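/- arXiv:1302.5812 — 4 statements merged into one kernel-verified Lean document; each statement's English description precedes it below -/
import Mathlib

section
/- Let a ∈ C⁰([0,T]; C¹([0,1])) with a(t,x) ≥ c > 0, let y_l ∈ C¹([0,T]) and y₀ ∈ C¹([0,1]) satisfy the compatibility conditions y_l(0) = y₀(0) and y_l'(0) + a(0,0)·y₀'(0) = 0. Define y(t,x) = y_l(e(t,x)) if the backward characteristic through (t,x) exits at x = 0 at time e(t,x) > 0 (off the characteristic through the origin), and y(t,x) = y₀(φ(0,t,x)) otherwise. Then y ∈ C¹([0,T]×[0,1]) is a strong solution of ∂_t y + a ∂_x y = 0 with y(t,0) = y_l(t) and y(0,x) = y₀(x). -/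
open Set Filter Topology MeasureTheory

theorem abs_le_exp_mul_abs_of_abs_deriv_le {D D' : ℝ → ℝ} {τ L : ℝ}
    (hD : ∀ s ∈ Icc 0 τ, HasDerivWithinAt D (D' s) (Icc 0 τ) s)
    (hL : ∀ s ∈ Icc 0 τ, |D' s| ≤ L * |D s|) {s : ℝ} (hs : s ∈ Icc 0 τ) :
    |D s| ≤ Real.exp (L * (τ - s)) * |D τ| ∧ |D τ| ≤ Real.exp (L * (τ - s)) * |D s| := by
  have hτ : τ ∈ Icc 0 τ := ⟨hs.1.trans hs.2, le_rfl⟩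
  have key : ∀ k : ℝ, ∀ r ∈ Icc 0 τ,
      HasDerivWithinAt (fun r => D r ^ 2 * Real.exp (2 * k * r))
        (2 * (D r * D' r + k * D r ^ 2) * Real.exp (2 * k * r)) (Icc 0 τ) r := by
    intro k r hr
    have h1 := (hD r hr).pow 2
    have h2 : HasDerivWithinAt (fun r => Real.exp (2 * k * r))
        (Real.exp (2 * k * r) * (2 * k)) (Icc 0 τ) r := by
      simpa using (((hasDerivAt_id r).const_mul (2 * k)).exp).hasDerivWithinAt
    refine (h1.mul h2).congr_deriv ?_
    push_cast
    simp only [Pi.pow_apply]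
    ring
  have bound : ∀ r ∈ Icc 0 τ, |D r * D' r| ≤ L * D r ^ 2 := by
    intro r hr
    rw [abs_mul, ← sq_abs (D r)]
    nlinarith [hL r hr, abs_nonneg (D r)]
  have mono : MonotoneOn (fun r => D r ^ 2 * Real.exp (2 * L * r)) (Icc 0 τ) := by
    refine monotoneOn_of_hasDerivWithinAt_nonneg (convex_Icc _ _)
      (fun r hr => (key L r hr).continuousWithinAt)
      (fun r hr => (key L r (interior_subset hr)).mono interior_subset) fun r hr => ?_
    have := (abs_le.1 (bound r (interior_subset hr))).1
    have := Real.exp_pos (2 * L * r)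
    apply mul_nonneg _ this.le
    linarith
  have anti : AntitoneOn (fun r => D r ^ 2 * Real.exp (2 * (-L) * r)) (Icc 0 τ) := by
    refine antitoneOn_of_hasDerivWithinAt_nonpos (convex_Icc _ _)
      (fun r hr => (key (-L) r hr).continuousWithinAt)
      (fun r hr => (key (-L) r (interior_subset hr)).mono interior_subset) fun r hr => ?_
    have := (abs_le.1 (bound r (interior_subset hr))).2
    have := Real.exp_pos (2 * (-L) * r)
    apply mul_nonpos_of_nonpos_of_nonneg _ this.le
    linarith
  have sq_exp : Real.exp (L * (τ - s)) ^ 2 = Real.exp (2 * L * τ) * Real.exp (2 * (-L) * s) := by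
    rw [← Real.exp_nat_mul, ← Real.exp_add]; congr 1; push_cast; ring
  have inv1 : Real.exp (2 * L * s) * Real.exp (2 * (-L) * s) = 1 := by
    rw [← Real.exp_add, ← Real.exp_zero]; congr 1; ring
  have inv2 : Real.exp (2 * L * τ) * Real.exp (2 * (-L) * τ) = 1 := by
    rw [← Real.exp_add, ← Real.exp_zero]; congr 1; ring
  have h1 := mul_le_mul_of_nonneg_right (mono hs hτ hs.2) (Real.exp_pos (2 * (-L) * s)).le
  have h2 := mul_le_mul_of_nonneg_right (anti hs hτ hs.2) (Real.exp_pos (2 * L * τ)).le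
  simp only at h1 h2
  constructor <;> refine abs_le_of_sq_le_sq' ?_ (by positivity) |>.2 <;>
    rw [mul_pow, sq_abs, sq_abs, sq_exp]
  · calc D s ^ 2 = D s ^ 2 * Real.exp (2 * L * s) * Real.exp (2 * (-L) * s) := by
          rw [mul_assoc, inv1, mul_one]
      _ ≤ _ := by linarith
  · calc D τ ^ 2 = D τ ^ 2 * Real.exp (2 * (-L) * τ) * Real.exp (2 * L * τ) := by
          rw [mul_assoc, mul_comm (Real.exp _), inv2, mul_one]
      _ ≤ _ := by linarith

theorem eq_mul_exp_neg_integral_div {D D' : ℝ → ℝ} {τ : ℝ} (hτ : 0 ≤ τ)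
    (hD : ∀ s ∈ Icc 0 τ, HasDerivWithinAt D (D' s) (Icc 0 τ) s)
    (hD' : ContinuousOn D' (Icc 0 τ)) (h0 : ∀ s ∈ Icc 0 τ, D s ≠ 0) :
    D 0 = D τ * Real.exp (-∫ s in (0 : ℝ)..τ, D' s / D s) := by
  have hc : ContinuousOn D (Icc 0 τ) := fun s hs => (hD s hs).continuousWithinAt
  have hint : ∫ s in (0 : ℝ)..τ, D' s / D s = Real.log (D τ) - Real.log (D 0) := by
    refine intervalIntegral.integral_eq_sub_of_hasDerivAt_of_le hτ (hc.log h0)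
      (fun s hs => ?_) ?_
    · exact ((hD s (Ioo_subset_Icc_self hs)).hasDerivAt (Icc_mem_nhds hs.1 hs.2)).log
        (h0 s (Ioo_subset_Icc_self hs))
    · exact (ContinuousOn.div hD' hc h0).intervalIntegrable_of_Icc hτ
  have hl : (0 : ℝ) ∈ Icc 0 τ := ⟨le_rfl, hτ⟩
  have hr : τ ∈ Icc 0 τ := ⟨hτ, le_rfl⟩
  have hsign : 0 < D 0 / D τ := by
    by_contra hneg
    have hmul : D 0 * D τ < 0 := by
      rcases lt_or_gt_of_ne (h0 0 hl) with h | h <;> rcases lt_or_gt_of_ne (h0 τ hr) with h' | h'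
      · exact absurd (div_pos_of_neg_of_neg h h') hneg
      · exact mul_neg_of_neg_of_pos h h'
      · exact mul_neg_of_pos_of_neg h h'
      · exact absurd (div_pos h h') hneg
    have : (0 : ℝ) ∈ D '' Icc 0 τ := by
      rcases mul_neg_iff.1 hmul with h | h
      · exact intermediate_value_Icc' hτ hc ⟨h.2.le, h.1.le⟩
      · exact intermediate_value_Icc hτ hc ⟨h.1.le, h.2.le⟩
    obtain ⟨s, hs, hs0⟩ := this
    exact h0 s hs hs0
  rw [hint, neg_sub, ← Real.log_div (h0 0 hl) (h0 τ hr), Real.exp_log hsign,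
    mul_div_cancel₀ _ (h0 τ hr)]

/-- `X p` is, for every `p = (t, x)` in `[0, T] × [0, 1]`, the backward characteristic through `p`
of a continuous velocity field `F` with `c ≤ F ≤ M`. The field is `L`-Lipschitz in space,
and `q` is its space derivative away from `x = 0` and to the left of `x = 1`. -/
structure IsBackwardFlow (T c M L : ℝ) (F q : ℝ → ℝ → ℝ) (X : ℝ × ℝ → ℝ → ℝ) : Prop where
  cont : Continuous fun z : ℝ × ℝ => F z.1 z.2
  pos : 0 < c
  le_field : ∀ s x, c ≤ F s x
  field_le : ∀ s x, F s x ≤ M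
  lip_nonneg : 0 ≤ L
  lip : ∀ s x x', |F s x - F s x'| ≤ L * |x - x'|
  measurable : Measurable fun z : ℝ × ℝ => q z.1 z.2
  bound : ∀ s x, |q s x| ≤ L
  hasDerivAt : ∀ s ∈ Ioo 0 T, ∀ x < 1, x ≠ 0 → HasDerivAt (F s) (q s x) x
  continuousAt : ∀ s, ∀ x ≠ 0, ContinuousAt (q s) x
  terminal : ∀ p ∈ Icc 0 T ×ˢ Icc (0 : ℝ) 1, X p p.1 = p.2
  ode : ∀ p ∈ Icc 0 T ×ˢ Icc (0 : ℝ) 1, ∀ s ∈ Icc 0 p.1,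
    HasDerivWithinAt (X p) (F s (X p s)) (Icc 0 p.1) s

/-- The backward characteristic `X p`, frozen outside of `[0, p.1]`. -/
def frozen (X : ℝ × ℝ → ℝ → ℝ) (p : ℝ × ℝ) (s : ℝ) : ℝ := X p (max 0 (min s p.1))

/-- The integrand of the logarithm of the space derivative of the first integral. -/
noncomputable def rate (q : ℝ → ℝ → ℝ) (X : ℝ × ℝ → ℝ → ℝ) (p : ℝ × ℝ) (s : ℝ) : ℝ :=
  (Iio p.1).indicator (fun s => q s (frozen X p s)) s

/-- The difference quotient of the field along two backward characteristics. -/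
noncomputable def quotientRate (F : ℝ → ℝ → ℝ) (X : ℝ × ℝ → ℝ → ℝ) (p₀ p : ℝ × ℝ) (s : ℝ) : ℝ :=
  (Iio (min p.1 p₀.1)).indicator
    (fun s => (F s (frozen X p s) - F s (frozen X p₀ s)) / (frozen X p s - frozen X p₀ s)) s

/-- The space derivative of the first integral `p ↦ X p 0`. -/
noncomputable def stretch (T : ℝ) (q : ℝ → ℝ → ℝ) (X : ℝ × ℝ → ℝ → ℝ) (p : ℝ × ℝ) : ℝ :=
  Real.exp (-∫ s in (0 : ℝ)..T, rate q X p s)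

theorem frozen_of_mem {X : ℝ × ℝ → ℝ → ℝ} {p : ℝ × ℝ} {s : ℝ} (hs : s ∈ Icc 0 p.1) :
    frozen X p s = X p s := by
  rw [frozen, min_eq_left hs.2, max_eq_right hs.1]

namespace IsBackwardFlow

variable {T c M L : ℝ} {F q : ℝ → ℝ → ℝ} {X : ℝ × ℝ → ℝ → ℝ}

theorem continuousOn (h : IsBackwardFlow T c M L F q X) {p : ℝ × ℝ}
    (hp : p ∈ Icc 0 T ×ˢ Icc (0 : ℝ) 1) : ContinuousOn (X p) (Icc 0 p.1) :=
  fun s hs => (h.ode p hp s hs).continuousWithinAt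

theorem continuous_frozen (h : IsBackwardFlow T c M L F q X) {p : ℝ × ℝ}
    (hp : p ∈ Icc 0 T ×ˢ Icc (0 : ℝ) 1) : Continuous (frozen X p) := by
  refine (h.continuousOn hp).comp_continuous (by fun_prop) fun s => ⟨le_max_left _ _, ?_⟩
  exact max_le hp.1.1 (min_le_right _ _)

theorem exists_sub_eq (h : IsBackwardFlow T c M L F q X) {p : ℝ × ℝ}
    (hp : p ∈ Icc 0 T ×ˢ Icc (0 : ℝ) 1) {s r : ℝ} (hs : 0 ≤ s) (hsr : s < r) (hr : r ≤ p.1) :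
    ∃ u ∈ Ioo s r, X p r - X p s = F u (X p u) * (r - s) := by
  obtain ⟨u, hu, hu'⟩ := exists_hasDerivAt_eq_slope (X p) (fun u => F u (X p u)) hsr
    ((h.continuousOn hp).mono (Icc_subset_Icc hs hr)) fun u hu =>
      (h.ode p hp u ⟨hs.trans hu.1.le, hu.2.le.trans hr⟩).hasDerivAt
        (Icc_mem_nhds (hs.trans_lt hu.1) (hu.2.trans_le hr))
  refine ⟨u, hu, ?_⟩
  rw [hu', div_mul_cancel₀ _ (sub_pos.2 hsr).ne']

theorem strictMonoOn (h : IsBackwardFlow T c M L F q X) {p : ℝ × ℝ}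
    (hp : p ∈ Icc 0 T ×ˢ Icc (0 : ℝ) 1) : StrictMonoOn (X p) (Icc 0 p.1) := by
  intro s hs r hr hsr
  obtain ⟨u, -, hu⟩ := h.exists_sub_eq hp hs.1 hsr hr.2
  have := mul_pos (h.pos.trans_le (h.le_field u (X p u))) (sub_pos.2 hsr)
  linarith

theorem abs_sub_terminal_le (h : IsBackwardFlow T c M L F q X) {p : ℝ × ℝ}
    (hp : p ∈ Icc 0 T ×ˢ Icc (0 : ℝ) 1) {s : ℝ} (hs : 0 ≤ s) (hsp : s ≤ p.1) :
    |X p s - p.2| ≤ M * (p.1 - s) := by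
  rcases hsp.eq_or_lt with rfl | hlt
  · simp [h.terminal p hp]
  · obtain ⟨u, -, hu⟩ := h.exists_sub_eq hp hs hlt le_rfl
    rw [h.terminal p hp] at hu
    have h1 := h.field_le u (X p u)
    have h2 := h.pos.trans_le (h.le_field u (X p u))
    rw [abs_sub_comm, hu, abs_of_nonneg (mul_nonneg h2.le (sub_pos.2 hlt).le)]
    exact mul_le_mul_of_nonneg_right h1 (sub_pos.2 hlt).le

theorem speed_bound_pos (h : IsBackwardFlow T c M L F q X) : 0 < M :=
  h.pos.trans_le ((h.le_field 0 0).trans (h.field_le 0 0))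

theorem exists_gap_eq (h : IsBackwardFlow T c M L F q X) {p p₀ : ℝ × ℝ}
    (hp : p ∈ Icc 0 T ×ˢ Icc (0 : ℝ) 1) (hp₀ : p₀ ∈ Icc 0 T ×ˢ Icc (0 : ℝ) 1) :
    ∃ w : ℝ × ℝ, |w.1 - p₀.1| ≤ |p.1 - p₀.1| ∧
      |w.2 - p₀.2| ≤ |p.2 - p₀.2| + M * |p.1 - p₀.1| ∧
      X p (min p.1 p₀.1) - X p₀ (min p.1 p₀.1)
        = (p.2 - p₀.2) - F w.1 w.2 * (p.1 - p₀.1) := by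
  have hM := h.speed_bound_pos
  rcases lt_trichotomy p.1 p₀.1 with hlt | heq | hgt
  · obtain ⟨u, hu, hu'⟩ := h.exists_sub_eq hp₀ hp.1.1 hlt le_rfl
    refine ⟨(u, X p₀ u), ?_, ?_, ?_⟩
    · rw [abs_sub_comm, abs_sub_comm p.1, abs_of_pos (sub_pos.2 hu.2),
        abs_of_pos (sub_pos.2 hlt)]
      linarith [hu.1]
    · have := h.abs_sub_terminal_le hp₀ (hp.1.1.trans hu.1.le) hu.2.le
      rw [abs_sub_comm p.1, abs_of_pos (sub_pos.2 hlt)]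
      have := mul_le_mul_of_nonneg_left (sub_le_sub_left hu.1.le p₀.1) hM.le
      linarith [abs_nonneg (p.2 - p₀.2)]
    · rw [min_eq_left hlt.le, h.terminal p hp]
      rw [h.terminal p₀ hp₀] at hu'
      linarith
  · refine ⟨p₀, by simp, by simp [heq], ?_⟩
    rw [heq, min_self, h.terminal p₀ hp₀, ← heq, h.terminal p hp]
    ring
  · obtain ⟨u, hu, hu'⟩ := h.exists_sub_eq hp hp₀.1.1 hgt le_rfl
    refine ⟨(u, X p u), ?_, ?_, ?_⟩
    · rw [abs_of_pos (sub_pos.2 hu.1), abs_of_pos (sub_pos.2 hgt)]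
      linarith [hu.2]
    · have h1 := h.abs_sub_terminal_le hp (hp₀.1.1.trans hu.1.le) hu.2.le
      rw [abs_of_pos (sub_pos.2 hgt)]
      have h2 := mul_le_mul_of_nonneg_left (sub_le_sub_left hu.1.le p.1) hM.le
      have h3 := abs_sub_le (X p u) p.2 p₀.2
      simp only
      linarith
    · rw [min_eq_right hgt.le, h.terminal p₀ hp₀]
      rw [h.terminal p hp] at hu'
      linarith

theorem hasDerivWithinAt_sub (h : IsBackwardFlow T c M L F q X) {p p₀ : ℝ × ℝ}
    (hp : p ∈ Icc 0 T ×ˢ Icc (0 : ℝ) 1) (hp₀ : p₀ ∈ Icc 0 T ×ˢ Icc (0 : ℝ) 1) {s : ℝ}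
    (hs : s ∈ Icc 0 (min p.1 p₀.1)) :
    HasDerivWithinAt (fun s => X p s - X p₀ s) (F s (X p s) - F s (X p₀ s))
      (Icc 0 (min p.1 p₀.1)) s :=
  ((h.ode p hp s ⟨hs.1, hs.2.trans (min_le_left _ _)⟩).mono
      (Icc_subset_Icc_right (min_le_left _ _))).sub
    ((h.ode p₀ hp₀ s ⟨hs.1, hs.2.trans (min_le_right _ _)⟩).mono
      (Icc_subset_Icc_right (min_le_right _ _)))

theorem abs_sub_le_exp_mul (h : IsBackwardFlow T c M L F q X) {p p₀ : ℝ × ℝ}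
    (hp : p ∈ Icc 0 T ×ˢ Icc (0 : ℝ) 1) (hp₀ : p₀ ∈ Icc 0 T ×ˢ Icc (0 : ℝ) 1) {s : ℝ}
    (hs : s ∈ Icc 0 (min p.1 p₀.1)) :
    |X p s - X p₀ s| ≤ Real.exp (L * T) * (|p.2 - p₀.2| + M * |p.1 - p₀.1|) := by
  obtain ⟨w, -, -, hw⟩ := h.exists_gap_eq hp hp₀
  have h1 := (abs_le_exp_mul_abs_of_abs_deriv_le
    (fun s hs => h.hasDerivWithinAt_sub hp hp₀ hs) (fun s _ => h.lip s _ _) hs).1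
  refine h1.trans (mul_le_mul ?_ ?_ (abs_nonneg _) (Real.exp_pos _).le)
  · refine Real.exp_le_exp.2 (mul_le_mul_of_nonneg_left ?_ h.lip_nonneg)
    linarith [min_le_left p.1 p₀.1, hp.1.2, hs.1]
  · rw [hw]
    refine (abs_sub _ _).trans (add_le_add le_rfl ?_)
    rw [abs_mul, abs_of_pos (h.pos.trans_le (h.le_field _ _))]
    exact mul_le_mul_of_nonneg_right (h.field_le _ _) (abs_nonneg _)

theorem tendsto_modulus (T L M : ℝ) (p₀ : ℝ × ℝ) :
    Tendsto (fun z : ℝ × ℝ => Real.exp (L * T) * (|z.2 - p₀.2| + M * |z.1 - p₀.1|))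
      (𝓝 p₀) (𝓝 0) :=
  Continuous.tendsto' (by fun_prop) _ _ (by simp)

theorem continuousOn_initial (h : IsBackwardFlow T c M L F q X) :
    ContinuousOn (fun p => X p 0) (Icc 0 T ×ˢ Icc (0 : ℝ) 1) := by
  intro p₀ hp₀
  rw [ContinuousWithinAt, tendsto_iff_norm_sub_tendsto_zero]
  refine squeeze_zero' (Eventually.of_forall fun _ => norm_nonneg _) ?_
    ((tendsto_modulus T L M p₀).mono_left nhdsWithin_le_nhds)
  filter_upwards [self_mem_nhdsWithin] with p hp
  exact h.abs_sub_le_exp_mul hp hp₀ ⟨le_rfl, le_min hp.1.1 hp₀.1.1⟩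

theorem tendsto_frozen (h : IsBackwardFlow T c M L F q X) {ι : Type*} {l : Filter ι}
    {p : ι → ℝ × ℝ} {p₀ : ℝ × ℝ} (hp : ∀ᶠ i in l, p i ∈ Icc 0 T ×ˢ Icc (0 : ℝ) 1)
    (hp₀ : p₀ ∈ Icc 0 T ×ˢ Icc (0 : ℝ) 1) (hlim : Tendsto p l (𝓝 p₀)) {s : ℝ}
    (hs : 0 ≤ s) (hs' : s < p₀.1) :
    Tendsto (fun i => frozen X (p i) s) l (𝓝 (frozen X p₀ s)) := by
  have h1 : Tendsto (fun i => (p i).1) l (𝓝 p₀.1) := (continuous_fst.tendsto p₀).comp hlim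
  rw [tendsto_iff_norm_sub_tendsto_zero]
  refine squeeze_zero' (Eventually.of_forall fun _ => norm_nonneg _) ?_
    ((tendsto_modulus T L M p₀).comp hlim)
  filter_upwards [hp, h1.eventually_const_lt hs'] with i hi hi'
  rw [frozen_of_mem ⟨hs, hi'.le⟩, frozen_of_mem ⟨hs, hs'.le⟩]
  exact h.abs_sub_le_exp_mul hi hp₀ ⟨hs, le_min hi'.le hs'.le⟩

theorem ae_ne (h : IsBackwardFlow T c M L F q X) {p : ℝ × ℝ}
    (hp : p ∈ Icc 0 T ×ˢ Icc (0 : ℝ) 1) :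
    ∀ᵐ s : ℝ, s ≠ p.1 ∧ (s ∈ Icc 0 p.1 → frozen X p s ≠ 0) := by
  have hsub : {s | s ∈ Icc 0 p.1 ∧ frozen X p s = 0}.Subsingleton := by
    intro s hs r hr
    have hs' := hs.2
    have hr' := hr.2
    rw [frozen_of_mem hs.1] at hs'
    rw [frozen_of_mem hr.1] at hr'
    exact (h.strictMonoOn hp).injOn hs.1 hr.1 (hs'.trans hr'.symm)
  have h1 : ∀ᵐ s : ℝ, s ∉ ({p.1} : Set ℝ) :=
    measure_eq_zero_iff_ae_notMem.1 (measure_singleton _)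
  have h2 : ∀ᵐ s : ℝ, s ∉ {s | s ∈ Icc 0 p.1 ∧ frozen X p s = 0} :=
    measure_eq_zero_iff_ae_notMem.1 (hsub.measure_zero _)
  filter_upwards [h1, h2] with s hs hs'
  exact ⟨hs, fun hmem h0 => hs' ⟨hmem, h0⟩⟩

theorem continuousOn_stretch (h : IsBackwardFlow T c M L F q X) (hT : 0 < T) :
    ContinuousOn (stretch T q X) (Icc 0 T ×ˢ Icc (0 : ℝ) 1) := by
  intro p₀ hp₀
  have hS : ∀ᶠ p in 𝓝[Icc 0 T ×ˢ Icc (0 : ℝ) 1] p₀, p ∈ Icc 0 T ×ˢ Icc (0 : ℝ) 1 :=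
    self_mem_nhdsWithin
  have hlim : Tendsto id (𝓝[Icc 0 T ×ˢ Icc (0 : ℝ) 1] p₀) (𝓝 p₀) :=
    tendsto_id.mono_left nhdsWithin_le_nhds
  have h1 : Tendsto (fun p : ℝ × ℝ => p.1) (𝓝[Icc 0 T ×ˢ Icc (0 : ℝ) 1] p₀) (𝓝 p₀.1) :=
    (continuous_fst.tendsto p₀).comp hlim
  refine (Real.continuous_exp.tendsto _).comp (Tendsto.neg ?_)
  refine intervalIntegral.tendsto_integral_filter_of_dominated_convergence (fun _ => L)
    ?_ ?_ (by simp) ?_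
  · filter_upwards [hS] with p hp
    exact ((h.measurable.comp (measurable_id.prodMk
      (h.continuous_frozen hp).measurable)).indicator measurableSet_Iio).aestronglyMeasurable
  · filter_upwards with p
    filter_upwards with s _
    rw [rate, Real.norm_eq_abs]
    by_cases hs : s ∈ Iio p.1
    · rw [indicator_of_mem hs]; exact h.bound _ _
    · rw [indicator_of_notMem hs, abs_zero]; exact h.lip_nonneg
  · filter_upwards [h.ae_ne hp₀] with s hs hsT
    rw [uIoc_of_le hT.le] at hsT
    rcases lt_or_gt_of_ne hs.1 with hlt | hgt
    · have hz := h.tendsto_frozen hS hp₀ hlim hsT.1.le hlt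
      have := (h.continuousAt s _ (hs.2 ⟨hsT.1.le, hlt.le⟩)).tendsto.comp hz
      rw [show rate q X p₀ s = q s (frozen X p₀ s) from indicator_of_mem (mem_Iio.2 hlt) _]
      refine this.congr' ?_
      filter_upwards [h1.eventually_const_lt hlt] with p hp
      exact (indicator_of_mem (mem_Iio.2 hp) (fun s => q s (frozen X p s))).symm
    · rw [show rate q X p₀ s = 0 from indicator_of_notMem (by simpa using hgt.le) _]
      refine tendsto_const_nhds.congr' ?_
      filter_upwards [h1.eventually_lt_const hgt] with p hp
      exact (indicator_of_notMem (by simpa using hp.le) (fun s => q s (frozen X p s))).symm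

theorem sub_ne_zero_of_gap (h : IsBackwardFlow T c M L F q X) {p p₀ : ℝ × ℝ}
    (hp : p ∈ Icc 0 T ×ˢ Icc (0 : ℝ) 1) (hp₀ : p₀ ∈ Icc 0 T ×ˢ Icc (0 : ℝ) 1)
    (hgap : X p (min p.1 p₀.1) - X p₀ (min p.1 p₀.1) ≠ 0) {s : ℝ}
    (hs : s ∈ Icc 0 (min p.1 p₀.1)) : X p s - X p₀ s ≠ 0 := by
  intro h0
  have := (abs_le_exp_mul_abs_of_abs_deriv_le
    (fun s hs => h.hasDerivWithinAt_sub hp hp₀ hs) (fun s _ => h.lip s _ _) hs).2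
  rw [h0, abs_zero, mul_zero] at this
  exact hgap (abs_nonpos_iff.1 this)

theorem initial_sub_eq (h : IsBackwardFlow T c M L F q X) {p p₀ : ℝ × ℝ}
    (hp : p ∈ Icc 0 T ×ˢ Icc (0 : ℝ) 1) (hp₀ : p₀ ∈ Icc 0 T ×ˢ Icc (0 : ℝ) 1)
    (hgap : X p (min p.1 p₀.1) - X p₀ (min p.1 p₀.1) ≠ 0) :
    X p 0 - X p₀ 0 = (X p (min p.1 p₀.1) - X p₀ (min p.1 p₀.1)) *
      Real.exp (-∫ s in (0 : ℝ)..T, quotientRate F X p₀ p s) := by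
  set τ := min p.1 p₀.1 with hτ
  have hτ0 : 0 ≤ τ := le_min hp.1.1 hp₀.1.1
  have hτT : τ ≤ T := (min_le_left _ _).trans hp.1.2
  have hcomp : ∀ p' ∈ Icc 0 T ×ˢ Icc (0 : ℝ) 1, τ ≤ p'.1 →
      ContinuousOn (fun s => F s (X p' s)) (Icc 0 τ) := fun p' hp' hle =>
    h.cont.comp_continuousOn
      (continuousOn_id.prodMk ((h.continuousOn hp').mono (Icc_subset_Icc_right hle)))
  have key := eq_mul_exp_neg_integral_div hτ0 (fun s hs => h.hasDerivWithinAt_sub hp hp₀ hs)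
    ((hcomp p hp (min_le_left _ _)).sub (hcomp p₀ hp₀ (min_le_right _ _)))
    fun s hs => h.sub_ne_zero_of_gap hp hp₀ hgap hs
  rw [key]
  congr 3
  rw [intervalIntegral.integral_of_le hτ0, intervalIntegral.integral_of_le (hτ0.trans hτT),
    integral_Ioc_eq_integral_Ioo, integral_Ioc_eq_integral_Ioo]
  have hmeas : MeasurableSet (Iio τ) := measurableSet_Iio
  simp only [quotientRate]
  rw [setIntegral_indicator hmeas]
  have hset : Ioo 0 T ∩ Iio τ = Ioo 0 τ := by
    rw [Ioo_inter_Iio, min_eq_right hτT]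
  rw [hset]
  refine setIntegral_congr_fun measurableSet_Ioo fun s hs => ?_
  rw [frozen_of_mem ⟨hs.1.le, hs.2.le.trans (min_le_left _ _)⟩,
    frozen_of_mem ⟨hs.1.le, hs.2.le.trans (min_le_right _ _)⟩]

theorem tendsto_exp_quotientRate (h : IsBackwardFlow T c M L F q X) (hT : 0 < T) {ι : Type*}
    {l : Filter ι} [l.IsCountablyGenerated]
    {p : ι → ℝ × ℝ} {p₀ : ℝ × ℝ} (hp : ∀ᶠ i in l, p i ∈ Icc 0 T ×ˢ Icc (0 : ℝ) 1)
    (hp₀ : p₀ ∈ Icc 0 T ×ˢ Icc (0 : ℝ) 1) (hlim : Tendsto p l (𝓝 p₀))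
    (hgap : ∀ᶠ i in l, X (p i) (min (p i).1 p₀.1) - X p₀ (min (p i).1 p₀.1) ≠ 0) :
    Tendsto (fun i => Real.exp (-∫ s in (0 : ℝ)..T, quotientRate F X p₀ (p i) s)) l
      (𝓝 (stretch T q X p₀)) := by
  have h1 : Tendsto (fun i => (p i).1) l (𝓝 p₀.1) := (continuous_fst.tendsto p₀).comp hlim
  refine (Real.continuous_exp.tendsto _).comp (Tendsto.neg ?_)
  refine intervalIntegral.tendsto_integral_filter_of_dominated_convergence (fun _ => L)
    ?_ ?_ (by simp) ?_
  · filter_upwards [hp] with i hi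
    have m1 := (h.continuous_frozen hi).measurable
    have m2 := (h.continuous_frozen hp₀).measurable
    have n1 := h.cont.measurable.comp (measurable_id.prodMk m1)
    have n2 := h.cont.measurable.comp (measurable_id.prodMk m2)
    exact (((n1.sub n2).div (m1.sub m2)).indicator measurableSet_Iio).aestronglyMeasurable
  · filter_upwards with i
    filter_upwards with s _
    rw [quotientRate, Real.norm_eq_abs]
    by_cases hs : s ∈ Iio (min (p i).1 p₀.1)
    · rw [indicator_of_mem hs, abs_div]
      exact div_le_of_le_mul₀ (abs_nonneg _) h.lip_nonneg (h.lip _ _ _)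
    · rw [indicator_of_notMem hs, abs_zero]; exact h.lip_nonneg
  · filter_upwards [h.ae_ne hp₀] with s hs hsT
    rw [uIoc_of_le hT.le] at hsT
    rcases lt_or_gt_of_ne hs.1 with hlt | hgt
    · have hz := h.tendsto_frozen hp hp₀ hlim hsT.1.le hlt
      have hone : frozen X p₀ s < 1 := by
        rw [frozen_of_mem ⟨hsT.1.le, hlt.le⟩]
        have := h.strictMonoOn hp₀ ⟨hsT.1.le, hlt.le⟩ ⟨hp₀.1.1, le_rfl⟩ hlt
        rw [h.terminal p₀ hp₀] at this
        exact this.trans_le hp₀.2.2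
      have hd := h.hasDerivAt s ⟨hsT.1, hlt.trans_le hp₀.1.2⟩ _ hone
        (hs.2 ⟨hsT.1.le, hlt.le⟩)
      have hne : ∀ᶠ i in l, frozen X (p i) s ∈ ({frozen X p₀ s}ᶜ : Set ℝ) := by
        filter_upwards [hp, hgap, h1.eventually_const_lt hlt] with i hi hg hi'
        have := h.sub_ne_zero_of_gap hi hp₀ hg (s := s) ⟨hsT.1.le, le_min hi'.le hlt.le⟩
        rw [mem_compl_singleton_iff, frozen_of_mem ⟨hsT.1.le, hlt.le⟩,
          frozen_of_mem ⟨hsT.1.le, hi'.le⟩]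
        exact sub_ne_zero.1 this
      have := (hasDerivAt_iff_tendsto_slope.1 hd).comp
        (tendsto_nhdsWithin_iff.2 ⟨hz, hne⟩)
      rw [show rate q X p₀ s = q s (frozen X p₀ s) from indicator_of_mem (mem_Iio.2 hlt) _]
      refine this.congr' ?_
      filter_upwards [h1.eventually_const_lt hlt] with i hi
      rw [quotientRate, indicator_of_mem (mem_Iio.2 (lt_min hi hlt)), Function.comp_apply,
        slope_def_field]
    · rw [show rate q X p₀ s = 0 from indicator_of_notMem (by simpa using hgt.le) _]
      refine tendsto_const_nhds.congr' ?_
      filter_upwards with i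
      exact (indicator_of_notMem
        (notMem_Iio.2 ((min_le_right _ _).trans hgt.le)) _).symm

theorem hasDerivWithinAt_space (h : IsBackwardFlow T c M L F q X) (hT : 0 < T) {t x : ℝ}
    (ht : t ∈ Icc 0 T) (hx : x ∈ Icc (0 : ℝ) 1) :
    HasDerivWithinAt (fun ξ => X (t, ξ) 0) (stretch T q X (t, x)) (Icc 0 1) x := by
  rw [hasDerivWithinAt_iff_tendsto_slope]
  have hgap : ∀ ξ ∈ Icc (0 : ℝ) 1, X (t, ξ) (min t t) - X (t, x) (min t t) = ξ - x := by
    intro ξ hξ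
    have h1 := h.terminal (t, ξ) ⟨ht, hξ⟩
    have h2 := h.terminal (t, x) ⟨ht, hx⟩
    simp only at h1 h2
    rw [min_self, h1, h2]
  have hmem : ∀ᶠ ξ in 𝓝[Icc 0 1 \ {x}] x, ξ ∈ Icc (0 : ℝ) 1 \ {x} := self_mem_nhdsWithin
  have hlim : Tendsto (fun ξ => (t, ξ)) (𝓝[Icc 0 1 \ {x}] x) (𝓝 (t, x)) :=
    ((continuous_const.prodMk continuous_id).tendsto x).mono_left nhdsWithin_le_nhds
  refine (h.tendsto_exp_quotientRate hT (p₀ := (t, x)) (hmem.mono fun ξ hξ => ⟨ht, hξ.1⟩)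
    ⟨ht, hx⟩ hlim (hmem.mono fun ξ hξ => ?_)).congr' ?_
  · rw [hgap ξ hξ.1]
    exact sub_ne_zero.2 hξ.2
  · filter_upwards [hmem] with ξ hξ
    have hne : ξ - x ≠ 0 := sub_ne_zero.2 hξ.2
    have := h.initial_sub_eq (p := (t, ξ)) (p₀ := (t, x)) ⟨ht, hξ.1⟩ ⟨ht, hx⟩
      (by rw [hgap ξ hξ.1]; exact hne)
    rw [hgap ξ hξ.1] at this
    rw [slope_def_field, this, mul_div_cancel_left₀ _ hne]

theorem hasDerivWithinAt_time (h : IsBackwardFlow T c M L F q X) (hT : 0 < T) {t x : ℝ}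
    (ht : t ∈ Icc 0 T) (hx : x ∈ Icc (0 : ℝ) 1) :
    HasDerivWithinAt (fun τ => X (τ, x) 0) (-F t x * stretch T q X (t, x)) (Icc 0 T) t := by
  rw [hasDerivWithinAt_iff_tendsto_slope]
  have hgap : ∀ τ : ℝ, ∃ w : ℝ × ℝ, τ ∈ Icc 0 T → |w.1 - t| ≤ |τ - t| ∧
      |w.2 - x| ≤ M * |τ - t| ∧
      X (τ, x) (min τ t) - X (t, x) (min τ t) = -F w.1 w.2 * (τ - t) := by
    intro τ
    by_cases hτ : τ ∈ Icc 0 T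
    · obtain ⟨w, h1, h2, h3⟩ := h.exists_gap_eq (p := (τ, x)) (p₀ := (t, x)) ⟨hτ, hx⟩ ⟨ht, hx⟩
      refine ⟨w, fun _ => ⟨h1, by simpa using h2, h3.trans (by ring)⟩⟩
    · exact ⟨0, fun h' => absurd h' hτ⟩
  choose w hw using hgap
  have hmem : ∀ᶠ τ in 𝓝[Icc 0 T \ {t}] t, τ ∈ Icc 0 T \ {t} := self_mem_nhdsWithin
  have hid : Tendsto (fun τ => τ) (𝓝[Icc 0 T \ {t}] t) (𝓝 t) :=
    tendsto_id.mono_left nhdsWithin_le_nhds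
  have hlim : Tendsto (fun τ => (τ, x)) (𝓝[Icc 0 T \ {t}] t) (𝓝 (t, x)) :=
    ((continuous_id.prodMk continuous_const).tendsto t).mono_left nhdsWithin_le_nhds
  have hne : ∀ τ ∈ Icc 0 T \ {t}, X (τ, x) (min τ t) - X (t, x) (min τ t) ≠ 0 := by
    intro τ hτ
    rw [(hw τ hτ.1).2.2]
    exact mul_ne_zero (neg_ne_zero.2 (h.pos.trans_le (h.le_field _ _)).ne')
      (sub_ne_zero.2 hτ.2)
  have hE := h.tendsto_exp_quotientRate hT (p₀ := (t, x)) (hmem.mono fun τ hτ => ⟨hτ.1, hx⟩)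
    ⟨ht, hx⟩ hlim (hmem.mono fun τ hτ => hne τ hτ)
  have hw1 : Tendsto (fun τ => (w τ).1) (𝓝[Icc 0 T \ {t}] t) (𝓝 t) := by
    rw [tendsto_iff_norm_sub_tendsto_zero]
    refine squeeze_zero' (Eventually.of_forall fun _ => norm_nonneg _)
      (hmem.mono fun τ hτ => (hw τ hτ.1).1) ?_
    exact (Continuous.tendsto' (f := fun τ : ℝ => |τ - t|) (by fun_prop) t 0 (by simp)).comp hid
  have hw2 : Tendsto (fun τ => (w τ).2) (𝓝[Icc 0 T \ {t}] t) (𝓝 x) := by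
    rw [tendsto_iff_norm_sub_tendsto_zero]
    refine squeeze_zero' (Eventually.of_forall fun _ => norm_nonneg _)
      (hmem.mono fun τ hτ => (hw τ hτ.1).2.1) ?_
    exact (Continuous.tendsto' (f := fun τ : ℝ => M * |τ - t|) (by fun_prop) t 0
      (by simp)).comp hid
  have hF : Tendsto (fun τ => F (w τ).1 (w τ).2) (𝓝[Icc 0 T \ {t}] t) (𝓝 (F t x)) :=
    (h.cont.tendsto (t, x)).comp (hw1.prodMk_nhds hw2)
  refine (hF.neg.mul hE).congr' ?_
  filter_upwards [hmem] with τ hτ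
  have := h.initial_sub_eq (p := (τ, x)) (p₀ := (t, x)) ⟨hτ.1, hx⟩ ⟨ht, hx⟩ (hne τ hτ)
  simp only [(hw τ hτ.1).2.2] at this
  have hτt : τ - t ≠ 0 := sub_ne_zero.2 hτ.2
  rw [slope_def_field, this]
  field_simp

end IsBackwardFlow

theorem hasDerivWithinAt_Icc_of_adjacent {g g' : ℝ → ℝ} {l m r : ℝ} (hlm : l ≤ m) (hmr : m ≤ r)
    (h₁ : ∀ s ∈ Icc l m, HasDerivWithinAt g (g' s) (Icc l m) s)
    (h₂ : ∀ s ∈ Icc m r, HasDerivWithinAt g (g' s) (Icc m r) s) {s : ℝ} (hs : s ∈ Icc l r) :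
    HasDerivWithinAt g (g' s) (Icc l r) s := by
  rcases lt_trichotomy s m with h | h | h
  · refine (h₁ s ⟨hs.1, h.le⟩).mono_of_mem_nhdsWithin ?_
    filter_upwards [self_mem_nhdsWithin, mem_nhdsWithin_of_mem_nhds (Iio_mem_nhds h)] with u hu hu'
    exact ⟨hu.1, le_of_lt hu'⟩
  · subst h
    rw [← Icc_union_Icc_eq_Icc hlm hmr]
    exact (h₁ s ⟨hlm, le_rfl⟩).union (h₂ s ⟨le_rfl, hmr⟩)
  · refine (h₂ s ⟨h.le, hs.2⟩).mono_of_mem_nhdsWithin ?_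
    filter_upwards [self_mem_nhdsWithin, mem_nhdsWithin_of_mem_nhds (Ioi_mem_nhds h)] with u hu hu'
    exact ⟨le_of_lt hu', hu.2⟩

theorem exists_orderIso_integral {k : ℝ → ℝ} {c : ℝ} (hk : Continuous k) (hc : 0 < c)
    (hck : ∀ s, c ≤ k s) :
    ∃ A : ℝ ≃o ℝ, (∀ u, A u = ∫ s in (0 : ℝ)..u, k s) ∧
      ∀ v, HasDerivAt A.symm (k (A.symm v))⁻¹ v := by
  have hd : ∀ u, HasDerivAt (fun u => ∫ s in (0 : ℝ)..u, k s) (k u) u := fun u =>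
    intervalIntegral.integral_hasDerivAt_right (hk.intervalIntegrable _ _)
      (hk.stronglyMeasurableAtFilter _ _) hk.continuousAt
  have hcont : Continuous (fun u => ∫ s in (0 : ℝ)..u, k s) :=
    continuous_iff_continuousAt.2 fun u => (hd u).continuousAt
  have hmono : StrictMono (fun u => ∫ s in (0 : ℝ)..u, k s) :=
    strictMono_of_hasDerivAt_pos hd fun u => hc.trans_le (hck u)
  have hlin : Monotone (fun u => (∫ s in (0 : ℝ)..u, k s) - c * u) := by
    refine monotone_of_hasDerivAt_nonneg (f' := fun u => k u - c) (fun u => ?_) fun u => ?_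
    · exact ((hd u).sub ((hasDerivAt_id u).const_mul c)).congr_deriv (by rw [mul_one])
    · exact sub_nonneg.2 (hck u)
  have htop : Tendsto (fun u => ∫ s in (0 : ℝ)..u, k s) atTop atTop := by
    refine tendsto_atTop_mono' _ ?_ (tendsto_id.const_mul_atTop hc)
    filter_upwards [eventually_ge_atTop 0] with u hu
    have := hlin hu
    simp only [intervalIntegral.integral_same, mul_zero, sub_zero] at this
    simp only [id]
    linarith
  have hbot : Tendsto (fun u => ∫ s in (0 : ℝ)..u, k s) atBot atBot := by
    refine tendsto_atBot_mono' _ ?_ (tendsto_id.const_mul_atBot hc)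
    filter_upwards [eventually_le_atBot 0] with u hu
    have := hlin hu
    simp only [intervalIntegral.integral_same, mul_zero, sub_zero] at this
    simp only [id]
    linarith
  let A := hmono.orderIsoOfSurjective _ (hcont.surjective htop hbot)
  refine ⟨A, fun _ => rfl, fun v => ?_⟩
  exact HasDerivAt.of_local_left_inverse A.symm.continuous.continuousAt (hd (A.symm v))
    (hc.trans_le (hck _)).ne' (Eventually.of_forall fun w => A.apply_symm_apply w)

/-- The projection of the real line onto `[0, r]`. -/
def clamp (r x : ℝ) : ℝ := max 0 (min x r)

theorem clamp_mem {r : ℝ} (hr : 0 ≤ r) (x : ℝ) : clamp r x ∈ Icc 0 r :=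
  ⟨le_max_left _ _, max_le hr (min_le_right _ _)⟩

theorem clamp_of_mem {r x : ℝ} (hx : x ∈ Icc 0 r) : clamp r x = x := by
  rw [clamp, min_eq_left hx.2, max_eq_right hx.1]

theorem clamp_of_nonpos {r x : ℝ} (hx : x ≤ 0) : clamp r x = 0 :=
  max_eq_left ((min_le_left _ _).trans hx)

@[fun_prop]
theorem continuous_clamp (r : ℝ) : Continuous (clamp r) := by
  unfold clamp; fun_prop

theorem abs_clamp_sub_le (r x x' : ℝ) : |clamp r x - clamp r x'| ≤ |x - x'| := by
  have h1 := abs_max_sub_max_le_max 0 (min x r) 0 (min x' r)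
  have h2 := abs_min_sub_min_le_max x r x' r
  rw [sub_self, abs_zero, max_eq_right (abs_nonneg (min x r - min x' r))] at h1
  rw [sub_self, abs_zero, max_eq_left (abs_nonneg (x - x'))] at h2
  exact h1.trans h2

/-- The extension of a field on `[0, T] × [0, 1]` which is constant along the projection. -/
def extendField (T : ℝ) (a : ℝ → ℝ → ℝ) (s x : ℝ) : ℝ := a (clamp T s) (clamp 1 x)

theorem extendField_of_mem {T : ℝ} (a : ℝ → ℝ → ℝ) {s x : ℝ} (hs : s ∈ Icc 0 T)
    (hx : x ∈ Icc (0 : ℝ) 1) : extendField T a s x = a s x := by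
  rw [extendField, clamp_of_mem hs, clamp_of_mem hx]

theorem continuous_extendField {T : ℝ} (hT : 0 ≤ T) {a : ℝ → ℝ → ℝ}
    (ha : ContinuousOn (fun p : ℝ × ℝ => a p.1 p.2) (Icc 0 T ×ˢ Icc 0 1)) :
    Continuous fun z : ℝ × ℝ => extendField T a z.1 z.2 :=
  ha.comp_continuous (f := fun z : ℝ × ℝ => (clamp T z.1, clamp 1 z.2)) (by fun_prop)
    fun z => ⟨clamp_mem hT _, clamp_mem zero_le_one _⟩

/-- The space derivative of `extendField T a` away from `x = 0` and for `x < 1`. -/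
noncomputable def extendDeriv (T : ℝ) (ax : ℝ → ℝ → ℝ) (s x : ℝ) : ℝ :=
  if 0 < x then extendField T ax s x else 0

theorem continuousAt_extendDeriv {T : ℝ} (hT : 0 ≤ T) {ax : ℝ → ℝ → ℝ}
    (hax : ContinuousOn (fun p : ℝ × ℝ => ax p.1 p.2) (Icc 0 T ×ˢ Icc 0 1))
    (s : ℝ) {x : ℝ} (hx : x ≠ 0) : ContinuousAt (extendDeriv T ax s) x := by
  rcases lt_or_gt_of_ne hx with h | h
  · refine (continuousAt_const (y := (0 : ℝ))).congr ?_
    filter_upwards [Iio_mem_nhds h] with u hu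
    exact (if_neg (not_lt.2 (le_of_lt hu))).symm
  · have : Continuous fun x => extendField T ax s x :=
      (continuous_extendField hT hax).comp (by fun_prop : Continuous fun x : ℝ => (s, x))
    refine this.continuousAt.congr ?_
    filter_upwards [Ioi_mem_nhds h] with u hu
    exact (if_pos hu).symm

theorem hasDerivAt_extendField {T : ℝ} {a ax : ℝ → ℝ → ℝ}
    (ha : ∀ t ∈ Icc (0:ℝ) T, ∀ x ∈ Icc (0:ℝ) 1, HasDerivWithinAt (a t) (ax t x) (Icc 0 1) x)
    {s x : ℝ} (hs : s ∈ Icc 0 T) (hx : x ≠ 0) (hx' : x < 1) :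
    HasDerivAt (extendField T a s) (extendDeriv T ax s x) x := by
  rcases lt_or_gt_of_ne hx with h | h
  · rw [extendDeriv, if_neg (not_lt.2 h.le)]
    refine (hasDerivAt_const x (extendField T a s 0)).congr_of_eventuallyEq ?_
    filter_upwards [Iio_mem_nhds h] with u hu
    rw [extendField, extendField, clamp_of_nonpos (le_of_lt hu), clamp_of_nonpos le_rfl]
  · rw [extendDeriv, if_pos h, extendField_of_mem _ hs ⟨h.le, hx'.le⟩]
    refine ((ha s hs x ⟨h.le, hx'.le⟩).hasDerivAt (Icc_mem_nhds h hx')).congr_of_eventuallyEq ?_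
    filter_upwards [Icc_mem_nhds h hx'] with u hu
    exact extendField_of_mem _ hs hu

/-- The characteristic `φ · t x` continued below its exit time by the boundary velocity. -/
noncomputable def continuedFlow (T : ℝ) (a : ℝ → ℝ → ℝ) (φ : ℝ → ℝ → ℝ → ℝ) (e : ℝ → ℝ → ℝ)
    (p : ℝ × ℝ) (s : ℝ) : ℝ :=
  if e p.1 p.2 ≤ s then φ s p.1 p.2 else ∫ σ in (e p.1 p.2)..s, extendField T a σ 0

theorem hasDerivWithinAt_continuedFlow {T : ℝ} {a : ℝ → ℝ → ℝ} {φ : ℝ → ℝ → ℝ → ℝ}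
    {e : ℝ → ℝ → ℝ} {p : ℝ × ℝ} (hT : 0 ≤ T)
    (ha : ContinuousOn (fun p : ℝ × ℝ => a p.1 p.2) (Icc 0 T ×ˢ Icc 0 1))
    (ha_nonneg : ∀ t ∈ Icc (0:ℝ) T, ∀ x ∈ Icc (0:ℝ) 1, 0 ≤ a t x)
    (hp : p.1 ≤ T) (he : e p.1 p.2 ∈ Icc 0 p.1)
    (hmem : ∀ s ∈ Icc (e p.1 p.2) p.1, φ s p.1 p.2 ∈ Icc (0 : ℝ) 1)
    (hode : ∀ s ∈ Icc (e p.1 p.2) p.1, HasDerivWithinAt (fun σ => φ σ p.1 p.2)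
      (a s (φ s p.1 p.2)) (Icc (e p.1 p.2) p.1) s)
    (hexit : 0 < e p.1 p.2 → φ (e p.1 p.2) p.1 p.2 = 0) {s : ℝ} (hs : s ∈ Icc 0 p.1) :
    HasDerivWithinAt (continuedFlow T a φ e p)
      (extendField T a s (continuedFlow T a φ e p s)) (Icc 0 p.1) s := by
  have hupper : ∀ s ∈ Icc (e p.1 p.2) p.1, continuedFlow T a φ e p s = φ s p.1 p.2 :=
    fun s hs => if_pos hs.1
  have h₂ : ∀ s ∈ Icc (e p.1 p.2) p.1, HasDerivWithinAt (continuedFlow T a φ e p)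
      (extendField T a s (continuedFlow T a φ e p s)) (Icc (e p.1 p.2) p.1) s := by
    intro s hs
    rw [hupper s hs, extendField_of_mem _ ⟨he.1.trans hs.1, hs.2.trans hp⟩ (hmem s hs)]
    exact (hode s hs).congr hupper (hupper s hs)
  rcases he.1.eq_or_lt with he0 | he0
  · rw [← he0] at h₂
    exact h₂ s hs
  have hk : Continuous fun σ => extendField T a σ 0 :=
    (continuous_extendField hT ha).comp (by fun_prop : Continuous fun σ : ℝ => (σ, (0 : ℝ)))
  have hlower : ∀ s ∈ Icc 0 (e p.1 p.2),
      continuedFlow T a φ e p s = ∫ σ in (e p.1 p.2)..s, extendField T a σ 0 := by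
    intro s hs
    rcases hs.2.eq_or_lt with rfl | hlt
    · rw [hupper _ ⟨le_rfl, he.2⟩, hexit he0, intervalIntegral.integral_same]
    · exact if_neg (not_le.2 hlt)
  refine hasDerivWithinAt_Icc_of_adjacent he.1 he.2 (fun s hs => ?_) h₂ hs
  have hnonpos : continuedFlow T a φ e p s ≤ 0 := by
    rw [hlower s hs, intervalIntegral.integral_symm, neg_nonpos]
    exact intervalIntegral.integral_nonneg hs.2 fun u _ =>
      ha_nonneg _ (clamp_mem hT _) _ (clamp_mem zero_le_one _)
  have hval : extendField T a s (continuedFlow T a φ e p s) = extendField T a s 0 := by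
    rw [extendField, clamp_of_nonpos hnonpos, extendField, clamp_of_nonpos le_rfl]
  rw [hval]
  exact (intervalIntegral.integral_hasDerivAt_right (hk.intervalIntegrable _ _)
    (hk.stronglyMeasurableAtFilter _ _) hk.continuousAt).hasDerivWithinAt.congr hlower (hlower s hs)

theorem exists_isBackwardFlow_continuedFlow {T c : ℝ} (hT : 0 < T) (hc : 0 < c)
    {a ax : ℝ → ℝ → ℝ}
    (ha_cont : ContinuousOn (fun p : ℝ × ℝ => a p.1 p.2) (Icc 0 T ×ˢ Icc 0 1))
    (hax_cont : ContinuousOn (fun p : ℝ × ℝ => ax p.1 p.2) (Icc 0 T ×ˢ Icc 0 1))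
    (ha_deriv : ∀ t ∈ Icc (0:ℝ) T, ∀ x ∈ Icc (0:ℝ) 1,
      HasDerivWithinAt (a t) (ax t x) (Icc 0 1) x)
    (ha_pos : ∀ t ∈ Icc (0:ℝ) T, ∀ x ∈ Icc (0:ℝ) 1, c ≤ a t x)
    {φ : ℝ → ℝ → ℝ → ℝ} {e : ℝ → ℝ → ℝ}
    (he : ∀ t ∈ Icc (0:ℝ) T, ∀ x ∈ Icc (0:ℝ) 1, e t x ∈ Icc 0 t)
    (hφ_init : ∀ t ∈ Icc (0:ℝ) T, ∀ x ∈ Icc (0:ℝ) 1, φ t t x = x)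
    (hφ_mem : ∀ t ∈ Icc (0:ℝ) T, ∀ x ∈ Icc (0:ℝ) 1,
      ∀ s ∈ Icc (e t x) t, φ s t x ∈ Icc (0:ℝ) 1)
    (hφ_ode : ∀ t ∈ Icc (0:ℝ) T, ∀ x ∈ Icc (0:ℝ) 1, ∀ s ∈ Icc (e t x) t,
      HasDerivWithinAt (fun σ => φ σ t x) (a s (φ s t x)) (Icc (e t x) t) s)
    (he_exit : ∀ t ∈ Icc (0:ℝ) T, ∀ x ∈ Icc (0:ℝ) 1, 0 < e t x → φ (e t x) t x = 0) :
    ∃ M L, IsBackwardFlow T c M L (extendField T a) (extendDeriv T ax)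
      (continuedFlow T a φ e) := by
  have hK : IsCompact (Icc 0 T ×ˢ Icc (0 : ℝ) 1) := isCompact_Icc.prod isCompact_Icc
  obtain ⟨M, hM⟩ := hK.exists_bound_of_continuousOn ha_cont
  obtain ⟨L, hL⟩ := hK.exists_bound_of_continuousOn hax_cont
  have hmem : ∀ s x, (clamp T s, clamp 1 x) ∈ Icc 0 T ×ˢ Icc (0 : ℝ) 1 := fun s x =>
    ⟨clamp_mem hT.le _, clamp_mem zero_le_one _⟩
  have hL0 : 0 ≤ L := (norm_nonneg _).trans (hL _ (hmem 0 0))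
  refine ⟨M, L, ?_⟩
  constructor
  case cont => exact continuous_extendField hT.le ha_cont
  case pos => exact hc
  case le_field => exact fun s x => ha_pos _ (hmem s x).1 _ (hmem s x).2
  case field_le => exact fun s x => (le_abs_self _).trans (hM _ (hmem s x))
  case lip_nonneg => exact hL0
  case lip =>
    intro s x x'
    refine ((convex_Icc (0 : ℝ) 1).norm_image_sub_le_of_norm_hasDerivWithin_le
      (fun u hu => ha_deriv _ (hmem s x).1 u hu)
      (fun u hu => hL (clamp T s, u) ⟨(hmem s x).1, hu⟩) (hmem s x').2 (hmem s x).2).trans ?_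
    exact mul_le_mul_of_nonneg_left (abs_clamp_sub_le _ _ _) hL0
  case measurable =>
    exact Measurable.ite (measurableSet_lt measurable_const measurable_snd)
      (continuous_extendField hT.le hax_cont).measurable measurable_const
  case bound =>
    intro s x
    rw [extendDeriv]
    split_ifs
    · exact hL _ (hmem s x)
    · rwa [abs_zero]
  case hasDerivAt =>
    exact fun s hs x hx hx' => hasDerivAt_extendField ha_deriv (Ioo_subset_Icc_self hs) hx' hx
  case continuousAt => exact fun s x hx => continuousAt_extendDeriv hT.le hax_cont s hx
  case terminal =>
    intro p hp
    rw [continuedFlow, if_pos (he _ hp.1 _ hp.2).2, hφ_init _ hp.1 _ hp.2]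
  case ode =>
    exact fun p hp s hs => hasDerivWithinAt_continuedFlow hT.le ha_cont
      (fun t ht x hx => hc.le.trans (ha_pos t ht x hx)) hp.1.2 (he _ hp.1 _ hp.2)
      (hφ_mem _ hp.1 _ hp.2) (hφ_ode _ hp.1 _ hp.2) (he_exit _ hp.1 _ hp.2) hs

/-- Boundary and initial data joined into one `C¹` function of the first integral. -/
theorem exists_joined_data {T c : ℝ} (hT : 0 ≤ T) (hc : 0 < c) {k : ℝ → ℝ} (hk : Continuous k)
    (hck : ∀ s, c ≤ k s) {yl y0 dyl dy0 : ℝ → ℝ}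
    (hyl : ∀ t ∈ Icc (0:ℝ) T, HasDerivWithinAt yl (dyl t) (Icc 0 T) t)
    (hy0 : ∀ x ∈ Icc (0:ℝ) 1, HasDerivWithinAt y0 (dy0 x) (Icc 0 1) x)
    (hdyl_cont : ContinuousOn dyl (Icc 0 T)) (hdy0_cont : ContinuousOn dy0 (Icc 0 1))
    (hcomp0 : yl 0 = y0 0) (hcomp1 : dyl 0 + k 0 * dy0 0 = 0) :
    ∃ (R : Set ℝ) (G g : ℝ → ℝ), Icc 0 1 ⊆ R ∧
      (∀ t ∈ Icc 0 T, -(∫ s in (0 : ℝ)..t, k s) ∈ R) ∧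
      ContinuousOn g R ∧ (∀ ξ ∈ R, HasDerivWithinAt G (g ξ) R ξ) ∧
      (∀ x ∈ Icc 0 1, G x = y0 x) ∧
      ∀ t ∈ Icc 0 T, G (-(∫ s in (0 : ℝ)..t, k s)) = yl t := by
  obtain ⟨A, hA, hB⟩ := exists_orderIso_integral hk hc hck
  have hA0 : A 0 = 0 := by rw [hA, intervalIntegral.integral_same]
  have hB0 : A.symm 0 = 0 := A.symm_apply_eq.2 hA0.symm
  have hAT : 0 ≤ A T := hA0 ▸ A.monotone hT
  have hBmem : ∀ ξ ∈ Icc (-A T) 0, A.symm (-ξ) ∈ Icc 0 T := by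
    intro ξ hξ
    constructor
    · rw [← hB0]; exact A.symm.monotone (neg_nonneg.2 hξ.2)
    · rw [← A.symm_apply_apply T]; exact A.symm.monotone (neg_le.1 hξ.1)
  have hAmem : ∀ t ∈ Icc 0 T, -A t ∈ Icc (-A T) 0 := fun t ht =>
    ⟨neg_le_neg (A.monotone ht.2), neg_nonpos.2 (hA0 ▸ A.monotone ht.1)⟩
  have hk0 : ∀ s, k s ≠ 0 := fun s => (hc.trans_le (hck s)).ne'
  let G : ℝ → ℝ := fun ξ => if 0 ≤ ξ then y0 ξ else yl (A.symm (-ξ))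
  let h : ℝ → ℝ := fun ξ => -dyl (A.symm (-ξ)) / k (A.symm (-ξ))
  let g : ℝ → ℝ := fun ξ => dy0 (max 0 ξ) + (h (min 0 ξ) - h 0)
  have hh0 : h 0 = dy0 0 := by
    simp only [h, neg_zero, hB0]
    rw [div_eq_iff (hk0 0)]
    linarith
  have hGu : ∀ ξ ∈ Icc (0 : ℝ) 1, G ξ = y0 ξ := fun ξ hξ => if_pos hξ.1
  have hGl : ∀ ξ ∈ Icc (-A T) 0, G ξ = yl (A.symm (-ξ)) := by
    intro ξ hξ
    rcases hξ.2.eq_or_lt with rfl | hlt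
    · rw [neg_zero, hB0, hcomp0]; exact if_pos le_rfl
    · exact if_neg (not_le.2 hlt)
  have hhcont : ContinuousOn h (Icc (-A T) 0) := by
    have hBc : Continuous fun ξ : ℝ => A.symm (-ξ) := A.symm.continuous.comp continuous_neg
    exact ((hdyl_cont.comp hBc.continuousOn hBmem).neg).div (hk.comp hBc).continuousOn
      fun ξ _ => hk0 _
  refine ⟨Icc (-A T) 1, G, g, Icc_subset_Icc_left (neg_nonpos.2 hAT), ?_, ?_, ?_, hGu, ?_⟩
  · intro t ht
    rw [← hA]
    exact ⟨(hAmem t ht).1, (hAmem t ht).2.trans zero_le_one⟩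
  · refine (hdy0_cont.comp (by fun_prop) fun ξ hξ => ?_).add
      ((hhcont.comp (by fun_prop) fun ξ hξ => ?_).sub continuousOn_const)
    · exact ⟨le_max_left _ _, max_le zero_le_one hξ.2⟩
    · exact ⟨le_min (neg_nonpos.2 hAT) hξ.1, min_le_left _ _⟩
  · intro ξ hξ
    refine hasDerivWithinAt_Icc_of_adjacent (neg_nonpos.2 hAT) zero_le_one
      (fun ξ hξ => ?_) (fun ξ hξ => ?_) hξ
    · have hgξ : g ξ = dyl (A.symm (-ξ)) * ((k (A.symm (-ξ)))⁻¹ * (-1)) := by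
        simp only [g, max_eq_left hξ.2, min_eq_right hξ.2, hh0, h]
        ring
      rw [hgξ]
      have hBd : HasDerivWithinAt (fun ξ => A.symm (-ξ)) ((k (A.symm (-ξ)))⁻¹ * (-1))
          (Icc (-A T) 0) ξ :=
        ((hB (-ξ)).comp ξ (hasDerivAt_neg ξ)).hasDerivWithinAt
      exact ((hyl _ (hBmem ξ hξ)).comp ξ hBd hBmem).congr hGl (hGl ξ hξ)
    · have hgξ : g ξ = dy0 ξ := by
        simp only [g, max_eq_right hξ.1, min_eq_left hξ.1, sub_self, add_zero]
      rw [hgξ]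
      exact (hy0 ξ hξ).congr hGu (hGu ξ hξ)
  · intro t ht
    rw [← hA, hGl _ (hAmem t ht), neg_neg, A.symm_apply_apply]


/-- Method of characteristics: under the compatibility conditions
`y_l(0) = y₀(0)` and `y_l'(0) + a(0,0)·y₀'(0) = 0`, the function defined by
`y(t,x) = y_l(e(t,x))` when the backward characteristic exits at `x = 0`
(`e(t,x) > 0`) and `y(t,x) = y₀(φ(0,t,x))` otherwise, is a C¹ strong solution of
`∂_t y + a ∂_x y = 0`, `y(t,0) = y_l(t)`, `y(0,x) = y₀(x)`. -/
theorem stmt_6 (T c : ℝ) (hT : 0 < T) (hc : 0 < c)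
    (a ax : ℝ → ℝ → ℝ)
    (ha_cont : ContinuousOn (fun p : ℝ × ℝ => a p.1 p.2) (Set.Icc 0 T ×ˢ Set.Icc 0 1))
    (hax_cont : ContinuousOn (fun p : ℝ × ℝ => ax p.1 p.2) (Set.Icc 0 T ×ˢ Set.Icc 0 1))
    (ha_deriv : ∀ t ∈ Set.Icc (0:ℝ) T, ∀ x ∈ Set.Icc (0:ℝ) 1,
      HasDerivWithinAt (a t) (ax t x) (Set.Icc 0 1) x)
    (ha_pos : ∀ t ∈ Set.Icc (0:ℝ) T, ∀ x ∈ Set.Icc (0:ℝ) 1, c ≤ a t x)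
    -- the flow and entrance time
    (φ : ℝ → ℝ → ℝ → ℝ) (e f : ℝ → ℝ → ℝ)
    (hef : ∀ t ∈ Set.Icc (0:ℝ) T, ∀ x ∈ Set.Icc (0:ℝ) 1,
      0 ≤ e t x ∧ e t x ≤ t ∧ t ≤ f t x ∧ f t x ≤ T)
    (hφ_init : ∀ t ∈ Set.Icc (0:ℝ) T, ∀ x ∈ Set.Icc (0:ℝ) 1, φ t t x = x)
    (hφ_mem : ∀ t ∈ Set.Icc (0:ℝ) T, ∀ x ∈ Set.Icc (0:ℝ) 1,
      ∀ s ∈ Set.Icc (e t x) (f t x), φ s t x ∈ Set.Icc (0:ℝ) 1)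
    (hφ_ode : ∀ t ∈ Set.Icc (0:ℝ) T, ∀ x ∈ Set.Icc (0:ℝ) 1,
      ∀ s ∈ Set.Icc (e t x) (f t x),
        HasDerivWithinAt (fun σ => φ σ t x) (a s (φ s t x)) (Set.Icc (e t x) (f t x)) s)
    (he_exit : ∀ t ∈ Set.Icc (0:ℝ) T, ∀ x ∈ Set.Icc (0:ℝ) 1,
      0 < e t x → φ (e t x) t x = 0)
    -- the data, of class C¹, with compatibility conditions
    (yl y0 dyl dy0 : ℝ → ℝ)
    (hyl : ∀ t ∈ Set.Icc (0:ℝ) T, HasDerivWithinAt yl (dyl t) (Set.Icc 0 T) t)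
    (hy0 : ∀ x ∈ Set.Icc (0:ℝ) 1, HasDerivWithinAt y0 (dy0 x) (Set.Icc 0 1) x)
    (hdyl_cont : ContinuousOn dyl (Set.Icc 0 T))
    (hdy0_cont : ContinuousOn dy0 (Set.Icc 0 1))
    (hcomp0 : yl 0 = y0 0)
    (hcomp1 : dyl 0 + a 0 0 * dy0 0 = 0)
    -- the function defined by the method of characteristics
    (y : ℝ → ℝ → ℝ)
    (hy : ∀ t ∈ Set.Icc (0:ℝ) T, ∀ x ∈ Set.Icc (0:ℝ) 1,
      y t x = if 0 < e t x then yl (e t x) else y0 (φ 0 t x)) :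
    ∃ yt yx : ℝ → ℝ → ℝ,
      ContinuousOn (fun p : ℝ × ℝ => yt p.1 p.2) (Set.Icc 0 T ×ˢ Set.Icc 0 1) ∧
      ContinuousOn (fun p : ℝ × ℝ => yx p.1 p.2) (Set.Icc 0 T ×ˢ Set.Icc 0 1) ∧
      (∀ t ∈ Set.Icc (0:ℝ) T, ∀ x ∈ Set.Icc (0:ℝ) 1,
        HasDerivWithinAt (fun τ => y τ x) (yt t x) (Set.Icc 0 T) t ∧
        HasDerivWithinAt (fun ξ => y t ξ) (yx t x) (Set.Icc 0 1) x ∧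
        yt t x + a t x * yx t x = 0) ∧
      (∀ t ∈ Set.Icc (0:ℝ) T, y t 0 = yl t) ∧
      (∀ x ∈ Set.Icc (0:ℝ) 1, y 0 x = y0 x) := by
  have he : ∀ t ∈ Icc (0:ℝ) T, ∀ x ∈ Icc (0:ℝ) 1, e t x ∈ Icc 0 t := fun t ht x hx =>
    ⟨(hef t ht x hx).1, (hef t ht x hx).2.1⟩
  have hsub : ∀ t ∈ Icc (0:ℝ) T, ∀ x ∈ Icc (0:ℝ) 1, Icc (e t x) t ⊆ Icc (e t x) (f t x) :=
    fun t ht x hx => Icc_subset_Icc_right (hef t ht x hx).2.2.1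
  obtain ⟨M, L, hX⟩ := exists_isBackwardFlow_continuedFlow hT hc ha_cont hax_cont ha_deriv ha_pos
    he hφ_init (fun t ht x hx s hs => hφ_mem t ht x hx s (hsub t ht x hx hs))
    (fun t ht x hx s hs => (hφ_ode t ht x hx s (hsub t ht x hx hs)).mono (hsub t ht x hx)) he_exit
  have hk : Continuous fun σ => extendField T a σ 0 :=
    hX.cont.comp (by fun_prop : Continuous fun σ : ℝ => (σ, (0 : ℝ)))
  have h00 : extendField T a 0 0 = a 0 0 :=
    extendField_of_mem _ ⟨le_rfl, hT.le⟩ ⟨le_rfl, zero_le_one⟩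
  obtain ⟨R, G, g, hR1, hR2, hg, hG, hG1, hG2⟩ := exists_joined_data hT.le hc hk
    (fun s => hX.le_field s 0) hyl hy0 hdyl_cont hdy0_cont hcomp0 (by rw [h00, hcomp1])
  have hξ : ∀ t ∈ Icc (0:ℝ) T, ∀ x ∈ Icc (0:ℝ) 1,
      continuedFlow T a φ e (t, x) 0 ∈ R ∧ y t x = G (continuedFlow T a φ e (t, x) 0) := by
    intro t ht x hx
    have hmem := he t ht x hx
    have hemem : e t x ∈ Icc 0 T := ⟨hmem.1, hmem.2.trans ht.2⟩
    rw [hy t ht x hx]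
    by_cases hpos : 0 < e t x
    · have hval : continuedFlow T a φ e (t, x) 0
          = -∫ s in (0 : ℝ)..(e t x), extendField T a s 0 := by
        rw [continuedFlow, if_neg (not_le.2 hpos), intervalIntegral.integral_symm]
      rw [hval, if_pos hpos]
      exact ⟨hR2 _ hemem, (hG2 _ hemem).symm⟩
    · have hval : continuedFlow T a φ e (t, x) 0 = φ 0 t x := if_pos (not_lt.1 hpos)
      have hφ0 := hφ_mem t ht x hx 0 ⟨not_lt.1 hpos, ht.1.trans (hef t ht x hx).2.2.1⟩
      rw [hval, if_neg hpos]
      exact ⟨hR1 hφ0, (hG1 _ hφ0).symm⟩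
  have hyx : ContinuousOn (fun p : ℝ × ℝ => g (continuedFlow T a φ e (p.1, p.2) 0)
      * stretch T (extendDeriv T ax) (continuedFlow T a φ e) (p.1, p.2))
      (Icc 0 T ×ˢ Icc 0 1) :=
    (hg.comp hX.continuousOn_initial fun p hp => (hξ p.1 hp.1 p.2 hp.2).1).mul (hX.continuousOn_stretch hT)
  refine ⟨fun t x => -a t x * (g (continuedFlow T a φ e (t, x) 0)
      * stretch T (extendDeriv T ax) (continuedFlow T a φ e) (t, x)),
    fun t x => g (continuedFlow T a φ e (t, x) 0)
      * stretch T (extendDeriv T ax) (continuedFlow T a φ e) (t, x),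
    ha_cont.neg.mul hyx, hyx, fun t ht x hx => ⟨?_, ?_, by ring⟩, fun t ht => ?_, fun x hx => ?_⟩
  · have hd := hX.hasDerivWithinAt_time hT ht hx
    rw [extendField_of_mem _ ht hx] at hd
    have := (hG _ (hξ t ht x hx).1).comp t hd fun τ hτ => (hξ τ hτ x hx).1
    exact (this.congr (fun τ hτ => (hξ τ hτ x hx).2) (hξ t ht x hx).2).congr_deriv (by ring)
  · have := (hG _ (hξ t ht x hx).1).comp x (hX.hasDerivWithinAt_space hT ht hx)
      fun ξ h' => (hξ t ht ξ h').1
    exact this.congr (fun ξ h' => (hξ t ht ξ h').2) (hξ t ht x hx).2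
  · have h0 : (0 : ℝ) ∈ Icc (0 : ℝ) 1 := ⟨le_rfl, zero_le_one⟩
    have hmem := he t ht 0 h0
    have het : e t 0 = t := by
      refine hmem.2.eq_or_lt.resolve_right fun hlt => ?_
      have hlt' := hX.strictMonoOn (p := (t, 0)) ⟨ht, h0⟩ hmem ⟨ht.1, le_rfl⟩ hlt
      rw [continuedFlow, if_pos le_rfl, continuedFlow, if_pos hmem.2, hφ_init t ht 0 h0] at hlt'
      exact hlt'.not_ge (hφ_mem t ht 0 h0 _ ⟨le_rfl, hmem.2.trans (hef t ht 0 h0).2.2.1⟩).1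
    rw [hy t ht 0 h0, het]
    rcases ht.1.eq_or_lt with rfl | hpos
    · rw [if_neg (lt_irrefl _), hφ_init 0 ht 0 h0, hcomp0]
    · exact if_pos hpos
  · have h0 : (0 : ℝ) ∈ Icc 0 T := ⟨le_rfl, hT.le⟩
    rw [hy 0 h0 x hx, if_neg (not_lt.2 (he 0 h0 x hx).2), hφ_init 0 h0 x hx]
end

section
/- (Energy/Gronwall uniqueness for the diagonal hyperbolic system) Let λ, μ : ℝ² → ℝ be C¹ with μ ≤ -c < 0 < c ≤ λ. Suppose (u¹,v¹) and (u²,v²) are two Lipschitz solutions on [0,T]×[0,1] of the system ∂_t u + λ(u,v)∂_x u = 0, ∂_t v + μ(u,v)∂_x v = 0 with the same boundary data u(t,0) = u_l(t), v(t,1) = v_r(t) and the same initial data u(0,·) = u₀, v(0,·) = v₀, with all solutions taking values in [-C₁,C₁]² and being C₃-Lipschitz. Then (u¹,v¹) = (u²,v²) on [0,T]×[0,1]. -/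
open MeasureTheory
open Set Filter Topology
open scoped NNReal

theorem LipschitzWith.integral_deriv_eq_sub {f : ℝ → ℝ} {K : ℝ≥0} (hf : LipschitzWith K f)
    (a b : ℝ) : ∫ x in a..b, deriv f x = f b - f a :=
  hf.lipschitzOnWith.absolutelyContinuousOnInterval.integral_deriv_eq_sub

theorem LipschitzWith.comp_prodMk_left {F : ℝ × ℝ → ℝ} {K : ℝ≥0} (hF : LipschitzWith K F) (s : ℝ) :
    LipschitzWith K (fun x => F (s, x)) := by
  simpa [Function.comp_def] using hF.comp (LipschitzWith.prodMk_left s)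

theorem LipschitzWith.comp_prodMk_right {F : ℝ × ℝ → ℝ} {K : ℝ≥0} (hF : LipschitzWith K F)
    (x : ℝ) : LipschitzWith K (fun s => F (s, x)) := by
  simpa [Function.comp_def] using hF.comp (LipschitzWith.prodMk_right x)

theorem integrable_deriv_snd {G : ℝ × ℝ → ℝ} {K : ℝ≥0} (hG : LipschitzWith K G)
    (μ : Measure (ℝ × ℝ)) [IsFiniteMeasure μ] :
    Integrable (fun p : ℝ × ℝ => deriv (fun ξ => G (p.1, ξ)) p.2) μ := by
  have hm : Measurable (fun p : ℝ × ℝ => deriv (fun ξ => G (p.1, ξ)) p.2) :=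
    measurable_deriv_with_param (f := fun s ξ => G (s, ξ)) hG.continuous
  exact Integrable.of_bound hm.aestronglyMeasurable K
    (ae_of_all _ fun p => norm_deriv_le_of_lipschitz (hG.comp_prodMk_left p.1))

theorem integrable_deriv_fst {F : ℝ × ℝ → ℝ} {K : ℝ≥0} (hF : LipschitzWith K F)
    (μ : Measure (ℝ × ℝ)) [IsFiniteMeasure μ] :
    Integrable (fun p : ℝ × ℝ => deriv (fun τ => F (τ, p.2)) p.1) μ := by
  have hm : Measurable (fun p : ℝ × ℝ => deriv (fun τ => F (τ, p.1)) p.2) :=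
    measurable_deriv_with_param (f := fun x τ => F (τ, x)) (hF.continuous.comp continuous_swap)
  exact Integrable.of_bound (hm.comp measurable_swap).aestronglyMeasurable K
    (ae_of_all _ fun p => norm_deriv_le_of_lipschitz (hF.comp_prodMk_right p.2))

/-- Integrating `∂ₜF + ∂ₓG ≤ K F` over `(0,t) × (0,1)` for Lipschitz `F`, `G` with favourable
boundary fluxes. -/
theorem integral_le_of_deriv_add_deriv_le {F G : ℝ × ℝ → ℝ} {KF KG : ℝ≥0}
    (hF : LipschitzWith KF F) (hG : LipschitzWith KG G) {K t : ℝ} (ht : 0 ≤ t)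
    (hF0 : ∀ x ∈ Icc (0 : ℝ) 1, F (0, x) = 0)
    (hG01 : ∀ s ∈ Icc (0 : ℝ) t, G (s, 0) ≤ G (s, 1))
    (hFG : ∀ᵐ p : ℝ × ℝ ∂(volume.restrict (Ioo (0 : ℝ) t ×ˢ Ioo (0 : ℝ) 1)),
      deriv (fun τ => F (τ, p.2)) p.1 + deriv (fun ξ => G (p.1, ξ)) p.2 ≤ K * F p) :
    ∫ x in (0 : ℝ)..1, F (t, x) ≤ K * ∫ s in (0 : ℝ)..t, ∫ x in (0 : ℝ)..1, F (s, x) := by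
  rw [Measure.volume_eq_prod, ← Measure.prod_restrict, Measure.restrict_congr_set Ioo_ae_eq_Ioc,
    Measure.restrict_congr_set Ioo_ae_eq_Ioc] at hFG
  set μ := (volume.restrict (Ioc (0 : ℝ) t)).prod (volume.restrict (Ioc (0 : ℝ) 1)) with hμ
  have hdF := integrable_deriv_fst hF μ
  have hdG := integrable_deriv_snd hG μ
  have hFi : Integrable F μ := by
    rw [hμ, Measure.prod_restrict]
    exact (hF.continuous.continuousOn.integrableOn_compact
      (isCompact_Icc.prod isCompact_Icc)).mono_set
      (prod_mono Ioc_subset_Icc_self Ioc_subset_Icc_self)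
  have key := integral_mono_ae (hdF.add hdG) (hFi.const_mul K) hFG
  simp only [Pi.add_apply] at key
  rw [integral_add hdF hdG, integral_const_mul, integral_prod_symm _ hdF, integral_prod _ hdG,
    integral_prod _ hFi] at key
  simp only [← intervalIntegral.integral_of_le ht,
    ← intervalIntegral.integral_of_le (zero_le_one (α := ℝ)),
    (hF.comp_prodMk_right _).integral_deriv_eq_sub,
    (hG.comp_prodMk_left _).integral_deriv_eq_sub] at key
  have h1 : ∫ x in (0 : ℝ)..1, (F (t, x) - F (0, x)) = ∫ x in (0 : ℝ)..1, F (t, x) := by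
    refine intervalIntegral.integral_congr fun x hx => ?_
    rw [uIcc_of_le zero_le_one] at hx
    simp [hF0 x hx]
  have h2 : 0 ≤ ∫ s in (0 : ℝ)..t, (G (s, 1) - G (s, 0)) :=
    intervalIntegral.integral_nonneg ht fun s hs => sub_nonneg.2 (hG01 s hs)
  linarith

/-- Grönwall's inequality for a Lipschitz energy density `F ≥ 0` with Lipschitz flux `G`. -/
theorem eq_zero_of_deriv_add_deriv_le {F G : ℝ × ℝ → ℝ} {KF KG : ℝ≥0}
    (hF : LipschitzWith KF F) (hG : LipschitzWith KG G) {K T : ℝ}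
    (hnn : ∀ p, 0 ≤ F p)
    (hF0 : ∀ x ∈ Icc (0 : ℝ) 1, F (0, x) = 0)
    (hG01 : ∀ s ∈ Icc (0 : ℝ) T, G (s, 0) ≤ G (s, 1))
    (hFG : ∀ᵐ p : ℝ × ℝ ∂(volume.restrict (Ioo (0 : ℝ) T ×ˢ Ioo (0 : ℝ) 1)),
      deriv (fun τ => F (τ, p.2)) p.1 + deriv (fun ξ => G (p.1, ξ)) p.2 ≤ K * F p) :
    ∀ t ∈ Icc (0 : ℝ) T, ∀ x ∈ Icc (0 : ℝ) 1, F (t, x) = 0 := by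
  set E : ℝ → ℝ := fun s => ∫ x in (0 : ℝ)..1, F (s, x) with hE
  have hEc : Continuous E :=
    intervalIntegral.continuous_parametric_intervalIntegral_of_continuous'
      (f := fun s x => F (s, x)) hF.continuous 0 1
  have hE0 : ∀ s, 0 ≤ E s := fun s =>
    intervalIntegral.integral_nonneg zero_le_one fun x _ => hnn _
  have hle : ∀ t ∈ Icc (0 : ℝ) T, E t ≤ K * ∫ s in (0 : ℝ)..t, E s := fun t ht =>
    integral_le_of_deriv_add_deriv_le hF hG ht.1 hF0
      (fun s hs => hG01 s ⟨hs.1, hs.2.trans ht.2⟩)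
      (ae_restrict_of_ae_restrict_of_subset
        (prod_mono (Ioo_subset_Ioo_right ht.2) subset_rfl) hFG)
  have hderiv : ∀ t, HasDerivAt (fun t => ∫ s in (0 : ℝ)..t, E s) (E t) t := fun t =>
    intervalIntegral.integral_hasDerivAt_right (hEc.intervalIntegrable _ _)
      (hEc.stronglyMeasurableAtFilter _ _) hEc.continuousAt
  have hI : ∀ t ∈ Icc (0 : ℝ) T, ∫ s in (0 : ℝ)..t, E s = 0 := by
    refine eq_zero_of_abs_deriv_le_mul_abs_self_of_eq_zero_right (f' := E) (K := K)
      (fun t _ => (hderiv t).continuousAt.continuousWithinAt)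
      (fun t _ => (hderiv t).hasDerivWithinAt) (by simp) fun t ht => ?_
    have hIt : 0 ≤ ∫ s in (0 : ℝ)..t, E s :=
      intervalIntegral.integral_nonneg ht.1 fun s _ => hE0 s
    rw [Real.norm_of_nonneg (hE0 t), Real.norm_of_nonneg hIt]
    exact hle t (Ico_subset_Icc_self ht)
  intro t ht x hx
  by_contra hne
  have hpos : 0 < E t := 
    intervalIntegral.integral_pos zero_lt_one (hF.comp_prodMk_left t).continuous.continuousOn
      (fun _ _ => hnn _) ⟨x, hx, (hnn _).lt_of_ne' hne⟩
  have := hle t ht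
  rw [hI t ht, mul_zero] at this
  exact absurd this (not_le.2 hpos)

theorem HasDerivAt.abs_le_of_abs_sub_le {f : ℝ → ℝ} {f' x a b C : ℝ} (hf : HasDerivAt f f' x)
    (hC : 0 ≤ C) (hx : x ∈ Ioo a b) (hlip : ∀ y ∈ Icc a b, |f y - f x| ≤ C * |y - x|) :
    |f'| ≤ C := by
  rw [← hf.deriv, ← Real.norm_eq_abs]
  refine norm_deriv_le_of_lip' hC ?_
  filter_upwards [Icc_mem_nhds hx.1 hx.2] with y hy using hlip y hy

/-- The contribution of one transport equation to the energy balance. -/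
theorem transport_energy_le {a b l₁ l₂ t₁ x₁ t₂ x₂ l' k C : ℝ} (hk : 0 ≤ k)
    (h₁ : t₁ + l₁ * x₁ = 0) (h₂ : t₂ + l₂ * x₂ = 0) (hl : |l₁ - l₂| ≤ k * (|a| + |b|))
    (hl' : |l'| ≤ k * C) (hx₂ : |x₂| ≤ C) :
    2 * a * (t₁ - t₂) + (l' * a ^ 2 + l₁ * (2 * a * (x₁ - x₂))) ≤
      4 * (k * C) * (a ^ 2 + b ^ 2) := by
  have hC : 0 ≤ C := (abs_nonneg _).trans hx₂
  have e : 2 * a * (t₁ - t₂) + (l' * a ^ 2 + l₁ * (2 * a * (x₁ - x₂))) =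
      l' * a ^ 2 - 2 * (a * ((l₁ - l₂) * x₂)) := by
    linear_combination 2 * a * h₁ - 2 * a * h₂
  have hA : l' * a ^ 2 ≤ k * C * a ^ 2 :=
    mul_le_mul_of_nonneg_right ((le_abs_self _).trans hl') (sq_nonneg a)
  have hB : |a * ((l₁ - l₂) * x₂)| ≤ |a| * (k * (|a| + |b|) * C) := by
    rw [abs_mul, abs_mul]; gcongr
  have hD : 2 * (|a| * (|a| + |b|)) ≤ 3 * a ^ 2 + b ^ 2 := by
    nlinarith [sq_nonneg (|a| - |b|), sq_abs a, sq_abs b]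
  have hkC : 0 ≤ k * C := by positivity
  have hE := mul_le_mul_of_nonneg_left hD hkC
  have hF : 0 ≤ k * C * b ^ 2 := by positivity
  have := neg_le_of_abs_le hB
  rw [e]
  linarith

theorem LipschitzOnWith.exists_lipschitzWith_comp_projIcc {α : Type*} [PseudoEMetricSpace α]
    {f : ℝ × ℝ → α} {K : ℝ≥0} {a b a' b' : ℝ} (h : a ≤ b) (h' : a' ≤ b')
    (hf : LipschitzOnWith K f (Icc a b ×ˢ Icc a' b')) :
    LipschitzWith K
      (fun p : ℝ × ℝ => f ((projIcc a b h p.1 : ℝ), (projIcc a' b' h' p.2 : ℝ))) := by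
  have h1 : LipschitzWith 1 (fun s => (projIcc a b h s : ℝ)) := by
    simpa [Function.comp_def] using (LipschitzWith.subtype_val _).comp (LipschitzWith.projIcc h)
  have h2 : LipschitzWith 1 (fun s => (projIcc a' b' h' s : ℝ)) := by
    simpa [Function.comp_def] using (LipschitzWith.subtype_val _).comp (LipschitzWith.projIcc h')
  have h3 : LipschitzWith 1
      (fun p : ℝ × ℝ => ((projIcc a b h p.1 : ℝ), (projIcc a' b' h' p.2 : ℝ))) := by
    simpa using (h1.comp LipschitzWith.prod_fst).prodMk (h2.comp LipschitzWith.prod_snd)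
  have := hf.comp (h3.lipschitzOnWith (s := univ)) fun p _ => ⟨Subtype.mem _, Subtype.mem _⟩
  simpa [Function.comp_def] using this

theorem projIcc_eventuallyEq {a b x : ℝ} (h : a ≤ b) (hx : x ∈ Ioo a b) :
    (fun y => (projIcc a b h y : ℝ)) =ᶠ[𝓝 x] id := by
  filter_upwards [Icc_mem_nhds hx.1 hx.2] with y hy
  simp [projIcc_of_mem h hy]

/-- Version of `eq_zero_of_deriv_add_deriv_le` for functions that are Lipschitz on the closed
rectangle only. -/
theorem eqOn_zero_of_hasDerivAt_add_le {F G : ℝ × ℝ → ℝ} {KF KG : ℝ≥0} {K T : ℝ} (hT : 0 ≤ T)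
    (hF : LipschitzOnWith KF F (Icc 0 T ×ˢ Icc 0 1))
    (hG : LipschitzOnWith KG G (Icc 0 T ×ˢ Icc 0 1))
    (hnn : ∀ p ∈ Icc (0 : ℝ) T ×ˢ Icc (0 : ℝ) 1, 0 ≤ F p)
    (hF0 : ∀ x ∈ Icc (0 : ℝ) 1, F (0, x) = 0)
    (hG01 : ∀ s ∈ Icc (0 : ℝ) T, G (s, 0) ≤ G (s, 1))
    (hFG : ∀ᵐ p : ℝ × ℝ ∂(volume.restrict (Ioo (0 : ℝ) T ×ˢ Ioo (0 : ℝ) 1)),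
      ∃ Ft Gx, HasDerivAt (fun τ => F (τ, p.2)) Ft p.1 ∧ HasDerivAt (fun ξ => G (p.1, ξ)) Gx p.2 ∧
        Ft + Gx ≤ K * F p) :
    ∀ t ∈ Icc (0 : ℝ) T, ∀ x ∈ Icc (0 : ℝ) 1, F (t, x) = 0 := by
  have h01 : (0 : ℝ) ≤ 1 := zero_le_one
  have key := eq_zero_of_deriv_add_deriv_le (K := K) (T := T)
    (hF.exists_lipschitzWith_comp_projIcc hT h01) (hG.exists_lipschitzWith_comp_projIcc hT h01)
    (fun p => hnn _ ⟨Subtype.mem _, Subtype.mem _⟩)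
    (fun x hx => by simpa [projIcc_of_mem h01 hx] using hF0 x hx)
    (fun s hs => by simpa [projIcc_of_mem hT hs] using hG01 s hs) ?_
  · intro t ht x hx
    simpa [projIcc_of_mem hT ht, projIcc_of_mem h01 hx] using key t ht x hx
  · filter_upwards [hFG, ae_restrict_mem (measurableSet_Ioo.prod measurableSet_Ioo)]
      with p ⟨Ft, Gx, hFt, hGx, hle⟩ hp
    have e1 := projIcc_of_mem hT (Ioo_subset_Icc_self hp.1)
    have e2 := projIcc_of_mem h01 (Ioo_subset_Icc_self hp.2)
    have hFt' := hFt.congr_of_eventuallyEq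
      (f₁ := fun τ => F ((projIcc 0 T hT τ : ℝ), (projIcc 0 1 h01 p.2 : ℝ))) (by
        filter_upwards [projIcc_eventuallyEq hT hp.1] with τ hτ
        rw [hτ, e2, id])
    have hGx' := hGx.congr_of_eventuallyEq
      (f₁ := fun ξ => G ((projIcc 0 T hT p.1 : ℝ), (projIcc 0 1 h01 ξ : ℝ))) (by
        filter_upwards [projIcc_eventuallyEq h01 hp.2] with ξ hξ
        rw [hξ, e1, id])
    rw [hFt'.deriv, hGx'.deriv]
    simpa [e1, e2] using hle

/-- Uniqueness of Lipschitz solutions for the diagonal hyperbolic system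
`∂_t u + λ(u,v)∂_x u = 0`, `∂_t v + μ(u,v)∂_x v = 0` with boundary data
`u(t,0) = u_l(t)`, `v(t,1) = v_r(t)` and initial data `u₀, v₀`, among solutions
taking values in `[-C₁,C₁]` and `C₃`-Lipschitz. -/
theorem stmt_11 (T c C₁ C₃ : ℝ) (hT : 0 < T) (hc : 0 < c) (hC₁ : 0 < C₁) (hC₃ : 0 < C₃)
    (lam mu : ℝ → ℝ → ℝ)
    (hlam : ContDiff ℝ 1 (fun p : ℝ × ℝ => lam p.1 p.2))
    (hmu : ContDiff ℝ 1 (fun p : ℝ × ℝ => mu p.1 p.2))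
    (hspeed : ∀ p q : ℝ, mu p q ≤ -c ∧ c ≤ lam p q)
    (ul vr u0 v0 : ℝ → ℝ)
    (u1 v1 u2 v2 : ℝ → ℝ → ℝ)
    (u1t u1x v1t v1x u2t u2x v2t v2x : ℝ × ℝ → ℝ)
    -- bounds and Lipschitz regularity of both solutions
    (hbd : ∀ t ∈ Set.Icc (0:ℝ) T, ∀ x ∈ Set.Icc (0:ℝ) 1,
      |u1 t x| ≤ C₁ ∧ |v1 t x| ≤ C₁ ∧ |u2 t x| ≤ C₁ ∧ |v2 t x| ≤ C₁)
    (hlip : ∀ t ∈ Set.Icc (0:ℝ) T, ∀ x ∈ Set.Icc (0:ℝ) 1,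
      ∀ t' ∈ Set.Icc (0:ℝ) T, ∀ x' ∈ Set.Icc (0:ℝ) 1,
      |u1 t x - u1 t' x'| ≤ C₃ * (|t - t'| + |x - x'|) ∧
      |v1 t x - v1 t' x'| ≤ C₃ * (|t - t'| + |x - x'|) ∧
      |u2 t x - u2 t' x'| ≤ C₃ * (|t - t'| + |x - x'|) ∧
      |v2 t x - v2 t' x'| ≤ C₃ * (|t - t'| + |x - x'|))
    -- the PDEs hold a.e. in `(0,T)×(0,1)` for both solutions
    (hpde1 : ∀ᵐ p : ℝ × ℝ ∂(volume.restrict (Set.Ioo (0:ℝ) T ×ˢ Set.Ioo (0:ℝ) 1)),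
      HasDerivAt (fun τ => u1 τ p.2) (u1t p) p.1 ∧
      HasDerivAt (fun ξ => u1 p.1 ξ) (u1x p) p.2 ∧
      HasDerivAt (fun τ => v1 τ p.2) (v1t p) p.1 ∧
      HasDerivAt (fun ξ => v1 p.1 ξ) (v1x p) p.2 ∧
      u1t p + lam (u1 p.1 p.2) (v1 p.1 p.2) * u1x p = 0 ∧
      v1t p + mu (u1 p.1 p.2) (v1 p.1 p.2) * v1x p = 0)
    (hpde2 : ∀ᵐ p : ℝ × ℝ ∂(volume.restrict (Set.Ioo (0:ℝ) T ×ˢ Set.Ioo (0:ℝ) 1)),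
      HasDerivAt (fun τ => u2 τ p.2) (u2t p) p.1 ∧
      HasDerivAt (fun ξ => u2 p.1 ξ) (u2x p) p.2 ∧
      HasDerivAt (fun τ => v2 τ p.2) (v2t p) p.1 ∧
      HasDerivAt (fun ξ => v2 p.1 ξ) (v2x p) p.2 ∧
      u2t p + lam (u2 p.1 p.2) (v2 p.1 p.2) * u2x p = 0 ∧
      v2t p + mu (u2 p.1 p.2) (v2 p.1 p.2) * v2x p = 0)
    -- identical boundary data and initial data
    (hbc : ∀ t ∈ Set.Icc (0:ℝ) T,
      u1 t 0 = ul t ∧ u2 t 0 = ul t ∧ v1 t 1 = vr t ∧ v2 t 1 = vr t)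
    (hic : ∀ x ∈ Set.Icc (0:ℝ) 1,
      u1 0 x = u0 x ∧ u2 0 x = u0 x ∧ v1 0 x = v0 x ∧ v2 0 x = v0 x) :
    ∀ t ∈ Set.Icc (0:ℝ) T, ∀ x ∈ Set.Icc (0:ℝ) 1,
      u1 t x = u2 t x ∧ v1 t x = v2 t x := by
  have hspec1 : ∀ p q, mu p q ≤ 0 := fun p q => (hspeed p q).1.trans (neg_nonpos.2 hc.le)
  have hspec2 : ∀ p q, 0 ≤ lam p q := fun p q => hc.le.trans (hspeed p q).2
  set R : Set (ℝ × ℝ) := Icc 0 T ×ˢ Icc 0 1 with hR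
  obtain ⟨kl, hkl⟩ := hlam.contDiffOn.exists_lipschitzOnWith one_ne_zero
    (convex_closedBall (0 : ℝ × ℝ) C₁) (isCompact_closedBall _ _)
  obtain ⟨km, hkm⟩ := hmu.contDiffOn.exists_lipschitzOnWith one_ne_zero
    (convex_closedBall (0 : ℝ × ℝ) C₁) (isCompact_closedBall _ _)
  set U : ℝ × ℝ → (ℝ × ℝ) × (ℝ × ℝ) :=
    fun p => ((u1 p.1 p.2, v1 p.1 p.2), (u2 p.1 p.2, v2 p.1 p.2)) with hU
  have hUlip : LipschitzOnWith (Real.toNNReal (2 * C₃)) U R := by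
    refine LipschitzOnWith.of_dist_le_mul fun p hp q hq => ?_
    rw [Real.coe_toNNReal _ (by positivity)]
    obtain ⟨h1, h2, h3, h4⟩ := hlip p.1 hp.1 p.2 hp.2 q.1 hq.1 q.2 hq.2
    have hle : C₃ * (|p.1 - q.1| + |p.2 - q.2|) ≤ 2 * C₃ * dist p q := by
      have a1 : |p.1 - q.1| ≤ dist p q := le_max_left _ _
      have a2 : |p.2 - q.2| ≤ dist p q := le_max_right _ _
      nlinarith
    simp only [hU, Prod.dist_eq, Real.dist_eq] at hle ⊢
    exact max_le (max_le (h1.trans hle) (h2.trans hle)) (max_le (h3.trans hle) (h4.trans hle))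
  have hmem1 : ∀ p ∈ R, (u1 p.1 p.2, v1 p.1 p.2) ∈ Metric.closedBall (0 : ℝ × ℝ) C₁ := by
    intro p hp
    obtain ⟨h1, h2, -, -⟩ := hbd p.1 hp.1 p.2 hp.2
    exact mem_closedBall_zero_iff.2 (max_le h1 h2)
  have hmem2 : ∀ p ∈ R, (u2 p.1 p.2, v2 p.1 p.2) ∈ Metric.closedBall (0 : ℝ × ℝ) C₁ := by
    intro p hp
    obtain ⟨-, -, h1, h2⟩ := hbd p.1 hp.1 p.2 hp.2
    exact mem_closedBall_zero_iff.2 (max_le h1 h2)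
  have hUmaps : MapsTo U R (Metric.closedBall 0 C₁) := fun p hp =>
    mem_closedBall_zero_iff.2 (max_le (mem_closedBall_zero_iff.1 (hmem1 p hp))
      (mem_closedBall_zero_iff.1 (hmem2 p hp)))
  have hcomp : ∀ Φ : (ℝ × ℝ) × (ℝ × ℝ) → ℝ, ContDiff ℝ 1 Φ →
      ∃ K, LipschitzOnWith K (Φ ∘ U) R := by
    intro Φ hΦ
    obtain ⟨K, hK⟩ := hΦ.contDiffOn.exists_lipschitzOnWith one_ne_zero
      (convex_closedBall (0 : (ℝ × ℝ) × (ℝ × ℝ)) C₁) (isCompact_closedBall _ _)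
    exact ⟨_, hK.comp hUlip hUmaps⟩
  obtain ⟨KF, hKF⟩ := hcomp (fun w => (w.1.1 - w.2.1) ^ 2 + (w.1.2 - w.2.2) ^ 2) (by fun_prop)
  obtain ⟨KG, hKG⟩ := hcomp (fun w => lam w.1.1 w.1.2 * (w.1.1 - w.2.1) ^ 2 +
      mu w.1.1 w.1.2 * (w.1.2 - w.2.2) ^ 2) (by
    have h1 : ContDiff ℝ 1 (fun w : (ℝ × ℝ) × (ℝ × ℝ) => lam w.1.1 w.1.2) :=
      hlam.comp contDiff_fst
    have h2 : ContDiff ℝ 1 (fun w : (ℝ × ℝ) × (ℝ × ℝ) => mu w.1.1 w.1.2) :=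
      hmu.comp contDiff_fst
    fun_prop)
  have hzero := eqOn_zero_of_hasDerivAt_add_le (K := 4 * (kl * C₃) + 4 * (km * C₃)) hT.le hKF hKG
    (fun p _ => by simp only [Function.comp_apply]; positivity)
    (fun x hx => by
      obtain ⟨h1, h2, h3, h4⟩ := hic x hx
      simp [hU, h1, h2, h3, h4])
    (fun s hs => by
      obtain ⟨h1, h2, h3, h4⟩ := hbc s hs
      simp only [Function.comp_apply, hU, h1, h2, h3, h4, sub_self]
      have a1 := mul_nonneg (hspec2 (u1 s 1) (vr s)) (sq_nonneg (u1 s 1 - u2 s 1))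
      have a2 := mul_nonpos_of_nonpos_of_nonneg (hspec1 (ul s) (v1 s 0))
        (sq_nonneg (v1 s 0 - v2 s 0))
      linarith) ?_
  · intro t ht x hx
    have h := hzero t ht x hx
    simp only [Function.comp_apply, hU] at h
    constructor <;> nlinarith [sq_nonneg (u1 t x - u2 t x), sq_nonneg (v1 t x - v2 t x)]
  filter_upwards [hpde1, hpde2, ae_restrict_mem (measurableSet_Ioo.prod measurableSet_Ioo)]
    with p ⟨hu1t, hu1x, hv1t, hv1x, hu1, hv1⟩ ⟨hu2t, hu2x, hv2t, hv2x, hu2, hv2⟩ hp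
  have hpR : p ∈ R := ⟨Ioo_subset_Icc_self hp.1, Ioo_subset_Icc_self hp.2⟩
  have hlipx : ∀ ξ ∈ Icc (0 : ℝ) 1, |u1 p.1 ξ - u1 p.1 p.2| ≤ C₃ * |ξ - p.2| ∧
      |v1 p.1 ξ - v1 p.1 p.2| ≤ C₃ * |ξ - p.2| ∧ |u2 p.1 ξ - u2 p.1 p.2| ≤ C₃ * |ξ - p.2| ∧
      |v2 p.1 ξ - v2 p.1 p.2| ≤ C₃ * |ξ - p.2| := fun ξ hξ => by
    simpa using hlip p.1 hpR.1 ξ hξ p.1 hpR.1 p.2 hpR.2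
  have speed : ∀ (g : ℝ × ℝ → ℝ) (k : ℝ≥0), ContDiff ℝ 1 g →
      LipschitzOnWith k g (Metric.closedBall 0 C₁) →
      (∃ g', HasDerivAt (fun ξ => g (u1 p.1 ξ, v1 p.1 ξ)) g' p.2 ∧ |g'| ≤ k * C₃) ∧
      |g (u1 p.1 p.2, v1 p.1 p.2) - g (u2 p.1 p.2, v2 p.1 p.2)| ≤
        k * (|u1 p.1 p.2 - u2 p.1 p.2| + |v1 p.1 p.2 - v2 p.1 p.2|) := by
    intro g k hg hk
    have hchain : HasDerivAt (fun ξ => g (u1 p.1 ξ, v1 p.1 ξ))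
        (fderiv ℝ g (u1 p.1 p.2, v1 p.1 p.2) (u1x p, v1x p)) p.2 :=
      (hg.differentiable one_ne_zero _).hasFDerivAt.comp_hasDerivAt p.2 (hu1x.prodMk hv1x)
    refine ⟨⟨_, hchain, hchain.abs_le_of_abs_sub_le (by positivity) hp.2 fun ξ hξ => ?_⟩, ?_⟩
    · have h := hk.dist_le_mul _ (hmem1 (p.1, ξ) ⟨hpR.1, hξ⟩) _ (hmem1 p hpR)
      have h' : dist (u1 p.1 ξ, v1 p.1 ξ) (u1 p.1 p.2, v1 p.1 p.2) ≤ C₃ * |ξ - p.2| :=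
        max_le (hlipx ξ hξ).1 (hlipx ξ hξ).2.1
      calc _ ≤ _ := h
        _ ≤ k * (C₃ * |ξ - p.2|) := by gcongr
        _ = _ := by ring
    · refine (hk.dist_le_mul _ (hmem1 p hpR) _ (hmem2 p hpR)).trans ?_
      gcongr
      exact max_le (le_add_of_nonneg_right (abs_nonneg _)) (le_add_of_nonneg_left (abs_nonneg _))
  obtain ⟨⟨l', hl', hl'le⟩, hlle⟩ := speed _ kl hlam hkl
  obtain ⟨⟨m', hm', hm'le⟩, hmle⟩ := speed _ km hmu hkm
  have hu2xle : |u2x p| ≤ C₃ := hu2x.abs_le_of_abs_sub_le hC₃.le hp.2 fun ξ hξ =>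
    (hlipx ξ hξ).2.2.1
  have hv2xle : |v2x p| ≤ C₃ := hv2x.abs_le_of_abs_sub_le hC₃.le hp.2 fun ξ hξ =>
    (hlipx ξ hξ).2.2.2
  have eu := transport_energy_le kl.2 hu1 hu2 hlle hl'le hu2xle
  have ev := transport_energy_le km.2 hv1 hv2
    (a := v1 p.1 p.2 - v2 p.1 p.2) (b := u1 p.1 p.2 - u2 p.1 p.2)
    (by rw [add_comm |_|]; exact hmle) hm'le hv2xle
  refine ⟨_, _, ((hu1t.sub hu2t).pow 2).add ((hv1t.sub hv2t).pow 2),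
    (hl'.mul ((hu1x.sub hu2x).pow 2)).add (hm'.mul ((hv1x.sub hv2x).pow 2)), ?_⟩
  simp only [Function.comp_apply, hU, Pi.sub_apply, Pi.pow_apply]
  norm_num
  simp only [NNReal.val_eq_coe] at eu ev
  linarith
end

section
/- (Finite-time extinction for the closed-loop system) Let λ, μ be smooth with μ ≤ -c < 0 < c ≤ λ, K > 0, γ ∈ (0,1). Suppose (u,v) is a Lipschitz solution on [0,T]×[0,1] of ∂_t u + λ(u,v)∂_x u = 0, ∂_t v + μ(u,v)∂_x v = 0, where T = 1/c + C₁^{1-γ}/((1-γ)K), u(t,0) = u_l(t) and v(t,1) = v_r(t) are solutions of the finite-time-stable ODEs w' = -K·sgn(w)|w|^γ with |u_l(0)| ≤ C₁, |v_r(0)| ≤ C₁. Then u(T,x) = v(T,x) = 0 for all x ∈ [0,1]. -/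
open MeasureTheory

/-- A nonzero solution of `w' = -K·sgn(w)|w|^γ` satisfies
`|w(t)|^{1-γ} = |w(0)|^{1-γ} - (1-γ)K t`, and hence it vanishes in finite time. -/
lemma eq_zero_of_hasDerivAt_neg_sign_mul_rpow {K γ C t : ℝ} {w : ℝ → ℝ} (hK : 0 < K)
    (hγ1 : γ < 1)
    (hw : ∀ t : ℝ, 0 ≤ t → HasDerivAt w (-K * Real.sign (w t) * |w t| ^ γ) t)
    (hw0 : |w 0| ≤ C) (ht : C ^ (1 - γ) / ((1 - γ) * K) ≤ t) : w t = 0 := by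
  have hγ : 0 < 1 - γ := by linarith
  have hC : 0 ≤ C := (abs_nonneg _).trans hw0
  have ht0 : 0 ≤ t := le_trans (by positivity) ht
  by_contra hne
  have hcont : ContinuousOn w (Set.Icc 0 t) := fun s hs =>
    (hw s hs.1).continuousAt.continuousWithinAt
  have hanti : AntitoneOn (fun s => w s ^ 2) (Set.Icc 0 t) := by
    refine antitoneOn_of_hasDerivWithinAt_nonpos (convex_Icc 0 t) (hcont.pow 2)
      (f' := fun s => 2 * w s * (-K * Real.sign (w s) * |w s| ^ γ)) ?_ ?_
    · intro s hs
      rw [interior_Icc] at hs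
      exact (((hw s hs.1.le).pow 2).congr_deriv (by simp)).hasDerivWithinAt
    · intro s _
      have h1 : Real.sign (w s) * w s = |w s| := by
        rcases lt_trichotomy (w s) 0 with h | h | h
        · simp [Real.sign_of_neg h, abs_of_neg h]
        · simp [h]
        · simp [Real.sign_of_pos h, abs_of_pos h]
      have h2 : 2 * w s * (-K * Real.sign (w s) * |w s| ^ γ)
          = -(2 * K * |w s| * |w s| ^ γ) := by rw [← h1]; ring
      rw [h2]
      exact neg_nonpos.2 (by positivity)
  have hne' : ∀ s ∈ Set.Icc 0 t, w s ≠ 0 := by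
    intro s hs h0
    have h := hanti hs (Set.right_mem_Icc.2 ht0) hs.2
    simp only [h0] at h
    exact hne (pow_eq_zero_iff two_ne_zero |>.1 (le_antisymm (by simpa using h) (sq_nonneg _)))
  have hderiv : ∀ s ∈ Set.Icc 0 t,
      HasDerivAt (fun s => |w s| ^ (1 - γ) + (1 - γ) * K * s) 0 s := by
    intro s hs
    have hpos : 0 < |w s| := abs_pos.2 (hne' s hs)
    have habs := (hasDerivAt_abs (hne' s hs)).comp s (hw s hs.1)
    have h := (habs.rpow_const (p := 1 - γ) (Or.inl hpos.ne')).add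
      ((hasDerivAt_id s).const_mul ((1 - γ) * K))
    have hpow : |w s| ^ γ * |w s| ^ (1 - γ - 1) = 1 := by
      rw [← Real.rpow_add hpos]; simp
    refine h.congr_deriv ?_
    have hsign : (SignType.sign (w s) : ℝ) * Real.sign (w s) = 1 := by
      rcases lt_or_gt_of_ne (hne' s hs) with h | h
      · simp [Real.sign_of_neg h, sign_neg h]
      · simp [Real.sign_of_pos h, sign_pos h]
    simp only [Function.comp]
    linear_combination (-(1 - γ) * K * |w s| ^ γ * |w s| ^ (1 - γ - 1)) * hsign
      - (1 - γ) * K * hpow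
  have hconst := constant_of_has_deriv_right_zero (a := 0) (b := t)
    (fun s hs => (hderiv s hs).continuousAt.continuousWithinAt)
    (fun s hs => (hderiv s ⟨hs.1, hs.2.le⟩).hasDerivWithinAt) t (Set.right_mem_Icc.2 ht0)
  have h1 : 0 < |w t| ^ (1 - γ) := Real.rpow_pos_of_pos (abs_pos.2 hne) _
  have h2 : |w 0| ^ (1 - γ) ≤ C ^ (1 - γ) := Real.rpow_le_rpow (abs_nonneg _) hw0 hγ.le
  rw [div_le_iff₀ (by positivity)] at ht
  simp only [mul_zero, add_zero] at hconst
  linarith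

lemma LocallyLipschitz.exists_lipschitzOnWith_Icc_prod {f : ℝ × ℝ → ℝ} (hf : LocallyLipschitz f)
    (a b c d : ℝ) : ∃ C, LipschitzOnWith C f (Set.Icc a b ×ˢ Set.Icc c d) :=
  hf.locallyLipschitzOn.exists_lipschitzOnWith_of_compact (isCompact_Icc.prod isCompact_Icc)

lemma LipschitzOnWith.section_snd {f : ℝ × ℝ → ℝ} {C : NNReal} {s t : Set ℝ}
    (hf : LipschitzOnWith C f (s ×ˢ t)) {x : ℝ} (hx : x ∈ s) :
    LipschitzOnWith C (fun y => f (x, y)) t := by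
  have h := hf.comp ((LipschitzWith.prodMk_left x).lipschitzOnWith (s := t))
    (fun y hy => ⟨hx, hy⟩)
  simpa [Function.comp_def] using h

/-- For a locally Lipschitz function, the derivative along the second coordinate is integrable on
rectangles, and the fundamental theorem of calculus holds in the second coordinate. -/
lemma LocallyLipschitz.integrableOn_deriv_snd {f : ℝ × ℝ → ℝ} (hf : LocallyLipschitz f)
    (a b c d : ℝ) :
    IntegrableOn (fun p : ℝ × ℝ => deriv (fun y => f (p.1, y)) p.2)
      (Set.Ioo a b ×ˢ Set.Ioo c d) := by
  obtain ⟨C, hC⟩ := hf.exists_lipschitzOnWith_Icc_prod a b c d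
  have hmeas : MeasurableSet (Set.Ioo a b ×ˢ Set.Ioo c d) := measurableSet_Ioo.prod measurableSet_Ioo
  refine Measure.integrableOn_of_bounded (M := C) ?_ ?_ ?_
  · rw [Measure.volume_eq_prod, Measure.prod_prod]
    simp [ENNReal.mul_eq_top]
  · exact aestronglyMeasurable_deriv_with_param (f := fun x y => f (x, y)) hf.continuous _
  · refine (ae_restrict_iff' hmeas).2 (.of_forall fun p hp => ?_)
    exact norm_deriv_le_of_lipschitzOn (Icc_mem_nhds hp.2.1 hp.2.2)
      (hC.section_snd (Set.Ioo_subset_Icc_self hp.1))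

lemma LocallyLipschitz.setIntegral_deriv_snd {f : ℝ × ℝ → ℝ} (hf : LocallyLipschitz f)
    {a b c d : ℝ} (hab : a ≤ b) (hcd : c ≤ d) :
    ∫ p in Set.Ioo a b ×ˢ Set.Ioo c d, deriv (fun y => f (p.1, y)) p.2
      = ∫ x in a..b, (f (x, d) - f (x, c)) := by
  obtain ⟨C, hC⟩ := hf.exists_lipschitzOnWith_Icc_prod a b c d
  rw [Measure.volume_eq_prod, setIntegral_prod _ (hf.integrableOn_deriv_snd a b c d),
    intervalIntegral.integral_of_le hab, integral_Ioc_eq_integral_Ioo]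
  refine setIntegral_congr_fun measurableSet_Ioo fun x hx => ?_
  have hlip := hC.section_snd (Set.Ioo_subset_Icc_self hx)
  rw [← Set.uIcc_of_le hcd] at hlip
  have h := hlip.absolutelyContinuousOnInterval.integral_deriv_eq_sub
  rwa [intervalIntegral.integral_of_le hcd, integral_Ioc_eq_integral_Ioo] at h

/-- The divergence inequality on a rectangle for locally Lipschitz fields. -/
lemma LocallyLipschitz.integral_boundary_nonpos {f g : ℝ × ℝ → ℝ} (hf : LocallyLipschitz f)
    (hg : LocallyLipschitz g) {a b c d : ℝ} (hab : a ≤ b) (hcd : c ≤ d)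
    (h : ∀ᵐ p : ℝ × ℝ ∂(volume.restrict (Set.Ioo a b ×ˢ Set.Ioo c d)),
      deriv (fun τ => f (τ, p.2)) p.1 + deriv (fun ξ => g (p.1, ξ)) p.2 ≤ 0) :
    (∫ x in c..d, (f (b, x) - f (a, x))) + ∫ t in a..b, (g (t, d) - g (t, c)) ≤ 0 := by
  have hf' : LocallyLipschitz (fun p : ℝ × ℝ => f (p.2, p.1)) :=
    hf.comp (LipschitzWith.prod_snd.prodMk LipschitzWith.prod_fst).locallyLipschitz
  have hfint : IntegrableOn (fun p : ℝ × ℝ => deriv (fun τ => f (τ, p.2)) p.1)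
      (Set.Ioo a b ×ˢ Set.Ioo c d) := (hf'.integrableOn_deriv_snd c d a b).swap
  have hswap := setIntegral_prod_swap (μ := volume) (ν := volume) (Set.Ioo c d) (Set.Ioo a b)
    (fun p : ℝ × ℝ => deriv (fun τ => f (τ, p.1)) p.2)
  rw [← Measure.volume_eq_prod] at hswap
  simp only [Prod.fst_swap, Prod.snd_swap] at hswap
  rw [← hf'.setIntegral_deriv_snd hcd hab, ← hg.setIntegral_deriv_snd hab hcd, ← hswap,
    ← integral_add hfint (hg.integrableOn_deriv_snd a b c d)]
  exact integral_nonpos_of_ae h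

/-- A locally Lipschitz solution of a transport equation with speed at least `c > 0` that vanishes
on the inflow boundary vanishes after the crossing time `1 / c`. -/
lemma transport_eq_zero_of_inflow_eq_zero {a u : ℝ × ℝ → ℝ} {c T : ℝ} (hc : 0 < c)
    (ha : LocallyLipschitz a) (hu : LocallyLipschitz u) (hac : ∀ p, c ≤ a p)
    (hpde : ∀ᵐ p : ℝ × ℝ ∂(volume.restrict (Set.Ioo (T - 1 / c) T ×ˢ Set.Ioo (0 : ℝ) 1)),
      DifferentiableAt ℝ (fun ξ => a (p.1, ξ)) p.2 ∧
      ∃ ut ux : ℝ, HasDerivAt (fun τ => u (τ, p.2)) ut p.1 ∧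
        HasDerivAt (fun ξ => u (p.1, ξ)) ux p.2 ∧ ut + a p * ux = 0)
    (hbc : ∀ t ∈ Set.Icc (T - 1 / c) T, u (t, 0) = 0) :
    ∀ x ∈ Set.Icc (0 : ℝ) 1, u (T, x) = 0 := by
  set t₀ := T - 1 / c with ht₀
  have htT : t₀ ≤ T := by
    have : 0 < 1 / c := by positivity
    linarith
  have hcT : c * (T - t₀) = 1 := by rw [ht₀]; field_simp; ring
  obtain ⟨L, hL⟩ := ha.exists_lipschitzOnWith_Icc_prod t₀ T 0 1
  set h := expNegInvGlue
  have hh1 : ContDiff ℝ 1 h := expNegInvGlue.contDiff (n := 1)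
  have hhd : Differentiable ℝ h := hh1.differentiable one_ne_zero
  set f : ℝ × ℝ → ℝ := fun p =>
    Real.exp (-(L * p.1)) * (h (c * (p.1 - t₀) - p.2) * u p ^ 2) with hfdef
  have hf : LocallyLipschitz f := by
    have hG : ContDiff ℝ 1 (fun q : (ℝ × ℝ) × ℝ =>
        Real.exp (-(L * q.1.1)) * (h (c * (q.1.1 - t₀) - q.1.2) * q.2 ^ 2)) := by
      fun_prop
    exact hG.locallyLipschitz.comp (LocallyLipschitz.id.prodMk hu)
  have hg : LocallyLipschitz (fun p => a p * f p) := by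
    have hG : ContDiff ℝ 1 (fun q : ℝ × ℝ => q.1 * q.2) := by fun_prop
    exact hG.locallyLipschitz.comp (ha.prodMk hf)
  have hf0 : ∀ p, 0 ≤ f p := fun p =>
    mul_nonneg (Real.exp_pos _).le (mul_nonneg (expNegInvGlue.nonneg _) (sq_nonneg _))
  have hmeas : MeasurableSet (Set.Ioo t₀ T ×ˢ Set.Ioo (0 : ℝ) 1) :=
    measurableSet_Ioo.prod measurableSet_Ioo
  have hdiv := hf.integral_boundary_nonpos hg htT zero_le_one (by
    filter_upwards [hpde, ae_restrict_mem hmeas] with p hp hpm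
    obtain ⟨hax, ut, ux, hut, hux, heq⟩ := hp
    have hLb : |deriv (fun ξ => a (p.1, ξ)) p.2| ≤ L :=
      norm_deriv_le_of_lipschitzOn (Icc_mem_nhds hpm.2.1 hpm.2.2)
        (hL.section_snd (Set.Ioo_subset_Icc_self hpm.1))
    set ax := deriv (fun ξ => a (p.1, ξ)) p.2 with haxdef
    set s := c * (p.1 - t₀) - p.2 with hs
    have hht : HasDerivAt (fun τ => h (c * (τ - t₀) - p.2)) (deriv h s * (c * 1)) p.1 :=
      HasDerivAt.comp p.1 (h₂ := h) (hhd s).hasDerivAt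
        ((((hasDerivAt_id p.1).sub_const t₀).const_mul c).sub_const p.2)
    have hhx : HasDerivAt (fun ξ => h (c * (p.1 - t₀) - ξ)) (deriv h s * (-1)) p.2 :=
      HasDerivAt.comp p.2 (h₂ := h) (hhd s).hasDerivAt
        ((hasDerivAt_id p.2).const_sub (c * (p.1 - t₀)))
    have het : HasDerivAt (fun τ : ℝ => Real.exp (-(L * τ)))
        (Real.exp (-(L * p.1)) * (-(L * 1))) p.1 :=
      (((hasDerivAt_id p.1).const_mul (L : ℝ)).neg).exp
    have hft := het.mul (hht.mul (hut.pow 2))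
    have hfx := hax.hasDerivAt.mul ((hhx.mul (hux.pow 2)).const_mul (Real.exp (-(L * p.1))))
    have e1 : deriv (fun τ => f (τ, p.2)) p.1 = _ := hft.deriv
    have e2 : deriv (fun ξ => a (p.1, ξ) * f (p.1, ξ)) p.2 = _ := hfx.deriv
    rw [e1, e2]
    have hmon : 0 ≤ deriv h s := expNegInvGlue.monotone.deriv_nonneg
    have hnn : 0 ≤ h s := expNegInvGlue.nonneg s
    have hE := Real.exp_pos (-(L * p.1))
    have hk1 : 0 ≤ Real.exp (-(L * p.1)) * (h s * u p ^ 2) * (L - ax) :=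
      mul_nonneg (by positivity) (by linarith [le_abs_self ax])
    have hk2 : 0 ≤ Real.exp (-(L * p.1)) * (deriv h s * u p ^ 2) * (a p - c) :=
      mul_nonneg (by positivity) (by linarith [hac p])
    simp only [Pi.mul_apply, Pi.pow_apply, Prod.mk.eta, ← hs, ← haxdef]
    refine le_of_sub_nonneg ?_
    refine (add_nonneg hk1 hk2).trans_eq ?_
    push_cast
    linear_combination (2 * Real.exp (-(L * p.1)) * h s * u p) * heq)
  have hbot : ∀ x ∈ Set.Icc (0 : ℝ) 1, f (t₀, x) = 0 := by
    intro x hx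
    have : h (c * (t₀ - t₀) - x) = 0 := expNegInvGlue.zero_of_nonpos (by simpa using hx.1)
    simp only [hfdef, this, zero_mul, mul_zero]
  have hleft : ∀ t ∈ Set.Icc t₀ T, f (t, 0) = 0 := by
    intro t ht
    simp [hfdef, hbc t ht]
  have hside : 0 ≤ ∫ t in t₀..T, (a (t, 1) * f (t, 1) - a (t, 0) * f (t, 0)) := by
    refine intervalIntegral.integral_nonneg htT fun t ht => ?_
    rw [hleft t ht, mul_zero, sub_zero]
    exact mul_nonneg (hc.le.trans (hac _)) (hf0 _)
  have hcongr : ∫ x in (0 : ℝ)..1, (f (T, x) - f (t₀, x)) = ∫ x in (0 : ℝ)..1, f (T, x) := by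
    refine intervalIntegral.integral_congr fun x hx => ?_
    rw [Set.uIcc_of_le zero_le_one] at hx
    simp [hbot x hx]
  rw [hcongr] at hdiv
  have hfT : ContinuousOn (fun x => f (T, x)) (Set.Icc 0 1) :=
    (hf.continuous.comp (Continuous.prodMk_right T)).continuousOn
  have hzero : ∀ x ∈ Set.Icc (0 : ℝ) 1, f (T, x) = 0 := by
    intro x hx
    by_contra hne
    have := intervalIntegral.integral_pos one_pos hfT (fun x _ => hf0 _)
      ⟨x, hx, lt_of_le_of_ne (hf0 _) (Ne.symm hne)⟩
    linarith
  have hlt : Set.EqOn (fun x => u (T, x)) 0 (Set.Ico 0 1) := by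
    intro x hx
    have hpos : 0 < h (c * (T - t₀) - x) := expNegInvGlue.pos_of_pos (by rw [hcT]; linarith [hx.2])
    have := hzero x ⟨hx.1, hx.2.le⟩
    simpa [hfdef, hpos.ne'] using this
  have hcl := hlt.closure (hu.continuous.comp (Continuous.prodMk_right T)) continuous_const
  rw [closure_Ico zero_ne_one] at hcl
  exact fun x hx => hcl hx

/-- The analogue of `transport_eq_zero_of_inflow_eq_zero` for leftward transport, with inflow
boundary on the right. -/
lemma transport_eq_zero_of_right_inflow_eq_zero {a u : ℝ × ℝ → ℝ} {c T : ℝ} (hc : 0 < c)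
    (ha : LocallyLipschitz a) (hu : LocallyLipschitz u) (hac : ∀ p, a p ≤ -c)
    (hpde : ∀ᵐ p : ℝ × ℝ ∂(volume.restrict (Set.Ioo (T - 1 / c) T ×ˢ Set.Ioo (0 : ℝ) 1)),
      DifferentiableAt ℝ (fun ξ => a (p.1, ξ)) p.2 ∧
      ∃ ut ux : ℝ, HasDerivAt (fun τ => u (τ, p.2)) ut p.1 ∧
        HasDerivAt (fun ξ => u (p.1, ξ)) ux p.2 ∧ ut + a p * ux = 0)
    (hbc : ∀ t ∈ Set.Icc (T - 1 / c) T, u (t, 1) = 0) :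
    ∀ x ∈ Set.Icc (0 : ℝ) 1, u (T, x) = 0 := by
  set R : ℝ × ℝ → ℝ × ℝ := fun p => (p.1, 1 - p.2) with hR
  have hRd : ContDiff ℝ 1 R := by fun_prop
  have hRlip := hRd.locallyLipschitz
  have hRmp : MeasurePreserving R volume volume :=
    (MeasurePreserving.id (volume : Measure ℝ)).prod (Measure.measurePreserving_sub_left volume (1 : ℝ))
  have hpre : R ⁻¹' (Set.Ioo (T - 1 / c) T ×ˢ Set.Ioo (0 : ℝ) 1)
      = Set.Ioo (T - 1 / c) T ×ˢ Set.Ioo (0 : ℝ) 1 := by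
    ext p
    simp only [hR, Set.mem_preimage, Set.mem_prod, Set.mem_Ioo]
    constructor <;> rintro ⟨h, h1, h2⟩ <;> exact ⟨h, by linarith, by linarith⟩
  have hRae := (hRmp.restrict_preimage
    (measurableSet_Ioo.prod measurableSet_Ioo)).quasiMeasurePreserving.ae hpde
  rw [hpre] at hRae
  have hneg : LocallyLipschitz (fun p => -a (R p)) :=
    (contDiff_neg (𝕜 := ℝ) (n := 1)).locallyLipschitz.comp (ha.comp hRlip)
  have key := transport_eq_zero_of_inflow_eq_zero (a := fun p => -a (R p)) (u := fun p => u (R p))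
    hc hneg (hu.comp hRlip) (fun p => by linarith [hac (R p)]) (by
      filter_upwards [hRae] with p hp
      obtain ⟨hax, ut, ux, hut, hux, heq⟩ := hp
      have hrefl : HasDerivAt (fun ξ : ℝ => 1 - ξ) (-1) p.2 := (hasDerivAt_id p.2).const_sub 1
      refine ⟨(hax.comp p.2 hrefl.differentiableAt).neg, ut, ux * -1, hut,
        HasDerivAt.comp p.2 (h₂ := fun ξ => u (p.1, ξ)) hux hrefl, ?_⟩
      linear_combination heq) (fun t ht => by simpa [hR] using hbc t ht)
  intro x hx
  simpa [hR] using key (1 - x) ⟨by linarith [hx.2], by linarith [hx.1]⟩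

/-- A function that is Lipschitz for the `ℓ¹` distance on a rectangle coincides there with a
locally Lipschitz function on the plane. -/
lemma exists_locallyLipschitz_extension {w : ℝ → ℝ → ℝ} {C a b c d : ℝ} (hC : 0 ≤ C)
    (h : ∀ t ∈ Set.Icc a b, ∀ x ∈ Set.Icc c d, ∀ t' ∈ Set.Icc a b, ∀ x' ∈ Set.Icc c d,
      |w t x - w t' x'| ≤ C * (|t - t'| + |x - x'|)) :
    ∃ W : ℝ × ℝ → ℝ, LocallyLipschitz W ∧
      ∀ t ∈ Set.Icc a b, ∀ x ∈ Set.Icc c d, W (t, x) = w t x := by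
  have hlip : LipschitzOnWith (2 * C).toNNReal (fun p : ℝ × ℝ => w p.1 p.2)
      (Set.Icc a b ×ˢ Set.Icc c d) := by
    refine LipschitzOnWith.of_dist_le_mul fun p hp q hq => ?_
    rw [Real.coe_toNNReal _ (by positivity), Real.dist_eq, Prod.dist_eq, Real.dist_eq, Real.dist_eq]
    refine (h _ hp.1 _ hp.2 _ hq.1 _ hq.2).trans ?_
    nlinarith [le_max_left |p.1 - q.1| |p.2 - q.2|, le_max_right |p.1 - q.1| |p.2 - q.2|]
  obtain ⟨W, hW, heq⟩ := hlip.extend_real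
  exact ⟨W, hW.locallyLipschitz, fun t ht x hx => (heq (Set.mk_mem_prod ht hx)).symm⟩

/-- Finite-time extinction for the closed-loop system: if `(u,v)` is a Lipschitz
solution of `∂_t u + λ(u,v)∂_x u = 0`, `∂_t v + μ(u,v)∂_x v = 0` on `[0,T]×[0,1]`,
with `T = 1/c + C₁^{1-γ}/((1-γ)K)`, whose boundary traces `u(·,0)` and `v(·,1)`
solve the finite-time stable ODE `w' = -K·sgn(w)|w|^γ` with initial data of
absolute value at most `C₁`, then `u(T,·) = v(T,·) = 0`. -/
theorem stmt_12 (c K C₁ C₃ γ : ℝ) (hc : 0 < c) (hK : 0 < K) (hC₁ : 0 < C₁)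
    (hC₃ : 0 < C₃) (hγ0 : 0 < γ) (hγ1 : γ < 1)
    (T : ℝ) (hTdef : T = 1 / c + C₁ ^ (1 - γ) / ((1 - γ) * K))
    (lam mu : ℝ → ℝ → ℝ)
    (hlam : ContDiff ℝ (⊤ : ℕ∞) (fun p : ℝ × ℝ => lam p.1 p.2))
    (hmu : ContDiff ℝ (⊤ : ℕ∞) (fun p : ℝ × ℝ => mu p.1 p.2))
    (hspeed : ∀ p q : ℝ, mu p q ≤ -c ∧ c ≤ lam p q)
    (u v : ℝ → ℝ → ℝ) (ut ux vt vx : ℝ × ℝ → ℝ)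
    -- Lipschitz regularity of the solution
    (hlip : ∀ t ∈ Set.Icc (0:ℝ) T, ∀ x ∈ Set.Icc (0:ℝ) 1,
      ∀ t' ∈ Set.Icc (0:ℝ) T, ∀ x' ∈ Set.Icc (0:ℝ) 1,
      |u t x - u t' x'| ≤ C₃ * (|t - t'| + |x - x'|) ∧
      |v t x - v t' x'| ≤ C₃ * (|t - t'| + |x - x'|))
    -- the PDEs hold a.e. in `(0,T)×(0,1)`
    (hpde : ∀ᵐ p : ℝ × ℝ ∂(volume.restrict (Set.Ioo (0:ℝ) T ×ˢ Set.Ioo (0:ℝ) 1)),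
      HasDerivAt (fun τ => u τ p.2) (ut p) p.1 ∧
      HasDerivAt (fun ξ => u p.1 ξ) (ux p) p.2 ∧
      HasDerivAt (fun τ => v τ p.2) (vt p) p.1 ∧
      HasDerivAt (fun ξ => v p.1 ξ) (vx p) p.2 ∧
      ut p + lam (u p.1 p.2) (v p.1 p.2) * ux p = 0 ∧
      vt p + mu (u p.1 p.2) (v p.1 p.2) * vx p = 0)
    -- boundary dynamics: finite-time stable ODEs
    (ul vr : ℝ → ℝ)
    (hul_ode : ∀ t : ℝ, 0 ≤ t → HasDerivAt ul (-K * Real.sign (ul t) * |ul t| ^ γ) t)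
    (hvr_ode : ∀ t : ℝ, 0 ≤ t → HasDerivAt vr (-K * Real.sign (vr t) * |vr t| ^ γ) t)
    (hul0 : |ul 0| ≤ C₁) (hvr0 : |vr 0| ≤ C₁)
    (hbc : ∀ t ∈ Set.Icc (0:ℝ) T, u t 0 = ul t ∧ v t 1 = vr t) :
    ∀ x ∈ Set.Icc (0:ℝ) 1, u T x = 0 ∧ v T x = 0 := by
  have hγ : 0 < 1 - γ := by linarith
  have ht₀ : T - 1 / c = C₁ ^ (1 - γ) / ((1 - γ) * K) := by rw [hTdef]; ring
  have ht₀pos : 0 ≤ T - 1 / c := by rw [ht₀]; positivity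
  have hT : 0 ≤ T := by
    have : 0 < 1 / c := by positivity
    linarith
  obtain ⟨U, hU, hUeq⟩ := exists_locallyLipschitz_extension hC₃.le
    fun t ht x hx t' ht' x' hx' => (hlip t ht x hx t' ht' x' hx').1
  obtain ⟨V, hV, hVeq⟩ := exists_locallyLipschitz_extension hC₃.le
    fun t ht x hx t' ht' x' hx' => (hlip t ht x hx t' ht' x' hx').2
  have hsmooth : ∀ {F : ℝ → ℝ → ℝ}, ContDiff ℝ (⊤ : ℕ∞) (fun p : ℝ × ℝ => F p.1 p.2) →
      LocallyLipschitz (fun p => F (U p) (V p)) := fun hF =>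
    (hF.of_le (by exact_mod_cast le_top)).locallyLipschitz.comp (hU.prodMk hV)
  have hsub : Set.Ioo (T - 1 / c) T ×ˢ Set.Ioo (0 : ℝ) 1 ⊆ Set.Ioo 0 T ×ˢ Set.Ioo 0 1 :=
    Set.prod_mono (Set.Ioo_subset_Ioo_left ht₀pos) subset_rfl
  have hmeas : MeasurableSet (Set.Ioo (T - 1 / c) T ×ˢ Set.Ioo (0 : ℝ) 1) :=
    measurableSet_Ioo.prod measurableSet_Ioo
  have hae : ∀ᵐ p : ℝ × ℝ ∂(volume.restrict (Set.Ioo (T - 1 / c) T ×ˢ Set.Ioo (0 : ℝ) 1)),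
      HasDerivAt (fun τ => U (τ, p.2)) (ut p) p.1 ∧
      HasDerivAt (fun ξ => U (p.1, ξ)) (ux p) p.2 ∧
      HasDerivAt (fun τ => V (τ, p.2)) (vt p) p.1 ∧
      HasDerivAt (fun ξ => V (p.1, ξ)) (vx p) p.2 ∧
      ut p + lam (U p) (V p) * ux p = 0 ∧
      vt p + mu (U p) (V p) * vx p = 0 := by
    filter_upwards [ae_restrict_of_ae_restrict_of_subset hsub hpde, ae_restrict_mem hmeas]
      with p hp hpm
    obtain ⟨h1, h2, h3, h4, h5, h6⟩ := hp
    have hpm' := hsub hpm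
    have hm1 := Set.Ioo_subset_Icc_self hpm'.1
    have hm2 := Set.Ioo_subset_Icc_self hpm'.2
    have hn1 : ∀ᶠ τ in nhds p.1, τ ∈ Set.Icc 0 T := Icc_mem_nhds hpm'.1.1 hpm'.1.2
    have hn2 : ∀ᶠ ξ in nhds p.2, ξ ∈ Set.Icc (0 : ℝ) 1 := Icc_mem_nhds hpm'.2.1 hpm'.2.2
    rw [← hUeq _ hm1 _ hm2, ← hVeq _ hm1 _ hm2] at h5 h6
    exact ⟨h1.congr_of_eventuallyEq (hn1.mono fun τ hτ => hUeq τ hτ _ hm2),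
      h2.congr_of_eventuallyEq (hn2.mono fun ξ hξ => hUeq _ hm1 ξ hξ),
      h3.congr_of_eventuallyEq (hn1.mono fun τ hτ => hVeq τ hτ _ hm2),
      h4.congr_of_eventuallyEq (hn2.mono fun ξ hξ => hVeq _ hm1 ξ hξ), h5, h6⟩
  have hspeed_diff : ∀ {F : ℝ → ℝ → ℝ} {p : ℝ × ℝ},
      ContDiff ℝ (⊤ : ℕ∞) (fun p : ℝ × ℝ => F p.1 p.2) →
      DifferentiableAt ℝ (fun ξ => U (p.1, ξ)) p.2 →
      DifferentiableAt ℝ (fun ξ => V (p.1, ξ)) p.2 →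
      DifferentiableAt ℝ (fun ξ => F (U (p.1, ξ)) (V (p.1, ξ))) p.2 := fun hF h1 h2 =>
    DifferentiableAt.comp _ (hF.differentiable (by simp) _) (h1.prodMk h2)
  have hmem : ∀ t ∈ Set.Icc (T - 1 / c) T, t ∈ Set.Icc 0 T := fun t ht =>
    ⟨ht₀pos.trans ht.1, ht.2⟩
  have hu0 := transport_eq_zero_of_inflow_eq_zero hc (hsmooth hlam) hU
    (fun p => (hspeed _ _).2) (by
      filter_upwards [hae] with p ⟨h1, h2, _, h4, h5, _⟩
      exact ⟨hspeed_diff hlam h2.differentiableAt h4.differentiableAt, _, _, h1, h2, h5⟩)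
    (fun t ht => by
      rw [hUeq t (hmem t ht) 0 (by simp), (hbc t (hmem t ht)).1]
      exact eq_zero_of_hasDerivAt_neg_sign_mul_rpow hK hγ1 hul_ode hul0 (ht₀ ▸ ht.1))
  have hv0 := transport_eq_zero_of_right_inflow_eq_zero hc (hsmooth hmu) hV
    (fun p => (hspeed _ _).1) (by
      filter_upwards [hae] with p ⟨_, h2, h3, h4, _, h6⟩
      exact ⟨hspeed_diff hmu h2.differentiableAt h4.differentiableAt, _, _, h3, h4, h6⟩)
    (fun t ht => by
      rw [hVeq t (hmem t ht) 1 (by simp), (hbc t (hmem t ht)).2]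
      exact eq_zero_of_hasDerivAt_neg_sign_mul_rpow hK hγ1 hvr_ode hvr0 (ht₀ ▸ ht.1))
  have hTm : T ∈ Set.Icc 0 T := ⟨hT, le_rfl⟩
  exact fun x hx => ⟨hUeq T hTm x hx ▸ hu0 x hx, hVeq T hTm x hx ▸ hv0 x hx⟩
end

section
/- Let λ, μ be smooth with μ ≤ -c < 0 < c ≤ λ, and set M₁ = max of ‖λ‖, ‖μ‖ on [-C₁,C₁]², M₂ = max of the sup norms of the four partial derivatives of λ, μ on [-C₁,C₁]², T = 1/c + C₁^{1-γ}/((1-γ)K). Let (ũ,ṽ) be C₃-Lipschitz functions on [0,T]×[0,1] bounded by C₁, and let (u,v) solve the linear transport problems ∂_t u + λ(ũ,ṽ)∂_x u = 0 with data u(t,0) = u_l(t), u(0,·) = u₀, and ∂_t v + μ(ũ,ṽ)∂_x v = 0 with data v(t,1) = v_r(t), v(0,·) = v₀, where ‖u₀‖_∞, ‖v₀‖_∞ ≤ C₁, ‖u₀'‖_∞, ‖v₀'‖_∞ ≤ C₂, and u_l, v_r solve the ODE w' = -K sgn(w)|w|^γ with initial data u₀(0), v₀(1). Then ‖u‖_∞,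 ‖v‖_∞ ≤ C₁ and u, v are Lipschitz with constant max(KC₁^γ/c, C₂)·max(1, M₁)·exp(2TM₂C₃). -/
open MeasureTheory

section

open Set

/-- `X` is a characteristic curve of the speed field `A` on the time interval `[0, T]`. -/
def IsCharacteristic (A : ℝ → ℝ → ℝ) (T : ℝ) (X : ℝ → ℝ) : Prop :=
  ∀ t ∈ Icc 0 T, HasDerivAt X (A t (X t)) t

theorem exists_characteristic {A : ℝ → ℝ → ℝ} {T M L : ℝ} (hT : 0 ≤ T)
    (hM : ∀ t x, |A t x| ≤ M)
    (hL : ∀ t x t' x', |A t x - A t' x'| ≤ L * (|t - t'| + |x - x'|))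
    {t₀ : ℝ} (ht₀ : t₀ ∈ Icc 0 T) (x₀ : ℝ) :
    ∃ X : ℝ → ℝ, X t₀ = x₀ ∧ IsCharacteristic A T X := by
  have hM0 : 0 ≤ M := (abs_nonneg _).trans (hM 0 0)
  have hL0 : 0 ≤ L := by simpa using (abs_nonneg _).trans (hL 0 0 1 0)
  have ht₀' : t₀ ∈ Icc (-1) (T + 1) := ⟨by linarith [ht₀.1], by linarith [ht₀.2]⟩
  have hpl : IsPicardLindelof A (tmin := -1) (tmax := T + 1) ⟨t₀, ht₀'⟩ x₀
      (.mk (M * (T + 1)) (by positivity)) 0 (.mk M hM0) (.mk L hL0) :=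
    { lipschitzOnWith := fun t _ => (LipschitzWith.of_dist_le_mul fun x y => by
        simpa [Real.dist_eq] using hL t x t y).lipschitzOnWith
      continuousOn := fun x _ => (LipschitzWith.of_dist_le_mul (K := .mk L hL0) fun s t => by
        simpa [Real.dist_eq] using hL s x t x).continuous.continuousOn
      norm_le := fun t _ x _ => hM t x
      mul_max_le := by
        have : max (T + 1 - t₀) (t₀ - -1) ≤ T + 1 :=
          max_le (by linarith [ht₀.1]) (by linarith [ht₀.2])
        simpa using mul_le_mul_of_nonneg_left this hM0 }
  obtain ⟨X, hX₀, hX⟩ := hpl.exists_eq_forall_mem_Icc_hasDerivWithinAt₀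
  exact ⟨X, hX₀, fun t ht => (hX t ⟨by linarith [ht.1], by linarith [ht.2]⟩).hasDerivAt
    (Icc_mem_nhds (by linarith [ht.1]) (by linarith [ht.2]))⟩

theorem ae_ae_shear {P : ℝ × ℝ → Prop} (hP : ∀ᵐ p, P p) {X : ℝ → ℝ} (hX : Continuous X) :
    ∀ᵐ y : ℝ, ∀ᵐ τ : ℝ, P (τ, X τ + y) := by
  have h1 : MeasurePreserving (fun p : ℝ × ℝ => (p.1, X p.1 + p.2)) (volume.prod volume)
      (volume.prod volume) :=
    (MeasurePreserving.id (volume : Measure ℝ)).skew_product (g := fun τ y => X τ + y)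
      (by unfold Function.uncurry; fun_prop)
      (Filter.Eventually.of_forall fun τ => (measurePreserving_add_left volume (X τ)).map_eq)
  have h2 := (h1.comp Measure.measurePreserving_swap).quasiMeasurePreserving.ae hP
  exact Measure.ae_ae_of_ae_prod h2

theorem abs_sub_le_of_ae_abs_deriv_le {g : ℝ → ℝ} {a b C : ℝ} {K : NNReal} (hab : a ≤ b)
    (hg : LipschitzOnWith K g (Icc a b)) (hC : ∀ᵐ τ, τ ∈ Ioo a b → |deriv g τ| ≤ C) :
    |g b - g a| ≤ C * (b - a) := by
  rw [← uIcc_of_le hab] at hg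
  have hac := hg.absolutelyContinuousOnInterval
  rw [← hac.integral_deriv_eq_sub, ← abs_of_nonneg (sub_nonneg.2 hab)]
  refine intervalIntegral.norm_integral_le_of_norm_le_const_ae (E := ℝ) ?_
  filter_upwards [hC, Measure.ae_ne volume b] with τ h hb hτ
  rw [uIoc_of_le hab] at hτ
  exact h ⟨hτ.1, hτ.2.lt_of_ne hb⟩

theorem hasDerivAt_curve_of_partial {W : ℝ → ℝ → ℝ} {W' : ℝ × ℝ →L[ℝ] ℝ} {Y : ℝ → ℝ}
    {τ y' p q : ℝ} (hW : HasFDerivAt (Function.uncurry W) W' (τ, Y τ)) (hY : HasDerivAt Y y' τ)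
    (hp : HasDerivAt (fun s => W s (Y τ)) p τ) (hq : HasDerivAt (fun ξ => W τ ξ) q (Y τ)) :
    HasDerivAt (fun s => W s (Y s)) (p + y' * q) τ := by
  have h1 : HasDerivAt (fun s => W s (Y τ)) (W' (1, 0)) τ :=
    hW.comp_hasDerivAt_of_eq τ ((hasDerivAt_id' τ).prodMk (hasDerivAt_const τ (Y τ))) rfl
  have h2 : HasDerivAt (fun ξ => W τ ξ) (W' (0, 1)) (Y τ) :=
    hW.comp_hasDerivAt (Y τ) ((hasDerivAt_const (Y τ) τ).prodMk (hasDerivAt_id' (Y τ)))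
  have h3 : HasDerivAt (fun s => W s (Y s)) (W' (1, y')) τ :=
    hW.comp_hasDerivAt_of_eq τ ((hasDerivAt_id' τ).prodMk hY) rfl
  rw [hp.unique h1, hq.unique h2]
  convert h3 using 1
  have : ((1, y') : ℝ × ℝ) = (1, 0) + y' • (0, 1) := by simp
  rw [this, map_add, map_smul, smul_eq_mul]

theorem ae_differentiableAt_of_abs_sub_le {W : ℝ → ℝ → ℝ} {C : ℝ}
    (hW : ∀ t x t' x', |W t x - W t' x'| ≤ C * (|t - t'| + |x - x'|)) :
    ∀ᵐ p : ℝ × ℝ, DifferentiableAt ℝ (Function.uncurry W) p := by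
  have hC0 : 0 ≤ C := by simpa using (abs_nonneg _).trans (hW 0 0 1 0)
  refine LipschitzWith.ae_differentiableAt (C := .mk (C * 2) (by positivity))
    (LipschitzWith.of_dist_le_mul fun p q => ?_)
  refine (hW p.1 p.2 q.1 q.2).trans ?_
  rw [NNReal.coe_mk, mul_assoc, two_mul]
  gcongr
  · exact le_max_left (dist p.1 q.1) (dist p.2 q.2)
  · exact le_max_right (dist p.1 q.1) (dist p.2 q.2)

theorem eq_along_characteristic_of_Icc {A W : ℝ → ℝ → ℝ} {wT wX : ℝ × ℝ → ℝ} {T M L C : ℝ}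
    (hM : ∀ t x, |A t x| ≤ M)
    (hL : ∀ t x t' x', |A t x - A t' x'| ≤ L * (|t - t'| + |x - x'|))
    (hW : ∀ t x t' x', |W t x - W t' x'| ≤ C * (|t - t'| + |x - x'|))
    (hpde : ∀ᵐ p : ℝ × ℝ, p ∈ Ioo 0 T ×ˢ Ioo (0 : ℝ) 1 →
      HasDerivAt (fun τ => W τ p.2) (wT p) p.1 ∧ HasDerivAt (fun ξ => W p.1 ξ) (wX p) p.2 ∧
      wT p + A p.1 p.2 * wX p = 0)
    {X : ℝ → ℝ} (hX : IsCharacteristic A T X)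
    {a b : ℝ} (ha : 0 ≤ a) (hab : a ≤ b) (hb : b ≤ T)
    (hmem : ∀ τ ∈ Icc a b, X τ ∈ Ioo 0 1) : W a (X a) = W b (X b) := by
  have hM0 : 0 ≤ M := (abs_nonneg _).trans (hM 0 0)
  have hL0 : 0 ≤ L := by simpa using (abs_nonneg _).trans (hL 0 0 1 0)
  have hC0 : 0 ≤ C := by simpa using (abs_nonneg _).trans (hW 0 0 1 0)
  have hsub : Icc a b ⊆ Icc 0 T := Icc_subset_Icc ha hb
  have hXc : ContinuousOn X (Icc a b) := fun τ hτ =>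
    (hX τ (hsub hτ)).continuousAt.continuousWithinAt
  have hXl : ∀ τ ∈ Icc a b, ∀ τ' ∈ Icc a b, |X τ' - X τ| ≤ M * |τ' - τ| := fun τ hτ τ' hτ' =>
    (convex_Icc a b).norm_image_sub_le_of_norm_hasDerivWithin_le
      (fun x hx => (hX x (hsub hx)).hasDerivWithinAt) (fun x _ => hM x (X x)) hτ hτ'
  obtain ⟨m, hm, hmax⟩ := isCompact_Icc.exists_isMaxOn (nonempty_Icc.2 hab) hXc
  have hae := ae_ae_shear (hpde.and (ae_differentiableAt_of_abs_sub_le hW))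
    (continuous_IccExtend_iff (h := hab).2 hXc.domRestrict)
  have key : ∀ ε > 0, |W b (X b) - W a (X a)| ≤ ε * (L * C * (b - a) + 2 * C) := by
    intro ε hε
    obtain ⟨y, hy, hy0, hyε⟩ := (Measure.dense_of_ae hae).exists_between
      (lt_min hε (sub_pos.2 (hmem m hm).2))
    have hy1 := hyε.trans_le (min_le_right _ _)
    have hyε := hyε.trans_le (min_le_left _ _)
    have hlip : LipschitzOnWith (.mk (C * (1 + M)) (by positivity))
        (fun τ => W τ (X τ + y)) (Icc a b) := by
      refine LipschitzOnWith.of_dist_le_mul fun τ hτ τ' hτ' => ?_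
      refine (hW _ _ _ _).trans ?_
      rw [NNReal.coe_mk, mul_assoc, add_sub_add_right_eq_sub, Real.dist_eq]
      gcongr
      linarith [hXl τ' hτ' τ hτ]
    have h1 := abs_sub_le_of_ae_abs_deriv_le (C := L * y * C) hab hlip (by
      filter_upwards [hy] with τ hτ hτab
      have hτ' := Ioo_subset_Icc_self hτab
      rw [IccExtend_of_mem hab _ hτ', domRestrict_apply] at hτ
      have hXτ := hmem τ hτ'
      obtain ⟨⟨hT, hx, hz⟩, hd⟩ := hτ.imp_left fun h => h
        ⟨⟨ha.trans_lt hτab.1, hτab.2.trans_le hb⟩, by dsimp only; linarith [hXτ.1],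
          by dsimp only; linarith [isMaxOn_iff.1 hmax τ hτ']⟩
      have hder := hasDerivAt_curve_of_partial hd.hasFDerivAt (Y := fun τ => X τ + y)
        ((hX τ (hsub hτ')).add_const y) hT hx
      rw [hder.deriv]
      have e : wT (τ, X τ + y) + A τ (X τ) * wX (τ, X τ + y) =
          (A τ (X τ) - A τ (X τ + y)) * wX (τ, X τ + y) := by linear_combination hz
      rw [e, abs_mul]
      have e1 : |A τ (X τ) - A τ (X τ + y)| ≤ L * y := by
        simpa [abs_of_pos hy0] using hL τ (X τ) τ (X τ + y)
      have e2 : |wX (τ, X τ + y)| ≤ C := hx.le_of_lip' hC0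
        (Filter.Eventually.of_forall fun ξ => by simpa using hW τ ξ τ (X τ + y))
      gcongr)
    have h2 : ∀ τ, |W τ (X τ + y) - W τ (X τ)| ≤ C * y := fun τ => by
      simpa [abs_of_pos hy0] using hW τ (X τ + y) τ (X τ)
    have h3 := abs_le.1 (h2 a)
    have h4 := abs_le.1 (h2 b)
    have h5 := abs_le.1 h1
    have h6 : y * (L * C * (b - a) + 2 * C) ≤ ε * (L * C * (b - a) + 2 * C) := by
      have := sub_nonneg.2 hab
      gcongr
    refine le_trans (abs_le.2 ⟨?_, ?_⟩) h6 <;> linarith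
  have hlim : Filter.Tendsto (fun ε : ℝ => ε * (L * C * (b - a) + 2 * C)) (nhdsWithin 0 (Ioi 0))
      (nhds 0) := by
    have : Continuous fun ε : ℝ => ε * (L * C * (b - a) + 2 * C) := by fun_prop
    simpa using (this.tendsto 0).mono_left nhdsWithin_le_nhds
  have := ge_of_tendsto hlim (Filter.eventually_of_mem self_mem_nhdsWithin key)
  exact (sub_eq_zero.1 (abs_nonpos_iff.1 this)).symm

namespace IsCharacteristic

variable {A : ℝ → ℝ → ℝ} {X Y : ℝ → ℝ} {T c M L a b : ℝ}

theorem continuousOn (hX : IsCharacteristic A T X) : ContinuousOn X (Icc 0 T) := fun τ hτ =>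
  (hX τ hτ).continuousAt.continuousWithinAt

theorem mul_le_sub (hX : IsCharacteristic A T X) (hA : ∀ t x, c ≤ A t x) (ha : 0 ≤ a)
    (hab : a ≤ b) (hb : b ≤ T) : c * (b - a) ≤ X b - X a := by
  have hsub : interior (Icc a b) ⊆ Icc 0 T := interior_subset.trans (Icc_subset_Icc ha hb)
  exact (convex_Icc a b).mul_sub_le_image_sub_of_le_deriv
    (hX.continuousOn.mono (Icc_subset_Icc ha hb))
    (fun τ hτ => (hX τ (hsub hτ)).differentiableAt.differentiableWithinAt)
    (fun τ hτ => by rw [(hX τ (hsub hτ)).deriv]; exact hA _ _)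
    a (left_mem_Icc.2 hab) b (right_mem_Icc.2 hab) hab

theorem sub_le_mul (hX : IsCharacteristic A T X) (hA : ∀ t x, A t x ≤ M) (ha : 0 ≤ a)
    (hab : a ≤ b) (hb : b ≤ T) : X b - X a ≤ M * (b - a) := by
  have hsub : interior (Icc a b) ⊆ Icc 0 T := interior_subset.trans (Icc_subset_Icc ha hb)
  exact (convex_Icc a b).image_sub_le_mul_sub_of_deriv_le
    (hX.continuousOn.mono (Icc_subset_Icc ha hb))
    (fun τ hτ => (hX τ (hsub hτ)).differentiableAt.differentiableWithinAt)
    (fun τ hτ => by rw [(hX τ (hsub hτ)).deriv]; exact hA _ _)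
    a (left_mem_Icc.2 hab) b (right_mem_Icc.2 hab) hab

theorem abs_sub_le_exp_mul (hX : IsCharacteristic A T X) (hY : IsCharacteristic A T Y)
    (hL : ∀ t x t' x', |A t x - A t' x'| ≤ L * (|t - t'| + |x - x'|)) (ha : 0 ≤ a)
    (hab : a ≤ b) (hb : b ≤ T) : |X a - Y a| ≤ Real.exp (L * (b - a)) * |X b - Y b| := by
  have hsub : Icc a b ⊆ Icc 0 T := Icc_subset_Icc ha hb
  have hder : ∀ τ ∈ Icc a b, HasDerivAt (fun τ => (Real.exp (L * τ) * (X τ - Y τ)) ^ 2)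
      (2 * Real.exp (L * τ) ^ 2 *
        (L * (X τ - Y τ) ^ 2 + (X τ - Y τ) * (A τ (X τ) - A τ (Y τ)))) τ := fun τ hτ => by
    refine (((((hasDerivAt_id' τ).const_mul L).exp).fun_mul
      ((hX τ (hsub hτ)).fun_sub (hY τ (hsub hτ)))).fun_pow 2).congr_deriv ?_
    push_cast
    ring
  have hmono : MonotoneOn (fun τ => (Real.exp (L * τ) * (X τ - Y τ)) ^ 2) (Icc a b) := by
    refine monotoneOn_of_deriv_nonneg (convex_Icc a b)
      (fun τ hτ => (hder τ hτ).continuousAt.continuousWithinAt)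
      (fun τ hτ => (hder τ (interior_subset hτ)).differentiableAt.differentiableWithinAt)
      fun τ hτ => ?_
    rw [(hder τ (interior_subset hτ)).deriv]
    refine mul_nonneg (by positivity) ?_
    have h1 : |A τ (X τ) - A τ (Y τ)| ≤ L * |X τ - Y τ| := by simpa using hL τ (X τ) τ (Y τ)
    have h2 := mul_le_mul_of_nonneg_left h1 (abs_nonneg (X τ - Y τ))
    rw [← abs_mul] at h2
    have h3 := neg_abs_le ((X τ - Y τ) * (A τ (X τ) - A τ (Y τ)))
    have h4 := abs_mul_abs_self (X τ - Y τ)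
    have h5 : |X τ - Y τ| * (L * |X τ - Y τ|) = L * (X τ - Y τ) ^ 2 := by
      linear_combination L * h4
    linarith
  have h := sq_le_sq.1 (hmono (left_mem_Icc.2 hab) (right_mem_Icc.2 hab) hab)
  rw [abs_mul, abs_mul, Real.abs_exp, Real.abs_exp] at h
  rw [mul_sub, Real.exp_sub, div_mul_eq_mul_div, le_div_iff₀ (Real.exp_pos _), mul_comm]
  exact h

theorem exists_foot (hX : IsCharacteristic A T X) (ha : 0 ≤ a) (hab : a ≤ b) (hb : b ≤ T)
    (hXb : 0 ≤ X b) : ∃ s ∈ Icc a b, 0 ≤ X s ∧ (s = a ∨ X s = 0) := by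
  rcases le_or_gt 0 (X a) with h | h
  · exact ⟨a, left_mem_Icc.2 hab, h, .inl rfl⟩
  · obtain ⟨s, hs, hs0⟩ := intermediate_value_Icc hab
      (hX.continuousOn.mono (Icc_subset_Icc ha hb)) ⟨h.le, hXb⟩
    exact ⟨s, hs, hs0.ge, .inr hs0⟩

theorem eq_along {W : ℝ → ℝ → ℝ} {wT wX : ℝ × ℝ → ℝ} {C : ℝ} (hX : IsCharacteristic A T X)
    (hc : 0 < c) (hcA : ∀ t x, c ≤ A t x) (hM : ∀ t x, A t x ≤ M)
    (hL : ∀ t x t' x', |A t x - A t' x'| ≤ L * (|t - t'| + |x - x'|))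
    (hW : ∀ t x t' x', |W t x - W t' x'| ≤ C * (|t - t'| + |x - x'|))
    (hpde : ∀ᵐ p : ℝ × ℝ, p ∈ Ioo 0 T ×ˢ Ioo (0 : ℝ) 1 →
      HasDerivAt (fun τ => W τ p.2) (wT p) p.1 ∧ HasDerivAt (fun ξ => W p.1 ξ) (wX p) p.2 ∧
      wT p + A p.1 p.2 * wX p = 0)
    (ha : 0 ≤ a) (hab : a ≤ b) (hb : b ≤ T) (hXa : 0 ≤ X a) (hXb : X b ≤ 1) :
    W a (X a) = W b (X b) := by
  rcases hab.eq_or_lt with rfl | hab'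
  · rfl
  have hC0 : 0 ≤ C := by simpa using (abs_nonneg _).trans (hW 0 0 1 0)
  have hWc : Continuous (Function.uncurry W) := by
    refine (LipschitzWith.of_dist_le_mul (K := .mk (C * 2) (by positivity))
      fun p q => ?_).continuous
    refine (hW p.1 p.2 q.1 q.2).trans ?_
    rw [NNReal.coe_mk, mul_assoc, two_mul]
    gcongr
    · exact le_max_left (dist p.1 q.1) (dist p.2 q.2)
    · exact le_max_right (dist p.1 q.1) (dist p.2 q.2)
  have hlt : ∀ {s t}, 0 ≤ s → s < t → t ≤ T → X s < X t := fun {s t} hs hst ht => by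
    have := hX.mul_le_sub hcA hs hst.le ht
    have := mul_pos hc (sub_pos.2 hst)
    linarith
  have hmem : ∀ τ ∈ Ioo a b, X τ ∈ Ioo 0 1 := fun τ hτ =>
    ⟨hXa.trans_lt (hlt ha hτ.1 (hτ.2.le.trans hb)),
      (hlt (ha.trans hτ.1.le) hτ.2 hb).trans_le hXb⟩
  have habs : ∀ t x, |A t x| ≤ M := fun t x => by
    rw [abs_of_pos (hc.trans_le (hcA t x))]
    exact hM t x
  have hle : ∀ s ∈ Ioo a b, ∀ t ∈ Ioo a b, s ≤ t → W s (X s) = W t (X t) := fun s hs t ht hst =>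
    eq_along_characteristic_of_Icc habs hL hW hpde hX (ha.trans hs.1.le) hst (ht.2.le.trans hb)
      fun τ hτ => hmem τ ⟨hs.1.trans_le hτ.1, hτ.2.trans_lt ht.2⟩
  obtain ⟨m, hm⟩ := nonempty_Ioo.2 hab'
  have heq : EqOn (fun τ => W τ (X τ)) (fun _ => W m (X m)) (Ioo a b) := fun τ hτ =>
    (le_total τ m).elim (hle τ hτ m hm) fun h => (hle m hm τ hτ h).symm
  have heq' := heq.of_subset_closure
    (hWc.comp_continuousOn (continuousOn_id.prodMk
      (hX.continuousOn.mono (Icc_subset_Icc ha hb)))) continuousOn_const Ioo_subset_Icc_self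
    (closure_Ioo hab'.ne).ge
  exact (heq' (left_mem_Icc.2 hab)).trans (heq' (right_mem_Icc.2 hab)).symm

end IsCharacteristic

/-- `W` is transported on `[0, T] × [0, 1]` by the speed field `A`, with values in `[c, M]` and
Lipschitz constant `L`; its inflow boundary data are `B`-Lipschitz, its initial data are
`D`-Lipschitz, and both are bounded by `S`. -/
structure IsTransported (A W : ℝ → ℝ → ℝ) (T c M L B D S : ℝ) : Prop where
  c_pos : 0 < c
  T_nonneg : 0 ≤ T
  le_speed : ∀ t x, c ≤ A t x
  speed_le : ∀ t x, A t x ≤ M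
  speed_lipschitz : ∀ t x t' x', |A t x - A t' x'| ≤ L * (|t - t'| + |x - x'|)
  eq_along : ∀ X, IsCharacteristic A T X → ∀ s t, 0 ≤ s → s ≤ t → t ≤ T → 0 ≤ X s → X t ≤ 1 →
    W s (X s) = W t (X t)
  boundary_lipschitz : ∀ s ∈ Icc 0 T, ∀ t ∈ Icc 0 T, |W s 0 - W t 0| ≤ B * |s - t|
  initial_lipschitz : ∀ x ∈ Icc 0 1, ∀ y ∈ Icc 0 1, |W 0 x - W 0 y| ≤ D * |x - y|
  boundary_bound : ∀ t ∈ Icc 0 T, |W t 0| ≤ S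
  initial_bound : ∀ x ∈ Icc 0 1, |W 0 x| ≤ S

namespace IsTransported

variable {A W : ℝ → ℝ → ℝ} {T c M L B D S : ℝ}

theorem exists_characteristic (h : IsTransported A W T c M L B D S) {t : ℝ} (ht : t ∈ Icc 0 T)
    (x : ℝ) : ∃ X : ℝ → ℝ, X t = x ∧ IsCharacteristic A T X :=
  _root_.exists_characteristic h.T_nonneg (M := M) (fun t x => by
    rw [abs_of_pos (h.c_pos.trans_le (h.le_speed t x))]
    exact h.speed_le t x) h.speed_lipschitz ht x

theorem monotone (h : IsTransported A W T c M L B D S) {X : ℝ → ℝ} (hX : IsCharacteristic A T X)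
    {s t : ℝ} (hs : 0 ≤ s) (hst : s ≤ t) (ht : t ≤ T) : X s ≤ X t := by
  have := hX.mul_le_sub h.le_speed hs hst ht
  have := mul_nonneg h.c_pos.le (sub_nonneg.2 hst)
  linarith

theorem lipschitz_nonneg (h : IsTransported A W T c M L B D S) : 0 ≤ max (B / c) D := by
  refine le_max_of_le_right ?_
  simpa using (abs_nonneg _).trans (h.initial_lipschitz 0 (by simp) 1 (by simp))

theorem abs_le (h : IsTransported A W T c M L B D S) {t x : ℝ} (ht : t ∈ Icc 0 T)
    (hx : x ∈ Icc 0 1) : |W t x| ≤ S := by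
  obtain ⟨X, rfl, hX⟩ := h.exists_characteristic ht x
  obtain ⟨s, hs, hs0, hsX⟩ := hX.exists_foot le_rfl ht.1 ht.2 hx.1
  rw [← h.eq_along X hX s t hs.1 hs.2 ht.2 hs0 hx.2]
  rcases hsX with rfl | hsX
  · exact h.initial_bound _ ⟨hs0, (h.monotone hX le_rfl hs.2 ht.2).trans hx.2⟩
  · rw [hsX]
    exact h.boundary_bound s ⟨hs.1, hs.2.trans ht.2⟩

theorem boundary_le (h : IsTransported A W T c M L B D S) {s t : ℝ} (hs : 0 ≤ s) (hst : s ≤ t)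
    (ht : t ≤ T) : |W t 0 - W s 0| ≤ max (B / c) D * (c * (t - s)) := by
  have h1 := h.boundary_lipschitz t ⟨hs.trans hst, ht⟩ s ⟨hs, hst.trans ht⟩
  rw [abs_of_nonneg (sub_nonneg.2 hst)] at h1
  have h2 : B ≤ max (B / c) D * c := (div_le_iff₀ h.c_pos).1 (le_max_left _ _)
  have := mul_le_mul_of_nonneg_right h2 (sub_nonneg.2 hst)
  linarith

theorem abs_boundary_sub_le (h : IsTransported A W T c M L B D S) {t x : ℝ} (ht : t ∈ Icc 0 T)
    (hx : x ∈ Icc 0 1) : |W t 0 - W t x| ≤ max (B / c) D * x := by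
  obtain ⟨X, rfl, hX⟩ := h.exists_characteristic ht x
  obtain ⟨s, hs, hs0, hsX⟩ := hX.exists_foot le_rfl ht.1 ht.2 hx.1
  rw [← h.eq_along X hX s t hs.1 hs.2 ht.2 hs0 hx.2]
  have h1 := h.boundary_le hs.1 hs.2 ht.2
  have h2 : |W s 0 - W s (X s)| ≤ max (B / c) D * X s := by
    rcases hsX with rfl | hsX
    · refine (h.initial_lipschitz 0 (by simp) _
        ⟨hs0, (h.monotone hX le_rfl hs.2 ht.2).trans hx.2⟩).trans ?_
      rw [zero_sub, abs_neg, abs_of_nonneg hs0]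
      gcongr
      exact le_max_right _ _
    · simp [hsX]
  have h3 := mul_le_mul_of_nonneg_left (hX.mul_le_sub h.le_speed hs.1 hs.2 ht.2)
    h.lipschitz_nonneg
  have h4 := abs_sub_le (W t 0) (W s 0) (W s (X s))
  linarith

theorem abs_sub_le_space (h : IsTransported A W T c M L B D S) {t x y : ℝ} (ht : t ∈ Icc 0 T)
    (hx : x ∈ Icc 0 1) (hy : y ∈ Icc 0 1) :
    |W t x - W t y| ≤ max (B / c) D * Real.exp (L * T) * |x - y| := by
  have hL0 : 0 ≤ L := by simpa using (abs_nonneg _).trans (h.speed_lipschitz 0 0 1 0)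
  have hN := h.lipschitz_nonneg
  obtain ⟨X, rfl, hX⟩ := h.exists_characteristic ht x
  obtain ⟨Y, rfl, hY⟩ := h.exists_characteristic ht y
  obtain ⟨s, hs, hs0, hsX⟩ := hX.exists_foot le_rfl ht.1 ht.2 hx.1
  obtain ⟨s', hs', hs0', hsY⟩ := hY.exists_foot le_rfl ht.1 ht.2 hy.1
  have key : ∃ r ∈ Icc 0 t, 0 ≤ X r ∧ 0 ≤ Y r ∧ (r = 0 ∨ X r = 0 ∨ Y r = 0) := by
    rcases le_total s s' with hss | hss
    · exact ⟨s', hs', hs0.trans (h.monotone hX hs.1 hss (hs'.2.trans ht.2)), hs0',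
        hsY.imp_right .inr⟩
    · exact ⟨s, hs, hs0, hs0'.trans (h.monotone hY hs'.1 hss (hs.2.trans ht.2)),
        hsX.imp_right .inl⟩
  obtain ⟨r, hr, hXr, hYr, hcase⟩ := key
  have hrT : r ∈ Icc 0 T := ⟨hr.1, hr.2.trans ht.2⟩
  have hXr1 := (h.monotone hX hr.1 hr.2 ht.2).trans hx.2
  have hYr1 := (h.monotone hY hr.1 hr.2 ht.2).trans hy.2
  rw [← h.eq_along X hX r t hr.1 hr.2 ht.2 hXr hx.2, ← h.eq_along Y hY r t hr.1 hr.2 ht.2 hYr hy.2]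
  have h1 : |W r (X r) - W r (Y r)| ≤ max (B / c) D * |X r - Y r| := by
    rcases hcase with rfl | h0 | h0
    · refine (h.initial_lipschitz _ ⟨hXr, hXr1⟩ _ ⟨hYr, hYr1⟩).trans ?_
      gcongr
      exact le_max_right _ _
    · rw [h0, zero_sub, abs_neg, abs_of_nonneg hYr]
      exact h.abs_boundary_sub_le hrT ⟨hYr, hYr1⟩
    · rw [h0, sub_zero, abs_of_nonneg hXr, abs_sub_comm]
      exact h.abs_boundary_sub_le hrT ⟨hXr, hXr1⟩
  refine h1.trans ?_
  rw [mul_assoc]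
  gcongr
  refine (hX.abs_sub_le_exp_mul hY h.speed_lipschitz hr.1 hr.2 ht.2).trans ?_
  gcongr
  linarith [hr.1, ht.2]

theorem abs_sub_le_time (h : IsTransported A W T c M L B D S) {s t x : ℝ} (hs : 0 ≤ s)
    (hst : s ≤ t) (ht : t ≤ T) (hx : x ∈ Icc 0 1) :
    |W s x - W t x| ≤ max (B / c) D * Real.exp (L * T) * (M * (t - s)) := by
  have hL0 : 0 ≤ L := by simpa using (abs_nonneg _).trans (h.speed_lipschitz 0 0 1 0)
  have hN := h.lipschitz_nonneg
  have hT := h.T_nonneg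
  have hsT : s ∈ Icc 0 T := ⟨hs, hst.trans ht⟩
  have hcM : c ≤ M := (h.le_speed 0 0).trans (h.speed_le 0 0)
  obtain ⟨X, hXt, hX⟩ := h.exists_characteristic ⟨hs.trans hst, ht⟩ x
  obtain ⟨r, hr, hr0, hrX⟩ := hX.exists_foot hs hst ht (hXt ▸ hx.1)
  have hr' : 0 ≤ r := hs.trans hr.1
  have hXr1 : X r ≤ x := hXt ▸ h.monotone hX hr' hr.2 ht
  have h1 := h.eq_along X hX r t hr' hr.2 ht hr0 (hXt ▸ hx.2)
  rw [hXt] at h1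
  rw [← h1]
  have h2 := hX.sub_le_mul h.speed_le hr' hr.2 ht
  rw [hXt] at h2
  rcases hrX with rfl | hrX
  · refine (h.abs_sub_le_space hsT hx ⟨hr0, hXr1.trans hx.2⟩).trans ?_
    rw [abs_of_nonneg (sub_nonneg.2 hXr1)]
    gcongr
  · rw [hrX] at h2 ⊢
    have h3 := h.abs_boundary_sub_le hsT hx
    have h4 := h.boundary_le hs hr.1 (hr.2.trans ht)
    have h5 := abs_sub_le (W r 0) (W s 0) (W s x)
    rw [abs_sub_comm (W r 0) (W s x)] at h5
    have h6 : c * (r - s) ≤ M * (r - s) := mul_le_mul_of_nonneg_right hcM (sub_nonneg.2 hr.1)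
    have h7 : max (B / c) D * (x + c * (r - s)) ≤ max (B / c) D * (M * (t - s)) := by
      gcongr
      linarith
    have h8 : max (B / c) D ≤ max (B / c) D * Real.exp (L * T) :=
      le_mul_of_one_le_right hN (Real.one_le_exp (by positivity))
    have h9 := mul_le_mul_of_nonneg_right h8
      (mul_nonneg (h.c_pos.le.trans hcM) (sub_nonneg.2 hst))
    linarith

theorem abs_sub_le (h : IsTransported A W T c M L B D S) {t x t' x' : ℝ} (ht : t ∈ Icc 0 T)
    (hx : x ∈ Icc 0 1) (ht' : t' ∈ Icc 0 T) (hx' : x' ∈ Icc 0 1) :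
    |W t x - W t' x'| ≤
      max (B / c) D * max 1 M * Real.exp (L * T) * (|t - t'| + |x - x'|) := by
  have hP : 0 ≤ max (B / c) D * Real.exp (L * T) :=
    mul_nonneg h.lipschitz_nonneg (Real.exp_pos _).le
  have h1 := h.abs_sub_le_space ht hx hx'
  have h2 : |W t x' - W t' x'| ≤ max (B / c) D * Real.exp (L * T) * (M * |t - t'|) := by
    rcases le_total t t' with htt | htt
    · rw [abs_sub_comm t, abs_of_nonneg (sub_nonneg.2 htt)]
      exact h.abs_sub_le_time ht.1 htt ht'.2 hx'
    · rw [abs_sub_comm, abs_of_nonneg (sub_nonneg.2 htt)]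
      exact h.abs_sub_le_time ht'.1 htt ht.2 hx'
  have h3 : |x - x'| + M * |t - t'| ≤ max 1 M * (|t - t'| + |x - x'|) := by
    have e1 := mul_le_mul_of_nonneg_right (le_max_left 1 M) (abs_nonneg (x - x'))
    have e2 := mul_le_mul_of_nonneg_right (le_max_right 1 M) (abs_nonneg (t - t'))
    linarith
  have h4 := mul_le_mul_of_nonneg_left h3 hP
  have h5 := _root_.abs_sub_le (W t x) (W t x') (W t' x')
  linarith

end IsTransported

theorem exists_isTransported_of_ae {a w : ℝ → ℝ → ℝ} {wT wX : ℝ × ℝ → ℝ} {T c M L B D S C : ℝ}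
    (hc : 0 < c) (hT : 0 ≤ T)
    (ha : ∀ t ∈ Icc 0 T, ∀ x ∈ Icc (0 : ℝ) 1, c ≤ a t x ∧ a t x ≤ M)
    (hL : ∀ t ∈ Icc 0 T, ∀ x ∈ Icc (0 : ℝ) 1, ∀ t' ∈ Icc 0 T, ∀ x' ∈ Icc (0 : ℝ) 1,
      |a t x - a t' x'| ≤ L * (|t - t'| + |x - x'|))
    (hw : ∀ t ∈ Icc 0 T, ∀ x ∈ Icc (0 : ℝ) 1, ∀ t' ∈ Icc 0 T, ∀ x' ∈ Icc (0 : ℝ) 1,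
      |w t x - w t' x'| ≤ C * (|t - t'| + |x - x'|))
    (hpde : ∀ᵐ p : ℝ × ℝ, p ∈ Ioo 0 T ×ˢ Ioo (0 : ℝ) 1 →
      HasDerivAt (fun τ => w τ p.2) (wT p) p.1 ∧ HasDerivAt (fun ξ => w p.1 ξ) (wX p) p.2 ∧
      wT p + a p.1 p.2 * wX p = 0)
    (hB : ∀ s ∈ Icc 0 T, ∀ t ∈ Icc 0 T, |w s 0 - w t 0| ≤ B * |s - t|)
    (hD : ∀ x ∈ Icc (0 : ℝ) 1, ∀ y ∈ Icc (0 : ℝ) 1, |w 0 x - w 0 y| ≤ D * |x - y|)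
    (hBS : ∀ t ∈ Icc 0 T, |w t 0| ≤ S) (hDS : ∀ x ∈ Icc (0 : ℝ) 1, |w 0 x| ≤ S) :
    ∃ A W : ℝ → ℝ → ℝ, (∀ t ∈ Icc 0 T, ∀ x ∈ Icc (0 : ℝ) 1, W t x = w t x) ∧
      IsTransported A W T c M L B D S := by
  have h0 : (0 : ℝ) ∈ Icc 0 T := left_mem_Icc.2 hT
  have h0' : (0 : ℝ) ∈ Icc (0 : ℝ) 1 := left_mem_Icc.2 zero_le_one
  have h1' : (1 : ℝ) ∈ Icc (0 : ℝ) 1 := right_mem_Icc.2 zero_le_one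
  have hL0 : 0 ≤ L := by simpa using (abs_nonneg _).trans (hL 0 h0 0 h0' 0 h0 1 h1')
  have hC0 : 0 ≤ C := by simpa using (abs_nonneg _).trans (hw 0 h0 0 h0' 0 h0 1 h1')
  set P : ℝ → ℝ := fun t => projIcc 0 T hT t with hP
  set Q : ℝ → ℝ := fun x => projIcc 0 1 zero_le_one x with hQ
  have hPm : ∀ t, P t ∈ Icc 0 T := fun t => (projIcc 0 T hT t).2
  have hQm : ∀ x, Q x ∈ Icc (0 : ℝ) 1 := fun x => (projIcc 0 1 zero_le_one x).2
  have hPe : ∀ t ∈ Icc 0 T, P t = t := fun t ht => by simp only [hP, projIcc_of_mem hT ht]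
  have hQe : ∀ x ∈ Icc (0 : ℝ) 1, Q x = x := fun x hx => by
    simp only [hQ, projIcc_of_mem zero_le_one hx]
  have hPl : ∀ s t, |P s - P t| ≤ |s - t| := fun s t => abs_projIcc_sub_projIcc hT
  have hQl : ∀ x y, |Q x - Q y| ≤ |x - y| := fun x y => abs_projIcc_sub_projIcc zero_le_one
  have hA' : ∀ t x t' x', |a (P t) (Q x) - a (P t') (Q x')| ≤ L * (|t - t'| + |x - x'|) :=
    fun t x t' x' => (hL _ (hPm t) _ (hQm x) _ (hPm t') _ (hQm x')).trans
      (mul_le_mul_of_nonneg_left (add_le_add (hPl t t') (hQl x x')) hL0)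
  have hW' : ∀ t x t' x', |w (P t) (Q x) - w (P t') (Q x')| ≤ C * (|t - t'| + |x - x'|) :=
    fun t x t' x' => (hw _ (hPm t) _ (hQm x) _ (hPm t') _ (hQm x')).trans
      (mul_le_mul_of_nonneg_left (add_le_add (hPl t t') (hQl x x')) hC0)
  have hpde' : ∀ᵐ p : ℝ × ℝ, p ∈ Ioo 0 T ×ˢ Ioo (0 : ℝ) 1 →
      HasDerivAt (fun τ => w (P τ) (Q p.2)) (wT p) p.1 ∧
      HasDerivAt (fun ξ => w (P p.1) (Q ξ)) (wX p) p.2 ∧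
      wT p + a (P p.1) (Q p.2) * wX p = 0 := by
    filter_upwards [hpde] with p hp hpm
    obtain ⟨hp1, hp2, hp3⟩ := hp hpm
    have e1 := hPe p.1 (Ioo_subset_Icc_self hpm.1)
    have e2 := hQe p.2 (Ioo_subset_Icc_self hpm.2)
    rw [e1, e2]
    refine ⟨hp1.congr_of_eventuallyEq ?_, hp2.congr_of_eventuallyEq ?_, hp3⟩
    · filter_upwards [Ioo_mem_nhds hpm.1.1 hpm.1.2] with τ hτ
      rw [hPe τ (Ioo_subset_Icc_self hτ)]
    · filter_upwards [Ioo_mem_nhds hpm.2.1 hpm.2.2] with ξ hξ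
      rw [hQe ξ (Ioo_subset_Icc_self hξ)]
  refine ⟨fun t x => a (P t) (Q x), fun t x => w (P t) (Q x),
    fun t ht x hx => by simp only [hPe t ht, hQe x hx], ?_⟩
  exact
    { c_pos := hc
      T_nonneg := hT
      le_speed := fun t x => (ha _ (hPm t) _ (hQm x)).1
      speed_le := fun t x => (ha _ (hPm t) _ (hQm x)).2
      speed_lipschitz := hA'
      eq_along := fun X hX s t hs hst ht hXs hXt => hX.eq_along hc
        (fun t x => (ha _ (hPm t) _ (hQm x)).1) (fun t x => (ha _ (hPm t) _ (hQm x)).2)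
        hA' hW' hpde' hs hst ht hXs hXt
      boundary_lipschitz := fun s hs t ht => by
        simpa only [hPe s hs, hPe t ht, hQe 0 h0'] using hB s hs t ht
      initial_lipschitz := fun x hx y hy => by
        simpa only [hQe x hx, hQe y hy, hPe 0 h0] using hD x hx y hy
      boundary_bound := fun t ht => by simpa only [hPe t ht, hQe 0 h0'] using hBS t ht
      initial_bound := fun x hx => by simpa only [hPe 0 h0, hQe x hx] using hDS x hx }

theorem bound_and_lipschitz_of_ae {a w : ℝ → ℝ → ℝ} {wT wX : ℝ × ℝ → ℝ} {T c M L B D S C : ℝ}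
    (hc : 0 < c) (hT : 0 ≤ T)
    (ha : ∀ t ∈ Icc 0 T, ∀ x ∈ Icc (0 : ℝ) 1, c ≤ a t x ∧ a t x ≤ M)
    (hL : ∀ t ∈ Icc 0 T, ∀ x ∈ Icc (0 : ℝ) 1, ∀ t' ∈ Icc 0 T, ∀ x' ∈ Icc (0 : ℝ) 1,
      |a t x - a t' x'| ≤ L * (|t - t'| + |x - x'|))
    (hw : ∀ t ∈ Icc 0 T, ∀ x ∈ Icc (0 : ℝ) 1, ∀ t' ∈ Icc 0 T, ∀ x' ∈ Icc (0 : ℝ) 1,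
      |w t x - w t' x'| ≤ C * (|t - t'| + |x - x'|))
    (hpde : ∀ᵐ p : ℝ × ℝ, p ∈ Ioo 0 T ×ˢ Ioo (0 : ℝ) 1 →
      HasDerivAt (fun τ => w τ p.2) (wT p) p.1 ∧ HasDerivAt (fun ξ => w p.1 ξ) (wX p) p.2 ∧
      wT p + a p.1 p.2 * wX p = 0)
    (hB : ∀ s ∈ Icc 0 T, ∀ t ∈ Icc 0 T, |w s 0 - w t 0| ≤ B * |s - t|)
    (hD : ∀ x ∈ Icc (0 : ℝ) 1, ∀ y ∈ Icc (0 : ℝ) 1, |w 0 x - w 0 y| ≤ D * |x - y|)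
    (hBS : ∀ t ∈ Icc 0 T, |w t 0| ≤ S) (hDS : ∀ x ∈ Icc (0 : ℝ) 1, |w 0 x| ≤ S) :
    (∀ t ∈ Icc 0 T, ∀ x ∈ Icc (0 : ℝ) 1, |w t x| ≤ S) ∧
    ∀ t ∈ Icc 0 T, ∀ x ∈ Icc (0 : ℝ) 1, ∀ t' ∈ Icc 0 T, ∀ x' ∈ Icc (0 : ℝ) 1,
      |w t x - w t' x'| ≤
        max (B / c) D * max 1 M * Real.exp (L * T) * (|t - t'| + |x - x'|) := by
  obtain ⟨A, W, hWw, h⟩ := exists_isTransported_of_ae hc hT ha hL hw hpde hB hD hBS hDS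
  refine ⟨fun t ht x hx => ?_, fun t ht x hx t' ht' x' hx' => ?_⟩
  · rw [← hWw t ht x hx]
    exact h.abs_le ht hx
  · rw [← hWw t ht x hx, ← hWw t' ht' x' hx']
    exact h.abs_sub_le ht hx ht' hx'

theorem abs_le_of_finite_time_ode {w : ℝ → ℝ} {K γ S : ℝ} (hK : 0 ≤ K)
    (hw : ∀ t, 0 ≤ t → HasDerivAt w (-K * Real.sign (w t) * |w t| ^ γ) t) (h0 : |w 0| ≤ S)
    {t : ℝ} (ht : 0 ≤ t) : |w t| ≤ S := by
  have hder : ∀ s, 0 ≤ s → HasDerivAt (fun s => w s ^ 2)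
      (2 * w s * (-K * Real.sign (w s) * |w s| ^ γ)) s := fun s hs => by
    simpa using (hw s hs).fun_pow 2
  have hanti : AntitoneOn (fun s => w s ^ 2) (Ici 0) := by
    refine antitoneOn_of_deriv_nonpos (convex_Ici 0)
      (fun s hs => (hder s hs).continuousAt.continuousWithinAt)
      (fun s hs => (hder s (interior_subset hs)).differentiableAt.differentiableWithinAt)
      fun s hs => ?_
    rw [(hder s (interior_subset hs)).deriv]
    have h1 : 0 ≤ Real.sign (w s) * w s := Real.sign_mul_nonneg (w s)
    have h2 : 0 ≤ |w s| ^ γ := by positivity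
    have h3 := mul_nonneg hK (mul_nonneg h1 h2)
    linarith
  exact (sq_le_sq.1 (hanti self_mem_Ici (mem_Ici.2 ht) ht)).trans h0

theorem abs_sub_le_of_finite_time_ode {w : ℝ → ℝ} {K γ S : ℝ} (hK : 0 ≤ K) (hγ : 0 ≤ γ)
    (hw : ∀ t, 0 ≤ t → HasDerivAt w (-K * Real.sign (w t) * |w t| ^ γ) t) (h0 : |w 0| ≤ S)
    {s t : ℝ} (hs : 0 ≤ s) (ht : 0 ≤ t) : |w s - w t| ≤ K * S ^ γ * |s - t| := by
  refine (convex_Ici (0 : ℝ)).norm_image_sub_le_of_norm_hasDerivWithin_le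
    (fun x hx => (hw x hx).hasDerivWithinAt) (fun x hx => ?_) ht hs
  have h1 : |Real.sign (w x)| ≤ 1 := by
    rcases Real.sign_apply_eq (w x) with h | h | h <;> simp [h]
  have h2 : |w x| ^ γ ≤ S ^ γ :=
    Real.rpow_le_rpow (abs_nonneg _) (abs_le_of_finite_time_ode hK hw h0 hx) hγ
  have h3 : 0 ≤ |w x| ^ γ := by positivity
  rw [Real.norm_eq_abs, abs_mul, abs_mul, abs_neg, abs_of_nonneg hK, abs_of_nonneg h3]
  calc K * |Real.sign (w x)| * |w x| ^ γ ≤ K * 1 * S ^ γ := by gcongr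
    _ = K * S ^ γ := by ring

end

/-- Stability of the domain for the fixed-point operator: if `(ũ,ṽ)` are bounded by
`C₁` and `C₃`-Lipschitz, and `(u,v)` are the Lipschitz solutions of the linear
transport equations with speeds `λ(ũ,ṽ)`, `μ(ũ,ṽ)`, boundary data given by the
finite-time stable ODE and initial data `u₀, v₀` (bounded by `C₁`, with `C₂`-bounded
derivatives), then `‖u‖_∞, ‖v‖_∞ ≤ C₁` and `u, v` are Lipschitz with constant
`max(KC₁^γ/c, C₂)·max(1,M₁)·exp(2TM₂C₃)`. -/
theorem stmt_14 (c K C₁ C₂ C₃ γ M₁ M₂ Cu : ℝ)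
    (hc : 0 < c) (hK : 0 < K) (hC₁ : 0 < C₁) (hC₂ : 0 < C₂) (hC₃ : 0 < C₃)
    (hγ0 : 0 < γ) (hγ1 : γ < 1)
    (T : ℝ) (hTdef : T = 1 / c + C₁ ^ (1 - γ) / ((1 - γ) * K))
    (lam mu : ℝ → ℝ → ℝ)
    (hlam_smooth : ContDiff ℝ (⊤ : ℕ∞) (fun p : ℝ × ℝ => lam p.1 p.2))
    (hmu_smooth : ContDiff ℝ (⊤ : ℕ∞) (fun p : ℝ × ℝ => mu p.1 p.2))
    (hspeed : ∀ p q : ℝ, mu p q ≤ -c ∧ c ≤ lam p q)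
    -- `M₁` bounds `λ, μ` and `M₂` their Lipschitz constants on `[-C₁,C₁]²`
    (hM₁ : ∀ p ∈ Set.Icc (-C₁) C₁, ∀ q ∈ Set.Icc (-C₁) C₁,
      |lam p q| ≤ M₁ ∧ |mu p q| ≤ M₁)
    (hM₂ : ∀ p ∈ Set.Icc (-C₁) C₁, ∀ q ∈ Set.Icc (-C₁) C₁,
      ∀ p' ∈ Set.Icc (-C₁) C₁, ∀ q' ∈ Set.Icc (-C₁) C₁,
      |lam p q - lam p' q'| ≤ M₂ * (|p - p'| + |q - q'|) ∧
      |mu p q - mu p' q'| ≤ M₂ * (|p - p'| + |q - q'|))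
    -- `(ũ,ṽ)` in the domain `D`
    (ut vt : ℝ → ℝ → ℝ)
    (hut_bd : ∀ t ∈ Set.Icc (0:ℝ) T, ∀ x ∈ Set.Icc (0:ℝ) 1, |ut t x| ≤ C₁ ∧ |vt t x| ≤ C₁)
    (hut_lip : ∀ t ∈ Set.Icc (0:ℝ) T, ∀ x ∈ Set.Icc (0:ℝ) 1,
      ∀ t' ∈ Set.Icc (0:ℝ) T, ∀ x' ∈ Set.Icc (0:ℝ) 1,
      |ut t x - ut t' x'| ≤ C₃ * (|t - t'| + |x - x'|) ∧
      |vt t x - vt t' x'| ≤ C₃ * (|t - t'| + |x - x'|))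
    -- the initial data
    (u0 v0 du0 dv0 : ℝ → ℝ)
    (hu0 : ∀ x ∈ Set.Icc (0:ℝ) 1, HasDerivWithinAt u0 (du0 x) (Set.Icc 0 1) x ∧
      HasDerivWithinAt v0 (dv0 x) (Set.Icc 0 1) x)
    (hu0_bd : ∀ x ∈ Set.Icc (0:ℝ) 1, |u0 x| ≤ C₁ ∧ |v0 x| ≤ C₁)
    (hdu0_bd : ∀ x ∈ Set.Icc (0:ℝ) 1, |du0 x| ≤ C₂ ∧ |dv0 x| ≤ C₂)
    -- the boundary data solve the finite-time stable ODE
    (ul vr : ℝ → ℝ)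
    (hul_ode : ∀ t : ℝ, 0 ≤ t → HasDerivAt ul (-K * Real.sign (ul t) * |ul t| ^ γ) t)
    (hvr_ode : ∀ t : ℝ, 0 ≤ t → HasDerivAt vr (-K * Real.sign (vr t) * |vr t| ^ γ) t)
    (hul0 : ul 0 = u0 0) (hvr0 : vr 0 = v0 1)
    -- `(u,v)` are Lipschitz solutions of the linear transport problems
    (u v : ℝ → ℝ → ℝ) (uT uX vT vX : ℝ × ℝ → ℝ)
    (huv_lip : ∀ t ∈ Set.Icc (0:ℝ) T, ∀ x ∈ Set.Icc (0:ℝ) 1,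
      ∀ t' ∈ Set.Icc (0:ℝ) T, ∀ x' ∈ Set.Icc (0:ℝ) 1,
      |u t x - u t' x'| ≤ Cu * (|t - t'| + |x - x'|) ∧
      |v t x - v t' x'| ≤ Cu * (|t - t'| + |x - x'|))
    (hpde : ∀ᵐ p : ℝ × ℝ ∂(volume.restrict (Set.Ioo (0:ℝ) T ×ˢ Set.Ioo (0:ℝ) 1)),
      HasDerivAt (fun τ => u τ p.2) (uT p) p.1 ∧
      HasDerivAt (fun ξ => u p.1 ξ) (uX p) p.2 ∧
      HasDerivAt (fun τ => v τ p.2) (vT p) p.1 ∧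
      HasDerivAt (fun ξ => v p.1 ξ) (vX p) p.2 ∧
      uT p + lam (ut p.1 p.2) (vt p.1 p.2) * uX p = 0 ∧
      vT p + mu (ut p.1 p.2) (vt p.1 p.2) * vX p = 0)
    (hbc : ∀ t ∈ Set.Icc (0:ℝ) T, u t 0 = ul t ∧ v t 1 = vr t)
    (hic : ∀ x ∈ Set.Icc (0:ℝ) 1, u 0 x = u0 x ∧ v 0 x = v0 x) :
    (∀ t ∈ Set.Icc (0:ℝ) T, ∀ x ∈ Set.Icc (0:ℝ) 1, |u t x| ≤ C₁ ∧ |v t x| ≤ C₁) ∧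
    (∀ t ∈ Set.Icc (0:ℝ) T, ∀ x ∈ Set.Icc (0:ℝ) 1,
      ∀ t' ∈ Set.Icc (0:ℝ) T, ∀ x' ∈ Set.Icc (0:ℝ) 1,
      |u t x - u t' x'| ≤
        max (K * C₁ ^ γ / c) C₂ * max 1 M₁ * Real.exp (2 * T * M₂ * C₃) *
          (|t - t'| + |x - x'|) ∧
      |v t x - v t' x'| ≤
        max (K * C₁ ^ γ / c) C₂ * max 1 M₁ * Real.exp (2 * T * M₂ * C₃) *
          (|t - t'| + |x - x'|)) := by
  have hγ : 0 < 1 - γ := sub_pos.2 hγ1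
  have hT : 0 ≤ T := hTdef ▸ by positivity
  have hexp : 2 * T * M₂ * C₃ = 2 * M₂ * C₃ * T := by ring
  rw [hexp]
  have h0' : (0 : ℝ) ∈ Set.Icc (0 : ℝ) 1 := Set.left_mem_Icc.2 zero_le_one
  have h1' : (1 : ℝ) ∈ Set.Icc (0 : ℝ) 1 := Set.right_mem_Icc.2 zero_le_one
  have hr : ∀ x ∈ Set.Icc (0 : ℝ) 1, 1 - x ∈ Set.Icc (0 : ℝ) 1 := fun x hx =>
    ⟨by linarith [hx.2], by linarith [hx.1]⟩
  have hr' : ∀ x y : ℝ, |1 - x - (1 - y)| = |x - y| := fun x y => by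
    rw [sub_sub_sub_cancel_left, abs_sub_comm]
  have hM₂0 : 0 ≤ M₂ := by
    have hm : C₁ ∈ Set.Icc (-C₁) C₁ := ⟨by linarith, le_rfl⟩
    have hm' : -C₁ ∈ Set.Icc (-C₁) C₁ := ⟨le_rfl, by linarith⟩
    have h := (abs_nonneg _).trans (hM₂ C₁ hm C₁ hm (-C₁) hm' C₁ hm).1
    rw [sub_self, abs_zero, add_zero] at h
    exact nonneg_of_mul_nonneg_left h (abs_pos.2 (by linarith))
  have hspeed_lip : ∀ t ∈ Set.Icc (0 : ℝ) T, ∀ x ∈ Set.Icc (0 : ℝ) 1,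
      ∀ t' ∈ Set.Icc (0 : ℝ) T, ∀ x' ∈ Set.Icc (0 : ℝ) 1,
      |lam (ut t x) (vt t x) - lam (ut t' x') (vt t' x')| ≤
        2 * M₂ * C₃ * (|t - t'| + |x - x'|) ∧
      |mu (ut t x) (vt t x) - mu (ut t' x') (vt t' x')| ≤
        2 * M₂ * C₃ * (|t - t'| + |x - x'|) := by
    intro t ht x hx t' ht' x' hx'
    have hb := hut_bd t ht x hx
    have hb' := hut_bd t' ht' x' hx'
    have hl := hut_lip t ht x hx t' ht' x' hx'
    have h := hM₂ _ (abs_le.1 hb.1) _ (abs_le.1 hb.2) _ (abs_le.1 hb'.1) _ (abs_le.1 hb'.2)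
    have h2 := mul_le_mul_of_nonneg_left (add_le_add hl.1 hl.2) hM₂0
    exact ⟨by linarith [h.1], by linarith [h.2]⟩
  rw [ae_restrict_iff' (measurableSet_Ioo.prod measurableSet_Ioo)] at hpde
  have hul_bd : |ul 0| ≤ C₁ := hul0 ▸ (hu0_bd 0 h0').1
  have hvr_bd : |vr 0| ≤ C₁ := hvr0 ▸ (hu0_bd 1 h1').2
  have hu := bound_and_lipschitz_of_ae (a := fun t x => lam (ut t x) (vt t x)) (w := u)
    (wT := uT) (wX := uX) (M := M₁) (L := 2 * M₂ * C₃) (B := K * C₁ ^ γ) (D := C₂) (S := C₁)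
    hc hT
    (fun t ht x hx => ⟨(hspeed _ _).2, (le_abs_self _).trans
      (hM₁ _ (abs_le.1 (hut_bd t ht x hx).1) _ (abs_le.1 (hut_bd t ht x hx).2)).1⟩)
    (fun t ht x hx t' ht' x' hx' => (hspeed_lip t ht x hx t' ht' x' hx').1)
    (fun t ht x hx t' ht' x' hx' => (huv_lip t ht x hx t' ht' x' hx').1)
    (by
      filter_upwards [hpde] with p hp hpm
      obtain ⟨h1, h2, -, -, h3, -⟩ := hp hpm
      exact ⟨h1, h2, h3⟩)
    (fun s hs t ht => by
      rw [(hbc s hs).1, (hbc t ht).1]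
      exact abs_sub_le_of_finite_time_ode hK.le hγ0.le hul_ode hul_bd hs.1 ht.1)
    (fun x hx y hy => by
      rw [(hic x hx).1, (hic y hy).1]
      exact (convex_Icc (0 : ℝ) 1).norm_image_sub_le_of_norm_hasDerivWithin_le
        (fun z hz => (hu0 z hz).1) (fun z hz => (hdu0_bd z hz).1) hy hx)
    (fun t ht => by
      rw [(hbc t ht).1]
      exact abs_le_of_finite_time_ode hK.le hul_ode hul_bd ht.1)
    (fun x hx => by
      rw [(hic x hx).1]
      exact (hu0_bd x hx).1)
  have hv := bound_and_lipschitz_of_ae (a := fun t x => -mu (ut t (1 - x)) (vt t (1 - x)))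
    (w := fun t x => v t (1 - x)) (wT := fun p => vT (p.1, 1 - p.2))
    (wX := fun p => -vX (p.1, 1 - p.2)) (M := M₁) (L := 2 * M₂ * C₃) (B := K * C₁ ^ γ)
    (D := C₂) (S := C₁) hc hT
    (fun t ht x hx => ⟨le_neg.2 (hspeed _ _).1, (neg_le_abs _).trans
      (hM₁ _ (abs_le.1 (hut_bd t ht _ (hr x hx)).1) _
        (abs_le.1 (hut_bd t ht _ (hr x hx)).2)).2⟩)
    (fun t ht x hx t' ht' x' hx' => by
      have h := (hspeed_lip t ht _ (hr x hx) t' ht' _ (hr x' hx')).2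
      rwa [hr', ← abs_neg, neg_sub'] at h)
    (fun t ht x hx t' ht' x' hx' => by
      have h := (huv_lip t ht _ (hr x hx) t' ht' _ (hr x' hx')).2
      rwa [hr'] at h)
    (by
      have hmp : MeasurePreserving (fun p : ℝ × ℝ => (p.1, 1 - p.2)) volume volume :=
        (MeasurePreserving.id volume).prod (volume.measurePreserving_sub_left (1 : ℝ))
      filter_upwards [hmp.quasiMeasurePreserving.ae hpde] with p hp hpm
      obtain ⟨-, -, h1, h2, -, h3⟩ := hp ⟨hpm.1, by dsimp only; linarith [hpm.2.2],
        by dsimp only; linarith [hpm.2.1]⟩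
      refine ⟨h1, ?_, by linear_combination h3⟩
      simpa using h2.comp_const_sub 1 p.2)
    (fun s hs t ht => by
      simp only [sub_zero]
      rw [(hbc s hs).2, (hbc t ht).2]
      exact abs_sub_le_of_finite_time_ode hK.le hγ0.le hvr_ode hvr_bd hs.1 ht.1)
    (fun x hx y hy => by
      rw [(hic _ (hr x hx)).2, (hic _ (hr y hy)).2, ← hr' x y]
      exact (convex_Icc (0 : ℝ) 1).norm_image_sub_le_of_norm_hasDerivWithin_le
        (fun z hz => (hu0 z hz).2) (fun z hz => (hdu0_bd z hz).2) (hr y hy) (hr x hx))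
    (fun t ht => by
      simp only [sub_zero]
      rw [(hbc t ht).2]
      exact abs_le_of_finite_time_ode hK.le hvr_ode hvr_bd ht.1)
    (fun x hx => by
      rw [(hic _ (hr x hx)).2]
      exact (hu0_bd _ (hr x hx)).2)
  refine ⟨fun t ht x hx => ⟨hu.1 t ht x hx, ?_⟩,
    fun t ht x hx t' ht' x' hx' => ⟨hu.2 t ht x hx t' ht' x' hx', ?_⟩⟩
  · simpa using hv.1 t ht (1 - x) (hr x hx)
  · have h := hv.2 t ht (1 - x) (hr x hx) t' ht' (1 - x') (hr x' hx')
    rwa [hr', sub_sub_cancel, sub_sub_cancel] at h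
end
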